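/- For any strictly increasing sequence (s_n)_{n≥1} of positive integers and any real number ξ>0, for Lebesgue-almost all x>1 one has limsup_{N→∞} √N · D_N({ξ x^{s_n}}) / √(log log N) = limsup_{N→∞} √N · D_N^*({ξ x^{s_n}}) / √(log log N) = 1/√2, where {·} denotes the fractional part. -/

import Mathlib

open MeasureTheory Filter

/-- The (extremal) discrepancy of the first `N` terms (indexed `1,…,N`) of `z`. -/
noncomputable def discrepancy (N : ℕ) (z : ℕ → ℝ) : ℝ :=
  sSup { d : ℝ | ∃ a b : ℝ, 0 ≤ a ∧ a < b ∧ b ≤ 1 ∧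
    d = |(∑ n ∈ Finset.Icc 1 N,
        Set.indicator (Set.Ico a b) (fun _ => (1 : ℝ)) (z n)) / N - (b - a)| }

/-- The star discrepancy of the first `N` terms (indexed `1,…,N`) of `z`. -/
noncomputable def starDiscrepancy (N : ℕ) (z : ℕ → ℝ) : ℝ :=
  sSup { d : ℝ | ∃ a : ℝ, 0 < a ∧ a ≤ 1 ∧
    d = |(∑ n ∈ Finset.Icc 1 N,
        Set.indicator (Set.Ico 0 a) (fun _ => (1 : ℝ)) (z n)) / N - a| }

namespace LIL
open Polynomial

lemma signVar_le (P : ℝ[X]) : P.signVariations ≤ P.support.card := by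
  induction hn : P.support.card generalizing P with
  | zero =>
    have : P = 0 := by simpa using hn
    subst this; simp
  | succ n ih =>
    have h1 := Polynomial.signVariations_le_eraseLead_succ (P := P)
    have h2 : P.eraseLead.support.card = n := by
      exact Polynomial.card_support_eraseLead' hn
    have := ih _ h2
    omega

/-- positive roots as a finset -/
noncomputable def posRoots (P : ℝ[X]) : Finset ℝ := P.roots.toFinset.filter (0 < ·)

lemma card_posRoots_le (P : ℝ[X]) : (posRoots P).card ≤ P.support.card := by
  refine le_trans ?_ ((Polynomial.roots_countP_pos_le_signVariations (P := P)).trans (signVar_le P))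
  rw [Multiset.countP_eq_card_filter, posRoots, ← Multiset.toFinset_filter]
  exact Multiset.toFinset_card_le _

lemma mem_posRoots {P : ℝ[X]} (hP : P ≠ 0) {x : ℝ} (hx : 0 < x) (h : P.eval x = 0) :
    x ∈ posRoots P := by
  simp [posRoots, hP, hx, h]

/-- sign constancy -/
lemma sign_const {P : ℝ[X]} (hP : P ≠ 0) {a b : ℝ} (ha : 0 ≤ a)
    (hZ : ∀ z ∈ posRoots P, z ∉ Set.Ioo a b) :
    (∀ x ∈ Set.Ioo a b, 0 < P.eval x) ∨ (∀ x ∈ Set.Ioo a b, P.eval x < 0) := by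
  by_contra hcon
  push Not at hcon
  obtain ⟨⟨x, hx, hx0⟩, ⟨y, hy, hy0⟩⟩ := hcon
  have hpc : IsPreconnected (Set.Ioo a b) := isPreconnected_Ioo
  have hc : ContinuousOn (fun x => P.eval x) (Set.Ioo a b) := P.continuous.continuousOn
  obtain ⟨z, hz, hz0⟩ := hpc.intermediate_value hx hy hc ⟨hx0, hy0⟩
  exact hZ z (mem_posRoots hP (lt_of_le_of_lt ha hz.1) hz0) hz

lemma split_bound (F : ℝ → ℝ → ℝ) (A B M : ℝ) (hM : 0 ≤ M) (Z : Finset ℝ)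
    (hsub : ∀ a b c, A ≤ a → a ≤ b → b ≤ c → c ≤ B → F a c ≤ F a b + F b c)
    (hfree : ∀ a b, A ≤ a → a ≤ b → b ≤ B → (∀ z ∈ Z, z ∉ Set.Ioo a b) → F a b ≤ M)
    (hAB : A ≤ B) : F A B ≤ (Z.card + 1) * M := by
  have key : ∀ n : ℕ, ∀ a b, A ≤ a → a ≤ b → b ≤ B →
      (Z.filter (fun z => z ∈ Set.Ioo a b)).card ≤ n → F a b ≤ (n + 1) * M := by
    intro n
    induction n with
    | zero =>
      intro a b ha hab hb hc
      have h0 : Z.filter (fun z => z ∈ Set.Ioo a b) = ∅ := by simpa using hc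
      have := hfree a b ha hab hb (by
        intro z hz hz2
        have : z ∈ Z.filter (fun z => z ∈ Set.Ioo a b) := Finset.mem_filter.2 ⟨hz, hz2⟩
        rw [h0] at this; simp at this)
      simpa using this
    | succ n ih =>
      intro a b ha hab hb hc
      by_cases hne : (Z.filter (fun z => z ∈ Set.Ioo a b)).Nonempty
      · -- take the smallest
        set W := Z.filter (fun z => z ∈ Set.Ioo a b) with hW
        set z := W.min' hne with hz
        have hzW : z ∈ W := Finset.min'_mem _ _
        have hz1 := Finset.mem_filter.1 hzW
        have h1 : F a z ≤ M := by
          refine hfree a z ha hz1.2.1.le (hz1.2.2.le.trans hb) ?_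
          intro y hy hy2
          have : y ∈ W := Finset.mem_filter.2 ⟨hy, hy2.1, hy2.2.trans hz1.2.2⟩
          have := Finset.min'_le W y this
          exact absurd hy2.2 (not_lt.2 this)
        have h2 : F z b ≤ (n + 1) * M := by
          refine ih z b (ha.trans hz1.2.1.le) hz1.2.2.le hb ?_
          have hlt : (Z.filter (fun y => y ∈ Set.Ioo z b)).card < W.card := by
            refine Finset.card_lt_card ?_
            refine (Finset.ssubset_iff_of_subset ?_).2 ⟨z, hzW, by simp⟩
            intro y hy
            rw [Finset.mem_filter] at hy ⊢
            exact ⟨hy.1, hz1.2.1.trans hy.2.1, hy.2.2⟩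
          omega
        have := hsub a z b ha hz1.2.1.le hz1.2.2.le hb
        push_cast
        nlinarith
      · have h0 : Z.filter (fun z => z ∈ Set.Ioo a b) = ∅ := Finset.not_nonempty_iff_eq_empty.1 hne
        have := ih a b ha hab hb (by rw [h0]; simp)
        push_cast
        nlinarith
  exact key Z.card A B le_rfl hAB le_rfl (Finset.card_filter_le _ _)

/-- measure of sublevel sets -/
noncomputable def subl (Q : ℝ[X]) (l a b : ℝ) : ℝ :=
  (volume {x : ℝ | x ∈ Set.Ioc a b ∧ |Q.eval x| < l}).toReal

lemma subl_meas (Q : ℝ[X]) (l a b : ℝ) :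
    MeasurableSet {x : ℝ | x ∈ Set.Ioc a b ∧ |Q.eval x| < l} := by
  apply MeasurableSet.inter measurableSet_Ioc
  exact measurableSet_lt (Q.continuous.abs.measurable) measurable_const

lemma subl_ne_top (Q : ℝ[X]) (l a b : ℝ) :
    volume {x : ℝ | x ∈ Set.Ioc a b ∧ |Q.eval x| < l} ≠ ⊤ := by
  refine ne_top_of_le_ne_top (b := volume (Set.Ioc a b)) (by simp) (measure_mono ?_)
  intro x hx; exact hx.1

lemma subl_nonneg (Q : ℝ[X]) (l a b : ℝ) : 0 ≤ subl Q l a b := ENNReal.toReal_nonneg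

lemma subl_add (Q : ℝ[X]) (l a b c : ℝ) (hab : a ≤ b) (hbc : b ≤ c) :
    subl Q l a c = subl Q l a b + subl Q l b c := by
  unfold subl
  rw [← ENNReal.toReal_add (subl_ne_top _ _ _ _) (subl_ne_top _ _ _ _), ← measure_union]
  · congr 2
    ext x
    simp only [Set.mem_ofPred_eq, Set.mem_union, Set.mem_Ioc]
    constructor
    · rintro ⟨⟨h1, h2⟩, h3⟩
      rcases le_or_gt x b with h | h
      · exact Or.inl ⟨⟨h1, h⟩, h3⟩
      · exact Or.inr ⟨⟨h, h2⟩, h3⟩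
    · rintro (⟨⟨h1, h2⟩, h3⟩ | ⟨⟨h1, h2⟩, h3⟩)
      · exact ⟨⟨h1, h2.trans hbc⟩, h3⟩
      · exact ⟨⟨lt_of_le_of_lt hab h1, h2⟩, h3⟩
  · rw [Set.disjoint_left]
    rintro x ⟨⟨_, h1⟩, _⟩ ⟨⟨h2, _⟩, _⟩
    linarith
  · exact subl_meas _ _ _ _

lemma subl_le_len (Q : ℝ[X]) (l a b : ℝ) (hab : a ≤ b) : subl Q l a b ≤ b - a := by
  unfold subl
  refine ENNReal.toReal_le_of_le_ofReal (by linarith) ?_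
  rw [← Real.volume_Ioc]
  exact measure_mono (fun x hx => hx.1)

lemma subl_full (Q : ℝ[X]) (l a b : ℝ) (hab : a ≤ b) (h : ∀ x ∈ Set.Ioo a b, |Q.eval x| < l) :
    subl Q l a b = b - a := by
  refine le_antisymm (subl_le_len _ _ _ _ hab) ?_
  unfold subl
  rw [← ENNReal.toReal_ofReal (show 0 ≤ b - a by linarith), ← Real.volume_Ioo]
  refine ENNReal.toReal_mono (subl_ne_top _ _ _ _) (measure_mono ?_)
  intro x hx
  exact ⟨⟨hx.1, hx.2.le⟩, h x hx⟩

lemma subl_empty (Q : ℝ[X]) (l a b : ℝ) (h : ∀ x ∈ Set.Ioo a b, l ≤ |Q.eval x|) :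
    subl Q l a b = 0 := by
  unfold subl
  have : volume {x : ℝ | x ∈ Set.Ioc a b ∧ |Q.eval x| < l} = 0 := by
    refine measure_mono_null (t := {b}) ?_ (by simp)
    rintro x ⟨⟨h1, h2⟩, h3⟩
    rcases h2.lt_or_eq with h4 | h4
    · exact absurd (h x ⟨h1, h4⟩) (not_le.2 h3)
    · simp [h4]
  rw [this]; rfl

lemma abs_trichotomy {Q : ℝ[X]} {l a b : ℝ} (ha : 0 ≤ a)
    (hQ : 1 ≤ Q.natDegree) (h1 : ∀ z ∈ posRoots (Q - C l), z ∉ Set.Ioo a b)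
    (h2 : ∀ z ∈ posRoots (Q + C l), z ∉ Set.Ioo a b) :
    (∀ x ∈ Set.Ioo a b, |Q.eval x| < l) ∨ (∀ x ∈ Set.Ioo a b, l < Q.eval x) ∨
      (∀ x ∈ Set.Ioo a b, Q.eval x < -l) := by
  have n1 : Q - C l ≠ 0 := by
    intro h
    have : Q = C l := by rwa [sub_eq_zero] at h
    rw [this] at hQ; simp at hQ
  have n2 : Q + C l ≠ 0 := by
    intro h
    have : Q = C (-l) := by rw [C_neg]; exact eq_neg_of_add_eq_zero_left h
    rw [this] at hQ; simp at hQ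
  rcases sign_const n1 ha h1 with h | h
  · right; left
    intro x hx; have := h x hx; simp at this; linarith
  · rcases sign_const n2 ha h2 with h' | h'
    · left
      intro x hx
      have h1 := h x hx
      have h2 := h' x hx
      simp at h1 h2
      rw [abs_lt]; constructor <;> linarith
    · right; right
      intro x hx
      have h2 := h' x hx
      simp at h2
      linarith

lemma card_supp_C (Q : ℝ[X]) (l : ℝ) : (Q - C l).support.card ≤ Q.support.card + 1 ∧
    (Q + C l).support.card ≤ Q.support.card + 1 := by
  constructor
  · rw [sub_eq_add_neg, ← C_neg]
    refine (Finset.card_le_card Polynomial.support_add).trans ?_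
    refine (Finset.card_union_le _ _).trans ?_
    gcongr
    refine (Finset.card_le_card (Polynomial.support_C_subset _)).trans (by simp)
  · refine (Finset.card_le_card Polynomial.support_add).trans ?_
    refine (Finset.card_union_le _ _).trans ?_
    gcongr
    refine (Finset.card_le_card (Polynomial.support_C_subset _)).trans (by simp)

end LIL

namespace LIL
open Polynomial

lemma subl_step (Q Q1 : ℝ[X]) (m1 m r : ℕ) (A B l T : ℝ)
    (hQ1 : ∀ x : ℝ, x * (derivative Q).eval x = Q1.eval x + m1 * Q.eval x)
    (hm : m1 ≤ m) (hd : 1 ≤ Q.natDegree) (hd1 : 1 ≤ Q1.natDegree)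
    (hr : Q.support.card ≤ r) (hr1 : Q1.support.card ≤ r) (hA : 1 ≤ A) (hAB : A ≤ B)
    (hl : 0 < l) (hT : 2 * m ≤ T) (hT0 : 0 < T) :
    subl Q l A B ≤ subl Q1 (T * l) A B + (4 * (r + 1) + 1) * (4 * B / T) := by
  have hB : 0 < B := by linarith
  set Z : Finset ℝ := (posRoots (Q - C l) ∪ posRoots (Q + C l)) ∪
    (posRoots (Q1 - C (T * l)) ∪ posRoots (Q1 + C (T * l))) with hZ
  have hcard : Z.card ≤ 4 * (r + 1) := by
    have h1 := card_supp_C Q l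
    have h2 := card_supp_C Q1 (T * l)
    have c1 := card_posRoots_le (Q - C l)
    have c2 := card_posRoots_le (Q + C l)
    have c3 := card_posRoots_le (Q1 - C (T * l))
    have c4 := card_posRoots_le (Q1 + C (T * l))
    have u1 := Finset.card_union_le (posRoots (Q - C l) ∪ posRoots (Q + C l))
      (posRoots (Q1 - C (T * l)) ∪ posRoots (Q1 + C (T * l)))
    have u2 := Finset.card_union_le (posRoots (Q - C l)) (posRoots (Q + C l))
    have u3 := Finset.card_union_le (posRoots (Q1 - C (T * l))) (posRoots (Q1 + C (T * l)))
    rw [← hZ] at u1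
    omega
  have hM : 0 ≤ 4 * B / T := by positivity
  have main := split_bound (fun a b => subl Q l a b - subl Q1 (T * l) a b) A B (4 * B / T) hM Z
    (by
      intro a b c _ hab hbc _
      rw [subl_add Q l a b c hab hbc, subl_add Q1 (T * l) a b c hab hbc]
      linarith)
    (by
      intro a b ha hab hb hfree
      have ha0 : 0 ≤ a := by linarith
      have t1 := abs_trichotomy (Q := Q) (l := l) (a := a) (b := b) ha0 hd
        (fun z hz => hfree z (by simp [hZ, hz])) (fun z hz => hfree z (by simp [hZ, hz]))
      have t2 := abs_trichotomy (Q := Q1) (l := T * l) (a := a) (b := b) ha0 hd1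
        (fun z hz => hfree z (by rw [hZ]; simp only [Finset.mem_union, hz, or_true, true_or])) (fun z hz => hfree z (by rw [hZ]; simp only [Finset.mem_union, hz, or_true, true_or]))
      rcases t2 with t2 | t2
      · rw [subl_full Q1 (T * l) a b hab t2]
        have := subl_le_len Q l a b hab
        linarith
      have n1 := subl_nonneg Q1 (T * l) a b
      rcases t1 with t1 | t1
      swap
      · have : subl Q l a b = 0 := by
          apply subl_empty
          intro x hx
          rcases t1 with t1 | t1
          · exact (t1 x hx).le.trans (le_abs_self _)
          · have := t1 x hx
            exact (by linarith : l ≤ -eval x Q).trans (neg_le_abs _)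
        rw [this]; linarith
      have hlen : b - a ≤ 4 * B / T := by
        rcases hab.lt_or_eq with hlt | heq
        swap
        · rw [heq]; simpa using hM
        have hcl : ∀ x ∈ Set.Icc a b, |Q.eval x| ≤ l := by
          intro x hx
          have hcl : IsClosed {x : ℝ | |Q.eval x| ≤ l} :=
            isClosed_le (Q.continuous.abs) continuous_const
          have hsub : Set.Ioo a b ⊆ {x : ℝ | |Q.eval x| ≤ l} := fun x hx => (t1 x hx).le
          have := closure_minimal hsub hcl
          rw [closure_Ioo hlt.ne] at this
          exact this hx
        have ba := abs_le.1 (hcl a ⟨le_rfl, hab⟩)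
        have bb := abs_le.1 (hcl b ⟨hab, le_rfl⟩)
        have hmr : (m1 : ℝ) ≤ m := by exact_mod_cast hm
        have hml : ∀ x ∈ Set.Ioo a b, |(m1 : ℝ) * Q.eval x| ≤ T * l / 2 := by
          intro x hx
          rw [abs_mul, abs_of_nonneg (by positivity : (0:ℝ) ≤ m1)]
          have := (t1 x hx).le
          have h0 := abs_nonneg (eval x Q)
          calc (m1 : ℝ) * |eval x Q| ≤ (T / 2) * l := by
                apply mul_le_mul _ this h0 (by positivity)
                linarith
            _ = _ := by ring
        have key : T * l / (2 * B) * (b - a) ≤ 2 * l := by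
          rcases t2 with t2 | t2
          · have hder : ∀ x ∈ interior (Set.Icc a b), T * l / (2 * B) ≤ deriv (fun x => Q.eval x) x := by
              intro x hx
              rw [interior_Icc] at hx
              rw [Polynomial.deriv]
              have h1 := hQ1 x
              have h2 := t2 x hx
              have h3 := (abs_le.1 (hml x hx)).1
              have hx0 : 0 < x := by linarith [hx.1]
              have hxB : x ≤ B := by linarith [hx.2]
              have h4 : T * l / 2 ≤ x * eval x (derivative Q) := by linarith
              have h5 : 0 < eval x (derivative Q) := by
                by_contra hneg
                have : 0 < T * l / 2 := by positivity
                nlinarith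
              rw [div_le_iff₀ (by positivity)]
              nlinarith
            have := (convex_Icc a b).mul_sub_le_image_sub_of_le_deriv (f := fun x => Q.eval x)
              Q.continuous.continuousOn Q.differentiable.differentiableOn hder
              a ⟨le_rfl, hab⟩ b ⟨hab, le_rfl⟩ hab
            linarith
          · have hder : ∀ x ∈ interior (Set.Icc a b), deriv (fun x => Q.eval x) x ≤ - (T * l / (2 * B)) := by
              intro x hx
              rw [interior_Icc] at hx
              rw [Polynomial.deriv]
              have h1 := hQ1 x
              have h2 := t2 x hx
              have h3 := (abs_le.1 (hml x hx)).2
              have hx0 : 0 < x := by linarith [hx.1]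
              have hxB : x ≤ B := by linarith [hx.2]
              have h4 : x * eval x (derivative Q) ≤ -(T * l / 2) := by linarith
              have h5 : eval x (derivative Q) < 0 := by
                by_contra hneg
                have : 0 < T * l / 2 := by positivity
                nlinarith
              rw [le_neg, div_le_iff₀ (by positivity)]
              nlinarith
            have := (convex_Icc a b).image_sub_le_mul_sub_of_deriv_le (f := fun x => Q.eval x)
              Q.continuous.continuousOn Q.differentiable.differentiableOn hder
              a ⟨le_rfl, hab⟩ b ⟨hab, le_rfl⟩ hab
            linarith
        rw [le_div_iff₀ hT0]
        have e : T * l / (2 * B) * (b - a) = ((b - a) * T) * (l / (2 * B)) := by ring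
        have e2 : 2 * l = (4 * B) * (l / (2 * B)) := by field_simp; ring
        rw [e, e2] at key
        exact le_of_mul_le_mul_right key (by positivity)
      have := subl_le_len Q l a b hab
      linarith)
    hAB
  have hc : (Z.card : ℝ) ≤ 4 * (r + 1) := by exact_mod_cast hcard
  have : ((Z.card : ℝ) + 1) * (4 * B / T) ≤ (4 * (r + 1) + 1) * (4 * B / T) := by gcongr
  linarith

lemma subl_bound (r m : ℕ) (A B T c : ℝ) (hA : 1 ≤ A) (hAB : A ≤ B) (hm : 1 ≤ m)
    (hT : 2 * m ≤ T) (hc : 0 < c) (k : ℕ) :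
    ∀ (Q : ℝ[X]) (l : ℝ), 0 < l → Q.support.card = k + 1 → k + 1 ≤ r → Q.natDegree = m →
      c ≤ |Q.leadingCoeff| → l * T ^ k ≤ c * A ^ m →
      subl Q l A B ≤ k * ((4 * (r + 1) + 1) * (4 * B / T)) := by
  have hm' : (1 : ℝ) ≤ m := by exact_mod_cast hm
  have hT0 : 0 < T := by linarith
  induction k with
  | zero =>
    intro Q l hl hcard hr hdeg hlead hsize
    obtain ⟨n, a, ha, hQ⟩ := Polynomial.card_support_eq_one.1 hcard
    have hn : n = m := by rw [← hdeg, hQ, natDegree_C_mul_X_pow _ _ ha]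
    have hla : Q.leadingCoeff = a := by rw [hQ, leadingCoeff_C_mul_X_pow]
    rw [subl_empty]
    · simp
    · intro x hx
      rw [hQ]
      simp only [eval_mul, eval_C, eval_pow, eval_X]
      rw [abs_mul, abs_pow, abs_of_nonneg (by linarith [hx.1] : 0 ≤ x), hn]
      rw [hla] at hlead
      have : A ^ m ≤ x ^ m := pow_le_pow_left₀ (by linarith) hx.1.le m
      calc l = l * T ^ 0 := by simp
        _ ≤ c * A ^ m := hsize
        _ ≤ |a| * x ^ m := by gcongr
  | succ k ih =>
    intro Q l hl hcard hr hdeg hlead hsize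
    have hQ0 : Q ≠ 0 := by rintro rfl; simp at hcard
    set m1 := Q.natTrailingDegree with hm1
    set Q1 : ℝ[X] := X * derivative Q - C (m1 : ℝ) * Q with hQ1
    have hcoeff : ∀ i, Q1.coeff i = ((i : ℝ) - m1) * Q.coeff i := by
      intro i
      rw [hQ1, coeff_sub, coeff_C_mul]
      cases i with
      | zero => simp
      | succ i => rw [coeff_X_mul, coeff_derivative]; push_cast; ring
    have hsupp : Q1.support = Q.support.erase m1 := by
      ext i
      rw [Finset.mem_erase, mem_support_iff, mem_support_iff, hcoeff]
      rw [mul_ne_zero_iff, sub_ne_zero]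
      simp
    have hmem : m1 ∈ Q.support := by
      rw [mem_support_iff]
      exact mt trailingCoeff_eq_zero.1 hQ0
    have hcard1 : Q1.support.card = k + 1 := by
      rw [hsupp, Finset.card_erase_of_mem hmem, hcard]; rfl
    have hne : m1 ≠ m := by
      intro h
      have : Q.support ⊆ {m} := by
        intro i hi
        have h1 := natTrailingDegree_le_of_mem_supp i hi
        have h2 := le_natDegree_of_mem_supp i hi
        simp; omega
      have := Finset.card_le_card this
      simp at this; omega
    have hle : m1 ≤ m := by rw [← hdeg]; exact natTrailingDegree_le_natDegree Q
    have hlt : m1 < m := lt_of_le_of_ne hle hne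
    have hlc : Q.coeff m ≠ 0 := by
      rw [← hdeg]; exact mt leadingCoeff_eq_zero.1 hQ0
    have hlcm : Q1.coeff m ≠ 0 := by
      rw [hcoeff]
      refine mul_ne_zero ?_ hlc
      rw [sub_ne_zero]; exact_mod_cast hne.symm
    have hdeg1 : Q1.natDegree = m := by
      refine le_antisymm ?_ (le_natDegree_of_ne_zero hlcm)
      refine natDegree_le_iff_coeff_eq_zero.2 ?_
      intro N hN
      rw [hcoeff, coeff_eq_zero_of_natDegree_lt (by omega), mul_zero]
    have hlead1 : c ≤ |Q1.leadingCoeff| := by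
      rw [leadingCoeff, hdeg1, hcoeff, abs_mul]
      rw [leadingCoeff, hdeg] at hlead
      have : (1 : ℝ) ≤ |(m : ℝ) - m1| := by
        have : (m1 : ℝ) + 1 ≤ m := by exact_mod_cast hlt
        rw [abs_of_nonneg (by linarith)]; linarith
      nlinarith [abs_nonneg (Q.coeff m)]
    have h1 := ih Q1 (T * l) (by positivity) hcard1 (by omega) hdeg1 hlead1 (by
      calc T * l * T ^ k = l * T ^ (k + 1) := by ring
        _ ≤ _ := hsize)
    have h2 := subl_step Q Q1 m1 m r A B l T (by
      intro x
      rw [hQ1]; simp) hle (by omega) (by omega) (by omega) (by omega) hA hAB hl hT hT0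
    push_cast
    linarith

end LIL

namespace LIL
open Polynomial

/-- `e(y) = exp(2πiy)` -/
noncomputable def ee (y : ℝ) : ℂ := Complex.exp (2 * Real.pi * Complex.I * y)

lemma norm_ee (y : ℝ) : ‖ee y‖ = 1 := by
  unfold ee
  rw [show (2 * Real.pi * Complex.I * y : ℂ) = ((2 * Real.pi * y : ℝ) : ℂ) * Complex.I by
    push_cast; ring]
  exact Complex.norm_exp_ofReal_mul_I _

lemma continuous_ee : Continuous ee := by unfold ee; fun_prop

lemma hasDerivAt_ee_poly (P : ℝ[X]) (x : ℝ) :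
    HasDerivAt (fun x => ee (P.eval x))
      (ee (P.eval x) * (2 * Real.pi * Complex.I * ((derivative P).eval x : ℝ))) x := by
  unfold ee
  have h := (P.hasDerivAt x).ofReal_comp
  exact (h.const_mul (2 * Real.pi * Complex.I)).cexp

lemma fdt (P : ℝ[X]) (a b l : ℝ) (hab : a ≤ b) (hl : 0 < l)
    (h1 : (∀ x ∈ Set.Icc a b, l ≤ (derivative P).eval x) ∨
      (∀ x ∈ Set.Icc a b, (derivative P).eval x ≤ -l))
    (h2 : (∀ x ∈ Set.Icc a b, 0 ≤ (derivative (derivative P)).eval x) ∨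
      (∀ x ∈ Set.Icc a b, (derivative (derivative P)).eval x ≤ 0)) :
    ‖∫ x in a..b, ee (P.eval x)‖ ≤ 1 / l := by
  set p1 : ℝ → ℝ := fun x => (derivative P).eval x with hp1
  set p2 : ℝ → ℝ := fun x => (derivative (derivative P)).eval x with hp2
  have hpi := Real.pi_gt_three
  have habs : ∀ x ∈ Set.Icc a b, l ≤ |p1 x| := by
    intro x hx
    rcases h1 with h1 | h1
    · exact (h1 x hx).trans (le_abs_self _)
    · have := h1 x hx
      exact (by simp only [hp1]; linarith : l ≤ -p1 x).trans (neg_le_abs _)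
  have hne : ∀ x ∈ Set.Icc a b, p1 x ≠ 0 := by
    intro x hx h
    have := habs x hx
    rw [h] at this; simp at this; linarith
  have c1 : Continuous p1 := (derivative P).continuous
  have c2 : Continuous p2 := (derivative (derivative P)).continuous
  have cee : Continuous (fun x => ee (P.eval x)) := continuous_ee.comp P.continuous
  have hinv : ∀ x ∈ Set.Icc a b, HasDerivAt (fun x => (p1 x)⁻¹) (-p2 x / (p1 x) ^ 2) x := by
    intro x hx
    exact ((derivative P).hasDerivAt x).inv (hne x hx)
  have hcont : ContinuousOn (fun x => -p2 x / (p1 x) ^ 2) (Set.Icc a b) := by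
    refine ContinuousOn.div c2.neg.continuousOn (c1.pow 2).continuousOn ?_
    intro x hx; exact pow_ne_zero _ (hne x hx)
  have hint : IntervalIntegrable (fun x => -p2 x / (p1 x) ^ 2) volume a b := by
    apply ContinuousOn.intervalIntegrable; rwa [Set.uIcc_of_le hab]
  set κ : ℂ := (2 * Real.pi * Complex.I)⁻¹ with hκ
  have hκ0 : (2 * Real.pi * Complex.I : ℂ) ≠ 0 := by simp [Real.pi_ne_zero]
  have hκn : ‖κ‖ = (2 * Real.pi)⁻¹ := by
    rw [hκ, norm_inv]; simp [abs_of_pos Real.pi_pos]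
  have hF : ∀ x ∈ Set.Icc a b, HasDerivAt (fun x => ee (P.eval x) * (κ * ((p1 x)⁻¹ : ℝ)))
      (ee (P.eval x) + ee (P.eval x) * (κ * ((-p2 x / (p1 x) ^ 2 : ℝ) : ℂ))) x := by
    intro x hx
    have := (hasDerivAt_ee_poly P x).mul (((hinv x hx).ofReal_comp).const_mul κ)
    refine this.congr_deriv ?_
    have hx0 : ((p1 x : ℝ) : ℂ) ≠ 0 := by exact_mod_cast hne x hx
    congr 1
    rw [hκ]
    push_cast
    change ee (eval x P) * (2 * Real.pi * Complex.I * ((p1 x : ℝ) : ℂ)) * _ = _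
    field_simp
  have hcont2 : ContinuousOn (fun x => ee (P.eval x) * (κ * ((-p2 x / (p1 x) ^ 2 : ℝ) : ℂ)))
      (Set.Icc a b) := by
    refine cee.continuousOn.mul (continuousOn_const.mul ?_)
    exact Complex.continuous_ofReal.comp_continuousOn hcont
  have hint2 : IntervalIntegrable (fun x => ee (P.eval x) * (κ * ((-p2 x / (p1 x) ^ 2 : ℝ) : ℂ)))
      volume a b := by
    apply ContinuousOn.intervalIntegrable; rwa [Set.uIcc_of_le hab]
  have hint3 : IntervalIntegrable (fun x => ee (P.eval x)) volume a b :=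
    cee.intervalIntegrable _ _
  have ftc := intervalIntegral.integral_eq_sub_of_hasDerivAt
    (fun x hx => hF x (by rwa [Set.uIcc_of_le hab] at hx)) (hint3.add hint2)
  rw [intervalIntegral.integral_add hint3 hint2] at ftc
  have ftc2 := intervalIntegral.integral_eq_sub_of_hasDerivAt
    (fun x hx => hinv x (by rwa [Set.uIcc_of_le hab] at hx)) hint
  have ha : a ∈ Set.Icc a b := ⟨le_rfl, hab⟩
  have hb : b ∈ Set.Icc a b := ⟨hab, le_rfl⟩
  have hinvb : ∀ x ∈ Set.Icc a b, |(p1 x)⁻¹| ≤ l⁻¹ := by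
    intro x hx
    rw [abs_inv]
    exact inv_anti₀ hl (habs x hx)
  have bd : ∀ x ∈ Set.Icc a b, ‖ee (P.eval x) * (κ * ((p1 x)⁻¹ : ℝ))‖ ≤ (2 * Real.pi)⁻¹ * l⁻¹ := by
    intro x hx
    rw [norm_mul, norm_mul, norm_ee, one_mul, hκn, Complex.norm_real, Real.norm_eq_abs]
    gcongr
    exact hinvb x hx
  have bd2 : ‖∫ x in a..b, ee (P.eval x) * (κ * ((-p2 x / (p1 x) ^ 2 : ℝ) : ℂ))‖ ≤
      (2 * Real.pi)⁻¹ * (2 * l⁻¹) := by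
    refine (intervalIntegral.norm_integral_le_integral_norm hab).trans ?_
    have hnorm : ∀ x, ‖ee (P.eval x) * (κ * ((-p2 x / (p1 x) ^ 2 : ℝ) : ℂ))‖ =
        (2 * Real.pi)⁻¹ * |(-p2 x / (p1 x) ^ 2 : ℝ)| := by
      intro x
      rw [norm_mul, norm_mul, norm_ee, one_mul, hκn, Complex.norm_real, Real.norm_eq_abs]
    simp only [hnorm]
    rw [intervalIntegral.integral_const_mul]
    gcongr
    have b1 := abs_le.1 (hinvb a ha)
    have b2 := abs_le.1 (hinvb b hb)
    rcases h2 with h2 | h2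
    · have : ∫ x in a..b, |(-p2 x / (p1 x) ^ 2 : ℝ)| = ∫ x in a..b, -(-p2 x / (p1 x) ^ 2 : ℝ) := by
        apply intervalIntegral.integral_congr
        intro x hx
        rw [Set.uIcc_of_le hab] at hx
        simp only
        apply abs_of_nonpos
        apply div_nonpos_of_nonpos_of_nonneg _ (by positivity)
        have := h2 x hx
        simp only [hp2]; linarith
      rw [this, intervalIntegral.integral_neg, ftc2]; linarith
    · have : ∫ x in a..b, |(-p2 x / (p1 x) ^ 2 : ℝ)| = ∫ x in a..b, (-p2 x / (p1 x) ^ 2 : ℝ) := by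
        apply intervalIntegral.integral_congr
        intro x hx
        rw [Set.uIcc_of_le hab] at hx
        simp only
        apply abs_of_nonneg
        apply div_nonneg _ (by positivity)
        have := h2 x hx
        simp only [hp2]; linarith
      rw [this, ftc2]; linarith
  have heq : ∫ x in a..b, ee (P.eval x) = ee (P.eval b) * (κ * ((p1 b)⁻¹ : ℝ)) -
      ee (P.eval a) * (κ * ((p1 a)⁻¹ : ℝ)) -
      ∫ x in a..b, ee (P.eval x) * (κ * ((-p2 x / (p1 x) ^ 2 : ℝ) : ℂ)) := by
    rw [← ftc]; ring
  rw [heq]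
  refine (norm_sub_le _ _).trans ?_
  refine (add_le_add (norm_sub_le _ _) le_rfl).trans ?_
  have t1 := bd a ha
  have t2 := bd b hb
  have : (2 * Real.pi)⁻¹ * 4 ≤ 1 := by
    rw [inv_mul_le_iff₀ (by positivity)]; linarith
  have hl' : 0 < l⁻¹ := by positivity
  rw [one_div]
  nlinarith

lemma closure_ext {f : ℝ → ℝ} (hf : Continuous f) {a b c : ℝ} (hab : a < b)
    (h : ∀ x ∈ Set.Ioo a b, c ≤ f x) : ∀ x ∈ Set.Icc a b, c ≤ f x := by
  intro x hx
  have hcl : IsClosed {x : ℝ | c ≤ f x} := isClosed_le continuous_const hf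
  have := closure_minimal (show Set.Ioo a b ⊆ {x : ℝ | c ≤ f x} from h) hcl
  rw [closure_Ioo hab.ne] at this
  exact this hx

lemma osc_step (P : ℝ[X]) (r : ℕ) (A B l : ℝ) (hA : 1 ≤ A) (hAB : A ≤ B) (hl : 0 < l)
    (hd : 2 ≤ P.natDegree) (hr : P.support.card ≤ r) :
    ‖∫ x in A..B, ee (P.eval x)‖ ≤ subl (derivative P) l A B + (3 * (r + 1) + 1) * (1 / l) := by
  set P1 := derivative P with hP1
  set P2 := derivative P1 with hP2
  have hsd : ∀ R : ℝ[X], (derivative R).support.card ≤ R.support.card := by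
    intro R
    refine Finset.card_le_card_of_injOn (fun i => i + 1) ?_ (by intro a _ b _ h; simpa using h)
    intro i hi
    simp only [Finset.mem_coe, mem_support_iff, coeff_derivative] at hi ⊢
    exact left_ne_zero_of_mul hi
  have hd1 : P1.natDegree = P.natDegree - 1 := natDegree_derivative P
  have hd2 : P2.natDegree = P1.natDegree - 1 := natDegree_derivative P1
  have hP20 : P2 ≠ 0 := by
    intro h
    have := Polynomial.natDegree_eq_zero_of_derivative_eq_zero (hP2 ▸ h)
    omega
  set Z : Finset ℝ := (posRoots (P1 - C l) ∪ posRoots (P1 + C l)) ∪ posRoots P2 with hZ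
  have hcard : Z.card ≤ 3 * (r + 1) := by
    have h1 := card_supp_C P1 l
    have c1 := card_posRoots_le (P1 - C l)
    have c2 := card_posRoots_le (P1 + C l)
    have c3 := card_posRoots_le P2
    have u1 := Finset.card_union_le (posRoots (P1 - C l) ∪ posRoots (P1 + C l)) (posRoots P2)
    have u2 := Finset.card_union_le (posRoots (P1 - C l)) (posRoots (P1 + C l))
    have s1 := hsd P
    have s2 := hsd P1
    rw [← hZ] at u1
    rw [← hP1] at s1
    rw [← hP2] at s2
    omega
  have hint : ∀ a b, IntervalIntegrable (fun x => ee (P.eval x)) volume a b := fun a b =>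
    (continuous_ee.comp P.continuous).intervalIntegrable a b
  have main := split_bound (fun a b => ‖∫ x in a..b, ee (P.eval x)‖ - subl P1 l a b) A B (1 / l)
    (by positivity) Z
    (by
      intro a b c _ hab hbc _
      rw [subl_add P1 l a b c hab hbc,
        ← intervalIntegral.integral_add_adjacent_intervals (hint a b) (hint b c)]
      have := norm_add_le (∫ x in a..b, ee (P.eval x)) (∫ x in b..c, ee (P.eval x))
      linarith)
    (by
      intro a b ha hab hb hfree
      have ha0 : 0 ≤ a := by linarith
      have hl' : 0 < 1 / l := by positivity
      rcases hab.lt_or_eq with hlt | heq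
      swap
      · subst heq
        have := subl_nonneg P1 l a a
        simp only [intervalIntegral.integral_same, norm_zero]
        linarith
      have t1 := abs_trichotomy (Q := P1) (l := l) (a := a) (b := b) ha0 (by omega)
        (fun z hz => hfree z (by rw [hZ]; simp only [Finset.mem_union, hz, or_true, true_or]))
        (fun z hz => hfree z (by rw [hZ]; simp only [Finset.mem_union, hz, or_true, true_or]))
      have t2 := sign_const hP20 ha0
        (fun z hz => hfree z (by rw [hZ]; simp only [Finset.mem_union, hz, or_true]))
      have n1 := subl_nonneg P1 l a b
      rcases t1 with t1 | t1
      · rw [subl_full P1 l a b hab t1]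
        have := intervalIntegral.norm_integral_le_of_norm_le_const (a := a) (b := b)
          (f := fun x => ee (P.eval x)) (C := 1) (fun x _ => (norm_ee _).le)
        rw [abs_of_nonneg (by linarith)] at this
        linarith
      have := fdt P a b l hab hl
        (by
          rcases t1 with t1 | t1
          · left
            exact closure_ext P1.continuous hlt (fun x hx => (t1 x hx).le)
          · right
            intro x hx
            have := closure_ext (f := fun x => -P1.eval x) P1.continuous.neg hlt (c := l)
              (fun x hx => by have := t1 x hx; linarith) x hx
            linarith)
        (by
          rcases t2 with t2 | t2
          · left
            exact closure_ext P2.continuous hlt (fun x hx => (t2 x hx).le)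
          · right
            intro x hx
            have := closure_ext (f := fun x => -P2.eval x) P2.continuous.neg hlt (c := 0)
              (fun x hx => by have := t2 x hx; linarith) x hx
            linarith)
      linarith)
    hAB
  have hc : (Z.card : ℝ) ≤ 3 * (r + 1) := by exact_mod_cast hcard
  have : ((Z.card : ℝ) + 1) * (1 / l) ≤ (3 * (r + 1) + 1) * (1 / l) := by gcongr
  linarith

/-- main oscillatory integral bound -/
lemma osc_bound (P : ℝ[X]) (r : ℕ) (A B T c : ℝ) (hA : 1 ≤ A) (hAB : A ≤ B) (hc : 0 < c)
    (hd : 2 ≤ P.natDegree) (hr : P.support.card ≤ r) (hlead : c ≤ |P.leadingCoeff|)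
    (hT : 2 * P.natDegree ≤ T) (hTr : T ^ r ≤ c * A ^ (P.natDegree - 1)) :
    ‖∫ x in A..B, ee (P.eval x)‖ ≤ 24 * B * (r + 1) ^ 2 / T := by
  have hB : 1 ≤ B := hA.trans hAB
  have hm : (2 : ℝ) ≤ P.natDegree := by exact_mod_cast hd
  have hT0 : 0 < T := by linarith
  have hT1 : 1 ≤ T := by linarith
  have hP0 : P ≠ 0 := by rintro rfl; simp at hd
  set P1 := derivative P with hP1
  have hd1 : P1.natDegree = P.natDegree - 1 := natDegree_derivative P
  have hP10 : P1 ≠ 0 := by intro h; rw [h] at hd1; simp at hd1; omega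
  have hcard : P1.support.card ≤ P.support.card := by
    refine Finset.card_le_card_of_injOn (fun i => i + 1) ?_ (by intro a _ b _ h; simpa using h)
    intro i hi
    simp only [Finset.mem_coe, mem_support_iff, hP1, coeff_derivative] at hi ⊢
    exact left_ne_zero_of_mul hi
  obtain ⟨k, hk⟩ : ∃ k, P1.support.card = k + 1 := by
    refine Nat.exists_eq_succ_of_ne_zero ?_
    rwa [Ne, card_support_eq_zero]
  have hlead1 : c ≤ |P1.leadingCoeff| := by
    rw [leadingCoeff, hd1, hP1, coeff_derivative, abs_mul,
      show P.natDegree - 1 + 1 = P.natDegree by omega]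
    have h2 : (1 : ℝ) ≤ |((P.natDegree - 1 : ℕ) : ℝ) + 1| := by
      rw [abs_of_nonneg (by positivity)]
      have : (0 : ℝ) ≤ ((P.natDegree - 1 : ℕ) : ℝ) := by positivity
      linarith
    have h3 : c ≤ |P.coeff P.natDegree| := hlead
    nlinarith [abs_nonneg (P.coeff P.natDegree)]
  have hr1 : 1 ≤ r := by omega
  have h1 := subl_bound r (P.natDegree - 1) A B T c hA hAB (by omega) (by
    have : ((P.natDegree - 1 : ℕ) : ℝ) ≤ P.natDegree := by exact_mod_cast Nat.sub_le _ _
    linarith) hc k P1 T hT0 hk (by omega) hd1 hlead1 (by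
      refine le_trans ?_ hTr
      rw [← pow_succ']
      exact pow_le_pow_right₀ hT1 (by omega))
  have h2 := osc_step P r A B T hA hAB hT0 hd hr
  have hkr : (k : ℝ) ≤ r - 1 := by
    have : k + 1 ≤ r := by omega
    have : ((k + 1 : ℕ) : ℝ) ≤ r := by exact_mod_cast this
    push_cast at this; linarith
  have hrr : (1 : ℝ) ≤ r := by exact_mod_cast hr1
  refine h2.trans ?_
  refine (add_le_add h1 le_rfl).trans ?_
  rw [div_eq_mul_inv, div_eq_mul_inv, div_eq_mul_inv, one_mul]
  have hT' : 0 < T⁻¹ := by positivity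
  have : (k : ℝ) * ((4 * (r + 1) + 1) * (4 * B)) + (3 * (r + 1) + 1) ≤ 24 * B * (r + 1) ^ 2 := by
    have e1 : (k : ℝ) * ((4 * (r + 1) + 1) * (4 * B)) ≤ (r - 1) * ((4 * (r + 1) + 1) * (4 * B)) := by
      gcongr
    have e2 : (3 * ((r : ℝ) + 1) + 1) ≤ (3 * ((r : ℝ) + 1) + 1) * B := by nlinarith
    have e3 : (r - 1) * ((4 * ((r : ℝ) + 1) + 1) * 4) + (3 * ((r : ℝ) + 1) + 1) ≤ 24 * (r + 1) ^ 2 := by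
      nlinarith
    nlinarith
  nlinarith

end LIL

namespace LIL

lemma ee_add (x y : ℝ) : ee (x + y) = ee x * ee y := by
  unfold ee; rw [← Complex.exp_add]; push_cast; ring_nf

lemma ee_zero : ee 0 = 1 := by simp [ee]

lemma ee_int (n : ℤ) : ee n = 1 := by
  unfold ee
  rw [Complex.exp_eq_one_iff]
  exact ⟨n, by push_cast; ring⟩

lemma hs_congr {f g : ℤ → ℂ} {a : ℂ} (h : HasSum g a) (e : ∀ k, f k = g k) : HasSum f a := by
  rw [show f = g from funext e]; exact h

/-- absolutely convergent Fourier series with total mass `≤ M` -/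
def AF (M : ℝ) (c : ℤ → ℂ) (φ : ℝ → ℝ) : Prop :=
  Summable (fun k => ‖c k‖) ∧ (∑' k, ‖c k‖) ≤ M ∧
    ∀ y, HasSum (fun k : ℤ => c k * ee (k * y)) (φ y : ℂ)

lemma AF.shift {M c φ} (h : AF M c φ) (t : ℝ) :
    AF M (fun k => c k * ee (k * t)) (fun y => φ (y + t)) := by
  obtain ⟨h1, h2, h3⟩ := h
  refine ⟨by simpa [norm_ee] using h1, by simpa [norm_ee] using h2, fun y => ?_⟩
  convert h3 (y + t) using 2 with k
  rw [mul_add, ee_add]; ring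

lemma AF.add {M M' c c' φ φ'} (h : AF M c φ) (h' : AF M' c' φ') :
    AF (M + M') (fun k => c k + c' k) (fun y => φ y + φ' y) := by
  obtain ⟨h1, h2, h3⟩ := h
  obtain ⟨h1', h2', h3'⟩ := h'
  have hs : Summable (fun k => ‖c k + c' k‖) :=
    Summable.of_nonneg_of_le (fun _ => norm_nonneg _) (fun k => norm_add_le _ _) (h1.add h1')
  refine ⟨hs, ?_, fun y => ?_⟩
  · refine (hs.tsum_le_tsum (fun k => norm_add_le _ _) (h1.add h1')).trans ?_
    rw [h1.tsum_add h1']; linarith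
  · push_cast
    exact hs_congr ((h3 y).add (h3' y)) fun k => by ring

lemma AF.smul {M c φ} (h : AF M c φ) (a : ℝ) :
    AF (|a| * M) (fun k => a * c k) (fun y => a * φ y) := by
  obtain ⟨h1, h2, h3⟩ := h
  refine ⟨?_, ?_, fun y => ?_⟩
  · simpa [norm_mul] using h1.mul_left |a|
  · simp only [norm_mul, Complex.norm_real, Real.norm_eq_abs]
    rw [tsum_mul_left]; gcongr
  · push_cast
    exact hs_congr ((h3 y).mul_left (a : ℂ)) fun k => by ring

lemma AF.const (a : ℝ) : AF |a| (fun k => if k = 0 then (a : ℂ) else 0) (fun _ => a) := by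
  have e : (fun k : ℤ => ‖if k = 0 then (a : ℂ) else 0‖) = fun k => if k = 0 then |a| else 0 := by
    ext k; split_ifs <;> simp
  refine ⟨?_, ?_, fun y => ?_⟩
  · rw [e]; exact (hasSum_ite_eq (0 : ℤ) |a|).summable
  · rw [e, tsum_ite_eq]
  · refine hs_congr (hasSum_ite_eq (0 : ℤ) (a : ℂ)) fun k => ?_
    split_ifs with hk
    · subst hk; simp [ee_zero]
    · simp [hk]

lemma AF.mono {M M' c φ} (h : AF M c φ) (hM : M ≤ M') : AF M' c φ :=
  ⟨h.1, h.2.1.trans hM, h.2.2⟩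

lemma AF.norm_le {M c φ} (h : AF M c φ) (y : ℝ) : ‖(φ y : ℂ)‖ ≤ M := by
  obtain ⟨h1, h2, h3⟩ := h
  rw [← (h3 y).tsum_eq]
  have : Summable (fun k : ℤ => ‖c k * ee (k * y)‖) := by simpa [norm_ee] using h1
  refine (norm_tsum_le_tsum_norm this).trans ?_
  simpa [norm_ee] using h2

lemma AF.nonneg {M c φ} (h : AF M c φ) : 0 ≤ M :=
  le_trans (tsum_nonneg fun _ => norm_nonneg _) h.2.1

section ind
variable {Ω : Type*} [MeasurableSpace Ω] (P : Measure Ω) [IsProbabilityMeasure P]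

lemma fourier_prod (f : ℕ → Ω → ℝ) (hf : ∀ n, Measurable (f n)) (F : Finset ℕ) (δ M : ℝ)
    (hδ : 0 ≤ δ) (hM : 0 ≤ M)
    (hosc : ∀ k : ℕ → ℤ, (∃ n ∈ F, k n ≠ 0) → ‖∫ ω, ee (∑ n ∈ F, k n * f n ω) ∂P‖ ≤ δ)
    (φ : ℕ → ℝ → ℝ) (c : ℕ → ℤ → ℂ) (hφ : ∀ n, AF M (c n) (φ n)) (hm : ∀ n, Measurable (φ n))
    (T : Finset ℕ) : T ⊆ F → ∀ k : ℕ → ℤ, (∀ n ∈ T, k n = 0) →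
    ‖(∫ ω, (∏ n ∈ T, (φ n (f n ω) : ℂ)) * ee (∑ n ∈ F, k n * f n ω) ∂P)
      - (if ∀ n ∈ F, k n = 0 then ∏ n ∈ T, c n 0 else 0)‖ ≤ M ^ T.card * δ := by
  classical
  induction T using Finset.induction_on with
  | empty =>
    intro _ k _
    split_ifs with hk
    · have : ∀ ω, ∑ n ∈ F, (k n : ℝ) * f n ω = 0 := fun ω =>
        Finset.sum_eq_zero fun n hn => by simp [hk n hn]
      simp [this, ee_zero, hδ]
    · push Not at hk
      simpa using hosc k hk
  | insert m T hmT ih =>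
    intro hTF k hk
    have hmF : m ∈ F := hTF (Finset.mem_insert_self _ _)
    have hkm : k m = 0 := hk m (Finset.mem_insert_self _ _)
    have hTF' : T ⊆ F := (Finset.subset_insert _ _).trans hTF
    have hsum : ∀ (j : ℤ) (ω : Ω), ∑ n ∈ F, ((Function.update k m j n : ℤ) : ℝ) * f n ω
        = j * f m ω + ∑ n ∈ F, k n * f n ω := by
      intro j ω
      rw [← Finset.add_sum_erase _ _ hmF, ← Finset.add_sum_erase F (fun n => (k n : ℝ) * f n ω) hmF]
      simp only [Function.update_self, hkm, Int.cast_zero, zero_mul, zero_add]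
      congr 1
      refine Finset.sum_congr rfl fun n hn => ?_
      rw [Function.update_of_ne (Finset.ne_of_mem_erase hn)]
    set H : ℤ → Ω → ℂ := fun j ω => c m j * ((∏ n ∈ T, (φ n (f n ω) : ℂ)) *
      ee (∑ n ∈ F, ((Function.update k m j n : ℤ) : ℝ) * f n ω)) with hH
    have hmeas : ∀ j, Measurable (H j) := by
      intro j
      refine Measurable.const_mul (Measurable.mul ?_ ?_) _
      · exact Finset.measurable_prod _ fun n _ => Complex.measurable_ofReal.comp ((hm n).comp (hf n))
      · exact continuous_ee.measurable.comp
          (Finset.measurable_sum _ fun n _ => (hf n).const_mul _)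
    have hbd : ∀ j ω, ‖H j ω‖ ≤ ‖c m j‖ * M ^ T.card := by
      intro j ω
      rw [hH]
      simp only [norm_mul, norm_ee, mul_one, norm_prod]
      gcongr
      refine (Finset.prod_le_prod (fun n _ => norm_nonneg _) (fun n _ => (hφ n).norm_le _)).trans ?_
      simp
    have hint : ∀ j, Integrable (H j) P := fun j =>
      Integrable.of_bound (hmeas j).aestronglyMeasurable _ (ae_of_all _ (hbd j))
    have hsn : Summable (fun j => ∫ ω, ‖H j ω‖ ∂P) := by
      refine Summable.of_nonneg_of_le (fun j => integral_nonneg fun _ => norm_nonneg _) (fun j => ?_)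
        ((hφ m).1.mul_right (M ^ T.card))
      refine (integral_mono (hint j).norm (integrable_const _) (hbd j)).trans ?_
      simp
    have hex := hasSum_integral_of_summable_integral_norm hint hsn
    have hpt : ∀ ω, ∑' j, H j ω = (∏ n ∈ insert m T, (φ n (f n ω) : ℂ)) *
        ee (∑ n ∈ F, k n * f n ω) := by
      intro ω
      refine HasSum.tsum_eq ?_
      have := ((hφ m).2.2 (f m ω)).mul_right ((∏ n ∈ T, (φ n (f n ω) : ℂ)) *
        ee (∑ n ∈ F, k n * f n ω))
      rw [Finset.prod_insert hmT, mul_assoc]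
      refine hs_congr this fun j => ?_
      rw [hH]
      simp only [hsum, ee_add]
      ring
    simp only [hpt] at hex
    have hupd : ∀ j, (∀ n ∈ T, Function.update k m j n = 0) := by
      intro j n hn
      rw [Function.update_of_ne (by rintro rfl; exact hmT hn)]
      exact hk n (Finset.mem_insert_of_mem hn)
    have hcond : ∀ j, (∀ n ∈ F, Function.update k m j n = 0) ↔ (j = 0 ∧ ∀ n ∈ F, k n = 0) := by
      intro j
      constructor
      · intro h
        refine ⟨by simpa using h m hmF, fun n hn => ?_⟩
        by_cases hnm : n = m
        · rw [hnm, hkm]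
        · simpa [Function.update_of_ne hnm] using h n hn
      · rintro ⟨rfl, h⟩ n hn
        by_cases hnm : n = m
        · rw [hnm]; simp
        · rw [Function.update_of_ne hnm]; exact h n hn
    have hmain : HasSum (fun j : ℤ => c m j *
        (if ∀ n ∈ F, Function.update k m j n = 0 then ∏ n ∈ T, c n 0 else 0))
        (if ∀ n ∈ F, k n = 0 then ∏ n ∈ insert m T, c n 0 else 0) := by
      rw [Finset.prod_insert hmT]
      refine hs_congr (hasSum_ite_eq (0 : ℤ)
        (if ∀ n ∈ F, k n = 0 then c m 0 * ∏ n ∈ T, c n 0 else 0)) fun j => ?_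
      simp only [hcond]
      by_cases hj : j = 0
      · subst hj; simp
      · simp [hj]
    have hdiff := hex.sub hmain
    have hterm : ∀ j, ‖(∫ ω, H j ω ∂P) - c m j *
        (if ∀ n ∈ F, Function.update k m j n = 0 then ∏ n ∈ T, c n 0 else 0)‖
        ≤ ‖c m j‖ * (M ^ T.card * δ) := by
      intro j
      rw [hH]
      simp only
      rw [integral_const_mul, ← mul_sub, norm_mul]
      gcongr
      exact ih hTF' _ (hupd j)
    rw [← hdiff.tsum_eq]
    refine (tsum_of_norm_bounded ((hφ m).1.mul_right (M ^ T.card * δ)).hasSum hterm).trans ?_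
    rw [tsum_mul_right, Finset.card_insert_of_notMem hmT, pow_succ]
    have := (hφ m).2.1
    have h0 : 0 ≤ M ^ T.card * δ := by positivity
    calc _ ≤ M * (M ^ T.card * δ) := by gcongr
      _ = _ := by ring
end ind

/-- periodised Bernoulli function -/
noncomputable def bet (y : ℝ) : ℝ := Int.fract y ^ 2 - Int.fract y + 1 / 6

noncomputable def cbet (k : ℤ) : ℂ := ((1 / (2 * Real.pi ^ 2 * (k : ℝ) ^ 2) : ℝ) : ℂ)

lemma bet_hasSum (y : ℝ) : HasSum (fun k : ℤ => cbet k * ee (k * y)) (bet y : ℂ) := by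
  have h := hasSum_one_div_pow_mul_fourier_mul_bernoulliFun (k := 2) le_rfl
    (x := Int.fract y) ⟨Int.fract_nonneg _, (Int.fract_lt_one _).le⟩
  have hpi : (Real.pi : ℂ) ≠ 0 := by exact_mod_cast Real.pi_ne_zero
  have h' := h.mul_left ((1 : ℂ) / (2 * (Real.pi : ℂ) ^ 2))
  have e2 : (1 : ℂ) / (2 * (Real.pi : ℂ) ^ 2) * (-(2 * Real.pi * Complex.I) ^ 2 / (Nat.factorial 2 : ℂ)
      * bernoulliFun 2 (Int.fract y)) = (bet y : ℂ) := by
    rw [bernoulliFun_two, bet]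
    push_cast [mul_pow, Complex.I_sq]
    norm_num
    field_simp
    ring
  rw [e2] at h'
  refine hs_congr h' fun k => ?_
  rw [fourier_coe_apply]
  have : ee (k * y) = Complex.exp (2 * Real.pi * Complex.I * k * (Int.fract y : ℝ) / (1 : ℝ)) := by
    have : (k : ℝ) * y = ((k * ⌊y⌋ : ℤ) : ℝ) + k * Int.fract y := by
      push_cast
      rw [← mul_add, Int.floor_add_fract]
    rw [this, ee_add, ee_int, one_mul]
    unfold ee
    congr 1; push_cast; ring
  rw [this, cbet]
  push_cast
  ring

lemma bet_AF : AF 1 cbet bet := by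
  have h0 := bet_hasSum 0
  have e : ∀ k : ℤ, cbet k * ee (k * 0) = ((‖cbet k‖ : ℝ) : ℂ) := by
    intro k
    rw [mul_zero, ee_zero, mul_one, cbet, Complex.norm_real, Real.norm_of_nonneg (by positivity)]
  simp only [e] at h0
  rw [Complex.hasSum_ofReal] at h0
  refine ⟨h0.summable, ?_, bet_hasSum⟩
  rw [h0.tsum_eq, bet]; norm_num

lemma cbet_zero : cbet 0 = 0 := by simp [cbet]

lemma measurable_bet : Measurable bet := by unfold bet; fun_prop

end LIL

namespace LIL

/-- indicator of `[a,b)` -/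
noncomputable def ind (a b y : ℝ) : ℝ := Set.indicator (Set.Ico a b) (fun _ => (1 : ℝ)) y

lemma measurable_ind (a b : ℝ) : Measurable (ind a b) :=
  measurable_const.indicator measurableSet_Ico

lemma ind_mem (a b y : ℝ) : ind a b y = 0 ∨ ind a b y = 1 := by
  unfold ind Set.indicator; split_ifs <;> simp

lemma ind_nonneg (a b y : ℝ) : 0 ≤ ind a b y := by
  rcases ind_mem a b y with h | h <;> rw [h]; norm_num

lemma ind_le_one (a b y : ℝ) : ind a b y ≤ 1 := by
  rcases ind_mem a b y with h | h <;> rw [h]; norm_num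

/-- `({y+h})` in the two cases -/
lemma fract_add_cases (y h : ℝ) (h0 : 0 ≤ h) (h1 : h ≤ 1) :
    (Int.fract y + h < 1 ∧ Int.fract (y + h) = Int.fract y + h) ∨
    (1 ≤ Int.fract y + h ∧ Int.fract (y + h) = Int.fract y + h - 1) := by
  have f0 := Int.fract_nonneg y
  have f1 := Int.fract_lt_one y
  have e := Int.floor_add_fract y
  rcases lt_or_ge (Int.fract y + h) 1 with hl | hl
  · left
    refine ⟨hl, ?_⟩
    rw [Int.fract_eq_iff]
    exact ⟨by linarith, hl, ⌊y⌋, by linarith⟩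
  · right
    refine ⟨hl, ?_⟩
    rw [Int.fract_eq_iff]
    exact ⟨by linarith, by linarith, ⌊y⌋ + 1, by push_cast; linarith⟩

lemma fract_sub_cases (y h : ℝ) (h0 : 0 ≤ h) (h1 : h ≤ 1) :
    (h ≤ Int.fract y ∧ Int.fract (y - h) = Int.fract y - h) ∨
    (Int.fract y < h ∧ Int.fract (y - h) = Int.fract y - h + 1) := by
  have f0 := Int.fract_nonneg y
  have f1 := Int.fract_lt_one y
  have e := Int.floor_add_fract y
  rcases le_or_gt h (Int.fract y) with hl | hl
  · left
    refine ⟨hl, ?_⟩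
    rw [Int.fract_eq_iff]
    exact ⟨by linarith, by linarith, ⌊y⌋, by linarith⟩
  · right
    refine ⟨hl, ?_⟩
    rw [Int.fract_eq_iff]
    exact ⟨by linarith, by linarith, ⌊y⌋ - 1, by push_cast; linarith⟩

/-- smoothed sawtooth -/
noncomputable def psi (η y : ℝ) : ℝ := (1 / (2 * η)) * (bet (y + η) + -1 * bet y)

noncomputable def tau (η y : ℝ) : ℝ :=
  4 * η + (-1 / (2 * η)) * (bet (y + 2 * η) + (bet (y + -(2 * η)) + -2 * bet y))

lemma psi_spec (η y : ℝ) (h0 : 0 < η) (h1 : η ≤ 1 / 8) :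
    |psi η y| ≤ 1 ∧ |Int.fract y - 1 / 2 - psi η y| ≤ η + tau η y := by
  have f0 := Int.fract_nonneg y
  have f1 := Int.fract_lt_one y
  have a1 := fract_add_cases y η h0.le (by linarith)
  have a2 := fract_add_cases y (2 * η) (by linarith) (by linarith)
  have a3 := fract_sub_cases y (2 * η) (by linarith) (by linarith)
  rw [sub_eq_add_neg] at a3
  set t := Int.fract y with ht
  have hps : (t + η < 1 ∧ psi η y = t - 1 / 2 + η / 2) ∨
      (1 ≤ t + η ∧ psi η y = t - 1 / 2 + η / 2 - (t + η - 1) / η) := by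
    unfold psi bet
    rcases a1 with ⟨h, e⟩ | ⟨h, e⟩
    · left; refine ⟨h, ?_⟩
      rw [e, ← ht]; field_simp; ring
    · right; refine ⟨h, ?_⟩
      rw [e, ← ht]; field_simp; ring
  have hta : (t + 2 * η < 1 ∧ 0 ≤ tau η y) ∨ (1 ≤ t + 2 * η ∧ tau η y = (t + 2 * η - 1) / η) := by
    unfold tau bet
    rcases a2 with ⟨h, e⟩ | ⟨h, e⟩
    · left; refine ⟨h, ?_⟩
      rcases a3 with ⟨h', e'⟩ | ⟨h', e'⟩
      · rw [e, e', ← ht]; apply le_of_eq; field_simp; ring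
      · rw [e, e', ← ht]
        have : 0 ≤ (2 * η - t) / η := div_nonneg (by linarith) h0.le
        refine this.trans (le_of_eq ?_)
        field_simp; ring
    · right; refine ⟨h, ?_⟩
      rcases a3 with ⟨h', e'⟩ | ⟨h', e'⟩
      · rw [e, e', ← ht]; field_simp; ring
      · linarith
  have hta0 : 0 ≤ tau η y := by
    rcases hta with ⟨_, h⟩ | ⟨h, e⟩
    · exact h
    · rw [e]; exact div_nonneg (by linarith) h0.le
  rcases hps with ⟨h, e⟩ | ⟨h, e⟩
  · rw [e]
    refine ⟨?_, ?_⟩ <;> rw [abs_le] <;> constructor <;> linarith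
  · have q0 : 0 ≤ (t + η - 1) / η := div_nonneg (by linarith) h0.le
    have q1 : (t + η - 1) / η ≤ 1 := by rw [div_le_one h0]; linarith
    have q2 : 1 ≤ tau η y := by
      rcases hta with ⟨h', _⟩ | ⟨_, e⟩
      · linarith
      · rw [e, le_div_iff₀ h0]; linarith
    rw [e]
    refine ⟨?_, ?_⟩ <;> rw [abs_le] <;> constructor <;> linarith

lemma tau_nonneg (η y : ℝ) (h0 : 0 < η) (h1 : η ≤ 1 / 8) : 0 ≤ η + tau η y :=
  (abs_nonneg _).trans (psi_spec η y h0 h1).2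

lemma ind_eq_psi (a b y : ℝ) (ha : 0 ≤ a) (hab : a < b) (hb : b ≤ 1) :
    ind a b (Int.fract y) - (b - a) =
      (Int.fract (y + -b) - 1 / 2) - (Int.fract (y + -a) - 1 / 2) := by
  have a1 := fract_sub_cases y a ha (by linarith)
  have a2 := fract_sub_cases y b (by linarith) hb
  rw [← sub_eq_add_neg, ← sub_eq_add_neg]
  unfold ind Set.indicator
  simp only [Set.mem_Ico]
  rcases a1 with ⟨h, e⟩ | ⟨h, e⟩ <;> rcases a2 with ⟨h', e'⟩ | ⟨h', e'⟩ <;> rw [e, e']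
  · rw [if_neg (by rintro ⟨_, h2⟩; linarith)]; ring
  · rw [if_pos ⟨h, h'⟩]; ring
  · linarith
  · rw [if_neg (by rintro ⟨h2, _⟩; linarith)]; ring

lemma psi_AF (η : ℝ) (h0 : 0 < η) : ∃ c, AF (1 / η) c (psi η) ∧ c 0 = 0 := by
  have h := ((bet_AF.shift η).add (bet_AF.smul (-1))).smul (1 / (2 * η))
  refine ⟨_, (h.mono (M' := 1 / η) ?_), ?_⟩
  · rw [abs_of_pos (by positivity)]; norm_num; field_simp; norm_num
  · simp [cbet_zero]

lemma tau_AF (η : ℝ) (h0 : 0 < η) (h1 : η ≤ 1 / 8) :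
    ∃ c, AF (4 / η) c (tau η) ∧ c 0 = (4 * η : ℝ) := by
  have h := (AF.const (4 * η)).add (((bet_AF.shift (2 * η)).add
    ((bet_AF.shift (-(2 * η))).add (bet_AF.smul (-2)))).smul (-1 / (2 * η)))
  refine ⟨_, (h.mono (M' := 4 / η) ?_), ?_⟩
  · rw [abs_of_pos (by positivity), abs_div, abs_of_pos (show 0 < 2 * η by positivity)]
    norm_num
    rw [le_div_iff₀ h0]
    field_simp
    nlinarith
  · simp [cbet_zero]

noncomputable def phi (η a b α γ y : ℝ) : ℝ :=
  α * (psi η (y + -b) + -1 * psi η (y + -a)) + (α * (b - a) + γ)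

lemma phi_AF (η a b α γ : ℝ) (h0 : 0 < η) (h1 : η ≤ 1 / 8) (ha : 0 ≤ a) (hab : a < b) (hb : b ≤ 1)
    (hα : |α| ≤ 1) (hγ : |γ| ≤ 1) :
    ∃ c, AF (4 / η) c (phi η a b α γ) ∧ c 0 = (α * (b - a) + γ : ℝ) := by
  obtain ⟨c, hc, hc0⟩ := psi_AF η h0
  have h := (((hc.shift (-b)).add ((hc.shift (-a)).smul (-1))).smul α).add
    (AF.const (α * (b - a) + γ))
  refine ⟨_, (h.mono (M' := 4 / η) ?_), ?_⟩
  · have e : |α * (b - a) + γ| ≤ 2 := by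
      refine (abs_add_le _ _).trans ?_
      rw [abs_mul, abs_of_pos (show 0 < b - a by linarith)]
      nlinarith [abs_nonneg α]
    have h2 : 2 ≤ 2 / η := by rw [le_div_iff₀ h0]; linarith
    have h3 : |α| * (1 / η + |(-1:ℝ)| * (1 / η)) ≤ 2 / η := by
      have : 0 < 1 / η := by positivity
      rw [show (2:ℝ) / η = 2 * (1 / η) by ring]
      rw [abs_neg, abs_one, one_mul]
      nlinarith [abs_nonneg α]
    have : (4:ℝ) / η = 2 / η + 2 / η := by ring
    linarith
  · simp [hc0]

lemma measurable_psi (η : ℝ) : Measurable (psi η) := by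
  unfold psi
  exact (((measurable_bet.comp (measurable_id.add_const _)).add (measurable_bet.const_mul _)).const_mul _)

lemma measurable_tau (η : ℝ) : Measurable (tau η) := by
  unfold tau
  refine measurable_const.add (Measurable.const_mul ?_ _)
  exact (measurable_bet.comp (measurable_id.add_const _)).add
    ((measurable_bet.comp (measurable_id.add_const _)).add (measurable_bet.const_mul _))

lemma measurable_phi (η a b α γ : ℝ) : Measurable (phi η a b α γ) := by
  unfold phi
  exact ((((measurable_psi η).comp (measurable_id.add_const _)).add
    (((measurable_psi η).comp (measurable_id.add_const _)).const_mul _)).const_mul _).add_const _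

lemma phi_abs (η a b α γ y : ℝ) (h0 : 0 < η) (h1 : η ≤ 1 / 8) (ha : 0 ≤ a) (hab : a < b) (hb : b ≤ 1)
    (hα : |α| ≤ 1) (hγ : |γ| ≤ 1) : |phi η a b α γ y| ≤ 4 := by
  unfold phi
  have p1 := (psi_spec η (y + -b) h0 h1).1
  have p2 := (psi_spec η (y + -a) h0 h1).1
  have e : |psi η (y + -b) + -1 * psi η (y + -a) + (b - a)| ≤ 3 := by
    rw [abs_le] at *
    constructor <;> linarith
  rw [show α * (psi η (y + -b) + -1 * psi η (y + -a)) + (α * (b - a) + γ) =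
    α * (psi η (y + -b) + -1 * psi η (y + -a) + (b - a)) + γ by ring]
  refine (abs_add_le _ _).trans ?_
  rw [abs_mul]
  nlinarith [abs_nonneg α, abs_nonneg (psi η (y + -b) + -1 * psi η (y + -a) + (b - a))]

lemma phi_err (η a b α γ y : ℝ) (h0 : 0 < η) (h1 : η ≤ 1 / 8) (ha : 0 ≤ a) (hab : a < b) (hb : b ≤ 1)
    (hα : |α| ≤ 1) : |α * ind a b (Int.fract y) + γ - phi η a b α γ y| ≤
      2 * η + tau η (y + -b) + tau η (y + -a) := by
  unfold phi
  have p1 := (psi_spec η (y + -b) h0 h1).2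
  have p2 := (psi_spec η (y + -a) h0 h1).2
  have e := ind_eq_psi a b y ha hab hb
  rw [show α * ind a b (Int.fract y) + γ - (α * (psi η (y + -b) + -1 * psi η (y + -a)) +
    (α * (b - a) + γ)) = α * ((Int.fract (y + -b) - 1 / 2 - psi η (y + -b)) -
      (Int.fract (y + -a) - 1 / 2 - psi η (y + -a))) by
      linear_combination α * e]
  rw [abs_mul]
  have := abs_sub (Int.fract (y + -b) - 1 / 2 - psi η (y + -b)) (Int.fract (y + -a) - 1 / 2 - psi η (y + -a))
  nlinarith [abs_nonneg α, abs_nonneg ((Int.fract (y + -b) - 1 / 2 - psi η (y + -b)) -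
      (Int.fract (y + -a) - 1 / 2 - psi η (y + -a)))]

lemma prod_tele (F : Finset ℕ) (g h : ℕ → ℝ) (hg : ∀ n, |g n| ≤ 4) (hh : ∀ n, |h n| ≤ 4) :
    |∏ n ∈ F, g n - ∏ n ∈ F, h n| ≤ 4 ^ F.card * ∑ n ∈ F, |g n - h n| := by
  classical
  induction F using Finset.induction_on with
  | empty => simp
  | insert m T hm ih =>
    rw [Finset.prod_insert hm, Finset.prod_insert hm, Finset.card_insert_of_notMem hm,
      Finset.sum_insert hm]
    have e : g m * ∏ n ∈ T, g n - h m * ∏ n ∈ T, h n =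
      (g m - h m) * ∏ n ∈ T, g n + h m * (∏ n ∈ T, g n - ∏ n ∈ T, h n) := by ring
    rw [e]
    refine (abs_add_le _ _).trans ?_
    rw [abs_mul, abs_mul]
    have hp : |∏ n ∈ T, g n| ≤ 4 ^ T.card := by
      rw [Finset.abs_prod]
      refine (Finset.prod_le_prod (fun _ _ => abs_nonneg _) (fun n _ => hg n)).trans ?_
      simp
    have h1 : |g m - h m| * |∏ n ∈ T, g n| ≤ |g m - h m| * 4 ^ (T.card + 1) := by
      gcongr
      refine hp.trans (pow_le_pow_right₀ (by norm_num) (by omega))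
    have h2 : |h m| * |∏ n ∈ T, g n - ∏ n ∈ T, h n| ≤ 4 * (4 ^ T.card * ∑ n ∈ T, |g n - h n|) := by
      gcongr
      exact hh m
    rw [pow_succ] at *
    linarith

lemma near_indep {Ω : Type*} [MeasurableSpace Ω] (P : Measure Ω) [IsProbabilityMeasure P]
    (f : ℕ → Ω → ℝ) (hf : ∀ n, Measurable (f n)) (F : Finset ℕ) (δ η : ℝ)
    (hδ : 0 ≤ δ) (h0 : 0 < η) (h1 : η ≤ 1 / 8)
    (hosc : ∀ k : ℕ → ℤ, (∃ n ∈ F, k n ≠ 0) → ‖∫ ω, ee (∑ n ∈ F, k n * f n ω) ∂P‖ ≤ δ)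
    (a b : ℝ) (ha : 0 ≤ a) (hab : a < b) (hb : b ≤ 1) (α γ : ℕ → ℝ) (hα : ∀ n, |α n| ≤ 1)
    (hγ : ∀ n, |γ n| ≤ 1) :
    |∫ ω, ∏ n ∈ F, (α n * ind a b (Int.fract (f n ω)) + γ n) ∂P -
      ∏ n ∈ F, (α n * (b - a) + γ n)| ≤
      4 ^ F.card * (F.card * (10 * η + 8 * δ / η)) + (4 / η) ^ F.card * δ := by
  have hM : 0 ≤ 4 / η := by positivity
  -- tau means
  have htau : ∀ n ∈ F, ∀ t : ℝ, ∫ ω, tau η (f n ω + t) ∂P ≤ 4 * η + 4 / η * δ := by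
    intro n hn t
    obtain ⟨c, hc, hc0⟩ := tau_AF η h0 h1
    have := fourier_prod P f hf F δ (4 / η) hδ hM hosc (fun _ y => tau η (y + t))
      (fun _ k => c k * ee (k * t)) (fun _ => hc.shift t)
      (fun _ => (measurable_tau η).comp (measurable_id.add_const _)) {n} (by simpa using hn) (fun _ => 0)
      (by simp)
    simp [hc0, ee_zero, integral_complex_ofReal] at this
    have e : ((∫ ω, tau η (f n ω + t) ∂P : ℝ) : ℂ) - 4 * η =
      ((∫ ω, tau η (f n ω + t) ∂P - 4 * η : ℝ) : ℂ) := by push_cast; ring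
    rw [e, Complex.norm_real] at this
    have := (le_abs_self _).trans this
    linarith
  choose c hc hc0 using fun n => phi_AF η a b (α n) (γ n) h0 h1 ha hab hb (hα n) (hγ n)
  have hmain := fourier_prod P f hf F δ (4 / η) hδ hM hosc (fun n => phi η a b (α n) (γ n)) c hc
    (fun n => measurable_phi _ _ _ _ _) F le_rfl (fun _ => 0) (by simp)
  simp only [Int.cast_zero, zero_mul, Finset.sum_const_zero, ee_zero, mul_one, implies_true,
    if_true, hc0, ← Complex.ofReal_prod, integral_complex_ofReal, ← Complex.ofReal_sub,
    Complex.norm_real, Real.norm_eq_abs] at hmain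
  have mg : Measurable (fun ω => ∏ n ∈ F, (α n * ind a b (Int.fract (f n ω)) + γ n)) :=
    Finset.measurable_prod _ fun n _ => (((measurable_ind a b).comp
      (measurable_fract.comp (hf n))).const_mul _).add_const _
  have mp : Measurable (fun ω => ∏ n ∈ F, phi η a b (α n) (γ n) (f n ω)) :=
    Finset.measurable_prod _ fun n _ => (measurable_phi _ _ _ _ _).comp (hf n)
  have bg : ∀ n y, |α n * ind a b (Int.fract y) + γ n| ≤ 4 := by
    intro n y
    refine (abs_add_le _ _).trans ?_
    rw [abs_mul, abs_of_nonneg (ind_nonneg _ _ _)]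
    nlinarith [hα n, hγ n, ind_le_one a b (Int.fract y), ind_nonneg a b (Int.fract y), abs_nonneg (α n)]
  have bp : ∀ n y, |phi η a b (α n) (γ n) y| ≤ 4 := fun n y =>
    phi_abs _ _ _ _ _ _ h0 h1 ha hab hb (hα n) (hγ n)
  have pb : ∀ g : ℕ → ℝ, (∀ n, |g n| ≤ 4) → ‖∏ n ∈ F, g n‖ ≤ 4 ^ F.card := by
    intro g hg
    rw [Real.norm_eq_abs, Finset.abs_prod]
    refine (Finset.prod_le_prod (fun _ _ => abs_nonneg _) (fun n _ => hg n)).trans ?_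
    simp
  have ig : Integrable (fun ω => ∏ n ∈ F, (α n * ind a b (Int.fract (f n ω)) + γ n)) P :=
    Integrable.of_bound mg.aestronglyMeasurable _ (ae_of_all _ fun ω => pb _ fun n => bg n (f n ω))
  have ip : Integrable (fun ω => ∏ n ∈ F, phi η a b (α n) (γ n) (f n ω)) P :=
    Integrable.of_bound mp.aestronglyMeasurable _ (ae_of_all _ fun ω => pb _ fun n => bp n (f n ω))
  have it : ∀ n t, Integrable (fun ω => tau η (f n ω + t)) P := by
    intro n t
    obtain ⟨c, hc, hc0⟩ := tau_AF η h0 h1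
    refine Integrable.of_bound ((measurable_tau η).comp ((hf n).add_const t)).aestronglyMeasurable
      (4 / η) (ae_of_all _ fun ω => ?_)
    have := hc.norm_le (f n ω + t)
    rwa [Complex.norm_real] at this
  have herr : |∫ ω, ∏ n ∈ F, (α n * ind a b (Int.fract (f n ω)) + γ n) ∂P -
      ∫ ω, ∏ n ∈ F, phi η a b (α n) (γ n) (f n ω) ∂P| ≤
      4 ^ F.card * (F.card * (10 * η + 8 * δ / η)) := by
    rw [← integral_sub ig ip]
    refine abs_integral_le_integral_abs.trans ?_
    have ib : Integrable (fun ω => 4 ^ F.card * ∑ n ∈ F, (2 * η + tau η (f n ω + -b) + tau η (f n ω + -a))) P :=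
      (integrable_finsetSum _ fun n _ => ((integrable_const _).add (it n _)).add (it n _)).const_mul _
    refine (integral_mono (ig.sub ip).abs ib fun ω => ?_).trans ?_
    · refine (prod_tele F _ _ (fun n => bg n (f n ω)) (fun n => bp n (f n ω))).trans ?_
      gcongr with n hn
      exact phi_err η a b (α n) (γ n) (f n ω) h0 h1 ha hab hb (hα n)
    · rw [integral_const_mul, integral_finsetSum]
      swap
      · exact fun n _ => ((integrable_const _).add (it n _)).add (it n _)
      gcongr
      refine (Finset.sum_le_card_nsmul _ _ (10 * η + 8 * δ / η) fun n hn => ?_).trans (by rw [nsmul_eq_mul])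
      have i1 : Integrable (fun ω => 2 * η + tau η (f n ω + -b)) P := (integrable_const _).add (it n _)
      rw [integral_add i1 (it n _), integral_add (integrable_const _) (it n _)]
      have t1 := htau n hn (-b)
      have t2 := htau n hn (-a)
      simp only [integral_const, probReal_univ, smul_eq_mul, one_mul]
      have : 8 * δ / η = 4 / η * δ + 4 / η * δ := by ring
      linarith
  refine (abs_sub_le _ (∫ ω, ∏ n ∈ F, phi η a b (α n) (γ n) (f n ω) ∂P) _).trans ?_
  exact add_le_add herr hmain

end LIL

namespace LIL
open Polynomial

lemma ev_rpow (C p q : ℝ) (hpq : p < q) : ∀ᶠ x : ℝ in atTop, C * x ^ p ≤ x ^ q := by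
  filter_upwards [(tendsto_rpow_atTop (sub_pos.2 hpq)).eventually_ge_atTop C, eventually_gt_atTop 0]
    with x h1 h2
  have : x ^ q = x ^ (q - p) * x ^ p := by rw [← Real.rpow_add h2]; ring_nf
  rw [this]; gcongr

lemma ev_log (C p q : ℝ) (hC : 0 ≤ C) (hpq : p < q) :
    ∀ᶠ x : ℝ in atTop, C * (Real.log x * x ^ p) ≤ x ^ q := by
  filter_upwards [ev_rpow (C * (1 / ((q - p) / 2))) (p + (q - p) / 2) q (by linarith),
    eventually_gt_atTop 0] with x h1 h2
  refine le_trans ?_ h1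
  have h3 := Real.log_le_rpow_div h2.le (show 0 < (q - p) / 2 by linarith)
  rw [Real.rpow_add h2]
  have : Real.log x * x ^ p ≤ (x ^ ((q - p) / 2) / ((q - p) / 2)) * x ^ p := by gcongr
  calc _ ≤ C * ((x ^ ((q - p) / 2) / ((q - p) / 2)) * x ^ p) := by gcongr
    _ = _ := by ring

lemma ev_const (C q : ℝ) (hq : 0 < q) : ∀ᶠ x : ℝ in atTop, C ≤ x ^ q :=
  (tendsto_rpow_atTop hq).eventually_ge_atTop C

lemma ev_log' (C q : ℝ) (hC : 0 ≤ C) (hq : 0 < q) :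
    ∀ᶠ x : ℝ in atTop, C * Real.log x ≤ x ^ q := by
  filter_upwards [ev_log C 0 q hC hq] with x hx
  simpa using hx

/-- asymptotic facts about the degree -/
lemma ev_deg (A ξ : ℝ) (hA : 1 < A) (hξ : 0 < ξ) : ∀ᶠ n0 : ℕ in atTop, ∀ m : ℕ, n0 ≤ m →
    2 ≤ m ∧ 2 * (m : ℝ) ≤ Real.exp ((m : ℝ) ^ (4 / 5 : ℝ)) ∧
    Real.log m * (m : ℝ) ^ (4 / 5 : ℝ) ≤ Real.log ξ + ((m - 1 : ℕ) : ℝ) * Real.log A := by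
  have hlA : 0 < Real.log A := Real.log_pos hA
  refine eventually_forall_ge_atTop.2 ?_
  have key := tendsto_natCast_atTop_atTop (R := ℝ)
  filter_upwards [eventually_ge_atTop 2, key.eventually (ev_log' 2 (4 / 5) (by norm_num) (by norm_num)),
    key.eventually (ev_const (2 * Real.log 2) (4 / 5) (by norm_num)),
    key.eventually (ev_log (2 / Real.log A) (4 / 5) 1 (by positivity) (by norm_num)),
    key.eventually (ev_const (2 * (-Real.log ξ + Real.log A) / Real.log A) 1 (by norm_num))]
    with m h2 h3 h4 h5 h6
  have hm : (2 : ℝ) ≤ m := by exact_mod_cast h2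
  refine ⟨h2, ?_, ?_⟩
  · rw [← Real.log_le_iff_le_exp (by positivity), Real.log_mul (by norm_num) (by positivity)]
    linarith
  · rw [Real.rpow_one, div_mul_eq_mul_div, div_le_iff₀ hlA] at h5
    rw [Real.rpow_one, div_le_iff₀ hlA] at h6
    rw [Nat.cast_sub (by omega)]
    push_cast
    linarith

/-- normalised Lebesgue measure -/
noncomputable def nrm (A B : ℝ) : Measure ℝ := ProbabilityTheory.cond volume (Set.Ioc A B)

lemma nrm_prob (A B : ℝ) (h : A < B) : IsProbabilityMeasure (nrm A B) := by
  refine ProbabilityTheory.cond_isProbabilityMeasure_of_finite ?_ ?_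
  · simp [h]
  · simp

lemma nrm_integral (A B : ℝ) (h : A < B) (f : ℝ → ℂ) :
    ‖∫ x, f x ∂(nrm A B)‖ = (B - A)⁻¹ * ‖∫ x in A..B, f x‖ := by
  unfold nrm ProbabilityTheory.cond
  rw [integral_smul_measure, intervalIntegral.integral_of_le h.le, norm_smul, Real.volume_Ioc,
    ENNReal.toReal_inv, ENNReal.toReal_ofReal (by linarith), Real.norm_of_nonneg]
  exact inv_nonneg.2 (by linarith)

lemma osc_seq (A B ξ : ℝ) (hA : 1 < A) (hAB : A < B) (hξ : 0 < ξ) (s : ℕ → ℕ) (hs : StrictMono s) :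
    ∀ᶠ n0 : ℕ in atTop, ∀ F : Finset ℕ, (∀ n ∈ F, n0 ≤ n) → (F.card : ℝ) ≤ Real.log n0 →
    ∀ k : ℕ → ℤ, (∃ n ∈ F, k n ≠ 0) →
      ‖∫ x, ee (∑ n ∈ F, k n * (ξ * x ^ s n)) ∂(nrm A B)‖ ≤ Real.exp (-(n0 : ℝ) ^ (3 / 4 : ℝ)) := by
  have key := tendsto_natCast_atTop_atTop (R := ℝ)
  have hD : 0 < (B - A)⁻¹ * (24 * B) := mul_pos (inv_pos.2 (by linarith)) (by linarith)
  set D := (B - A)⁻¹ * (24 * B) with hDdef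
  filter_upwards [ev_deg A ξ hA hξ, eventually_ge_atTop 1,
    key.eventually (ev_const (3 * Real.log D) (4 / 5) (by norm_num)),
    key.eventually (ev_log' 6 (4 / 5) (by norm_num) (by norm_num)),
    key.eventually (ev_rpow 3 (3 / 4) (4 / 5) (by norm_num))] with n0 hdeg hn1 a1 a2 a3 F hF hcard k hk
  obtain ⟨n, hnG, hmax⟩ := (F.filter (fun n => k n ≠ 0)).exists_max_image id
    (by obtain ⟨n, hn, h⟩ := hk; exact ⟨n, by simp [hn, h]⟩)
  simp only [Finset.mem_filter, id] at hnG hmax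
  obtain ⟨hnF, hkn⟩ := hnG
  set P : ℝ[X] := ∑ n ∈ F, monomial (s n) (ξ * k n) with hP
  have heval : ∀ x : ℝ, P.eval x = ∑ n ∈ F, k n * (ξ * x ^ s n) := by
    intro x
    rw [hP, eval_finsetSum]
    refine Finset.sum_congr rfl fun i _ => ?_
    rw [eval_monomial]; ring
  have hcoeff : ∀ j, P.coeff j = ∑ n ∈ F, if s n = j then ξ * k n else 0 := by
    intro j; rw [hP, finsetSum_coeff]; simp only [coeff_monomial]
  have hcn : P.coeff (s n) = ξ * k n := by
    rw [hcoeff, Finset.sum_eq_single n]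
    · simp
    · intro i _ hi; rw [if_neg (fun h => hi (hs.injective h))]
    · exact fun h => absurd hnF h
  have hcn0 : P.coeff (s n) ≠ 0 := by
    rw [hcn]; exact mul_ne_zero hξ.ne' (by exact_mod_cast hkn)
  have hnd : P.natDegree = s n := by
    refine natDegree_eq_of_le_of_coeff_ne_zero ?_ hcn0
    rw [natDegree_le_iff_coeff_eq_zero]
    intro j hj
    rw [hcoeff]
    refine Finset.sum_eq_zero fun i hi => ?_
    split_ifs with h
    · by_contra h2
      have h3 : k i ≠ 0 := by rintro h4; simp [h4] at h2
      have := hs.monotone (hmax i ⟨hi, h3⟩)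
      omega
    · rfl
  have hsupp : P.support.card ≤ F.card := by
    refine le_trans (Finset.card_le_card (t := F.image s) ?_) Finset.card_image_le
    intro j hj
    rw [mem_support_iff, hcoeff] at hj
    obtain ⟨i, hi, h⟩ := Finset.exists_ne_zero_of_sum_ne_zero hj
    rw [Finset.mem_image]
    refine ⟨i, hi, ?_⟩
    by_contra h2; simp [h2] at h
  have hlead : ξ ≤ |P.leadingCoeff| := by
    rw [leadingCoeff, hnd, hcn, abs_mul, abs_of_pos hξ]
    have : (1 : ℝ) ≤ |(k n : ℝ)| := by exact_mod_cast Int.one_le_abs hkn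
    nlinarith
  have hm0 : n0 ≤ s n := (hF n hnF).trans hs.le_apply
  obtain ⟨d1, d2, d3⟩ := hdeg (s n) hm0
  have hn0 : (1 : ℝ) ≤ n0 := by exact_mod_cast hn1
  have hm0' : (n0 : ℝ) ≤ s n := by exact_mod_cast hm0
  have hb := osc_bound P F.card A B (Real.exp ((s n : ℝ) ^ (4 / 5 : ℝ))) ξ hA.le hAB.le hξ
    (by omega) hsupp hlead (by rw [hnd]; exact d2) (by
      rw [hnd, ← Real.exp_nat_mul]
      have e : ξ * A ^ (s n - 1) = Real.exp (Real.log ξ + ((s n - 1 : ℕ) : ℝ) * Real.log A) := by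
        rw [Real.exp_add, Real.exp_log hξ, Real.exp_nat_mul, Real.exp_log (by linarith)]
      rw [e]
      refine Real.exp_le_exp.2 (le_trans ?_ d3)
      gcongr
      exact hcard.trans (Real.log_le_log (by linarith) hm0'))
  simp only [heval] at hb
  rw [nrm_integral A B hAB]
  have hAB' : 0 < (B - A)⁻¹ := inv_pos.2 (by linarith)
  calc _ ≤ (B - A)⁻¹ * (24 * B * (F.card + 1) ^ 2 / Real.exp ((s n : ℝ) ^ (4 / 5 : ℝ))) := by gcongr
    _ = D * (F.card + 1) ^ 2 * Real.exp (-(s n : ℝ) ^ (4 / 5 : ℝ)) := by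
      rw [Real.exp_neg, hDdef]; ring
    _ ≤ Real.exp (Real.log D) * Real.exp (2 * Real.log n0) * Real.exp (-(n0 : ℝ) ^ (4 / 5 : ℝ)) := by
      rw [Real.exp_log hD]
      gcongr
      have : (F.card : ℝ) + 1 ≤ Real.exp (Real.log n0) :=
        (add_le_add hcard le_rfl).trans (Real.add_one_le_exp _)
      calc ((F.card : ℝ) + 1) ^ 2 ≤ (Real.exp (Real.log n0)) ^ 2 := by gcongr
        _ = _ := by rw [← Real.exp_nat_mul]; norm_num
    _ ≤ _ := by
      rw [← Real.exp_add, ← Real.exp_add]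
      refine Real.exp_le_exp.2 ?_
      linarith

/-- near independence -/
def Good {Ω : Type*} [MeasurableSpace Ω] (P : Measure Ω) (X : ℕ → Ω → ℝ) : Prop :=
  (∀ n, Measurable (X n)) ∧ ∀ᶠ n0 : ℕ in atTop, ∀ F : Finset ℕ, (∀ n ∈ F, n0 ≤ n) →
    (F.card : ℝ) ≤ Real.log n0 → ∀ a b : ℝ, 0 ≤ a → a < b → b ≤ 1 → ∀ α γ : ℕ → ℝ,
    (∀ n, |α n| ≤ 1) → (∀ n, |γ n| ≤ 1) →
    |∫ ω, ∏ n ∈ F, (α n * ind a b (X n ω) + γ n) ∂P - ∏ n ∈ F, (α n * (b - a) + γ n)| ≤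
      Real.exp (-√(n0 : ℝ))

lemma good_nrm (A B ξ : ℝ) (hA : 1 < A) (hAB : A < B) (hξ : 0 < ξ) (s : ℕ → ℕ) (hs : StrictMono s) :
    Good (nrm A B) (fun n x => Int.fract (ξ * x ^ s n)) := by
  haveI := nrm_prob A B hAB
  have hm : ∀ n, Measurable (fun x : ℝ => ξ * x ^ s n) := fun n => by fun_prop
  refine ⟨fun n => measurable_fract.comp (hm n), ?_⟩
  have key := tendsto_natCast_atTop_atTop (R := ℝ)
  filter_upwards [osc_seq A B ξ hA hAB hξ s hs, eventually_ge_atTop 16,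
    key.eventually (ev_log' 6 (1 / 2) (by norm_num) (by norm_num)),
    key.eventually (ev_const 12 (1 / 2) (by norm_num)),
    key.eventually (ev_log' 20 (3 / 4) (by norm_num) (by norm_num)),
    key.eventually (ev_log 20 (1 / 2) (3 / 4) (by norm_num) (by norm_num)),
    key.eventually (ev_const 20 (3 / 4) (by norm_num)),
    key.eventually (ev_rpow 20 (1 / 2) (3 / 4) (by norm_num))]
    with n0 hosc hn a1 a2 a3 a4 a5 a6 F hF hcard a b ha hab hb α γ hα hγ
  have hn0 : (16 : ℝ) ≤ n0 := by exact_mod_cast hn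
  rw [← Real.sqrt_eq_rpow] at a1 a2 a4 a6
  set y := √(n0 : ℝ) with hy
  set L := Real.log n0 with hL
  set z := (n0 : ℝ) ^ (3 / 4 : ℝ) with hz
  set r : ℝ := (F.card : ℝ) with hr
  have hr0 : 0 ≤ r := by positivity
  have hL0 : 0 ≤ L := hr0.trans hcard
  have hη : Real.exp (-(2 * y)) ≤ 1 / 8 := by
    have h1 : Real.exp (-(2 * y)) ≤ Real.exp (-3) := Real.exp_le_exp.2 (by linarith)
    refine h1.trans ?_
    rw [Real.exp_neg, show (3 : ℝ) = 1 + 1 + 1 by norm_num, Real.exp_add, Real.exp_add, one_div]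
    have := Real.exp_one_gt_d9
    refine inv_anti₀ (by norm_num) ?_
    have h2 : (2:ℝ) ≤ Real.exp 1 := by linarith
    calc (8:ℝ) = 2 * 2 * 2 := by norm_num
      _ ≤ _ := by gcongr
  have main := near_indep (nrm A B) (fun n x => ξ * x ^ s n) hm F (Real.exp (-z)) (Real.exp (-(2 * y)))
    (Real.exp_pos _).le (Real.exp_pos _) hη (hosc F hF hcard) a b ha hab hb α γ hα hγ
  refine main.trans ?_
  have e4 : (4 : ℝ) ≤ Real.exp 2 := by
    rw [show (2 : ℝ) = 1 + 1 by norm_num, Real.exp_add]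
    have := Real.exp_one_gt_d9
    nlinarith
  have e16 : (16 : ℝ) ≤ Real.exp 4 := by
    rw [show (4 : ℝ) = 2 + 2 by norm_num, Real.exp_add]
    nlinarith
  have p4 : (4 : ℝ) ^ F.card ≤ Real.exp (2 * L) := by
    calc (4 : ℝ) ^ F.card ≤ (Real.exp 2) ^ F.card := by gcongr
      _ = Real.exp (F.card * 2) := by rw [← Real.exp_nat_mul]
      _ ≤ _ := Real.exp_le_exp.2 (by rw [← hr]; linarith)
  have pr : r ≤ Real.exp L := by
    have := Real.add_one_le_exp L; linarith
  have t1 : 4 ^ F.card * (r * (10 * Real.exp (-(2 * y)))) ≤ Real.exp (-y - 2) := by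
    calc _ ≤ Real.exp (2 * L) * (Real.exp L * (Real.exp 4 * Real.exp (-(2 * y)))) := by
          gcongr; linarith
      _ = Real.exp (2 * L + (L + (4 + (-(2 * y))))) := by simp only [Real.exp_add]
      _ ≤ _ := Real.exp_le_exp.2 (by linarith)
  have t2 : 4 ^ F.card * (r * (8 * Real.exp (-z) / Real.exp (-(2 * y)))) ≤ Real.exp (-y - 2) := by
    rw [mul_div_assoc, ← Real.exp_sub]
    calc _ ≤ Real.exp (2 * L) * (Real.exp L * (Real.exp 4 * Real.exp (-z - -(2 * y)))) := by
          gcongr; linarith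
      _ = Real.exp (2 * L + (L + (4 + (-z - -(2 * y))))) := by simp only [Real.exp_add]
      _ ≤ _ := Real.exp_le_exp.2 (by linarith)
  have t3 : (4 / Real.exp (-(2 * y))) ^ F.card * Real.exp (-z) ≤ Real.exp (-y - 2) := by
    have : (4 / Real.exp (-(2 * y))) ≤ Real.exp (2 + 2 * y) := by
      rw [div_le_iff₀ (Real.exp_pos _), ← Real.exp_add]
      refine e4.trans (Real.exp_le_exp.2 (by linarith))
    calc _ ≤ (Real.exp (2 + 2 * y)) ^ F.card * Real.exp (-z) := by gcongr
      _ = Real.exp (r * (2 + 2 * y) + -z) := by rw [← Real.exp_nat_mul, ← Real.exp_add]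
      _ ≤ _ := by
        refine Real.exp_le_exp.2 ?_
        have : r * (2 + 2 * y) ≤ L * (2 + 2 * y) := by gcongr
        linarith
  have t4 : 3 * Real.exp (-y - 2) ≤ Real.exp (-y) := by
    have : Real.exp (-y) = Real.exp 2 * Real.exp (-y - 2) := by rw [← Real.exp_add]; ring_nf
    rw [this]
    gcongr; linarith
  have e : 4 ^ F.card * (r * (10 * Real.exp (-(2 * y)) + 8 * Real.exp (-z) / Real.exp (-(2 * y)))) =
    4 ^ F.card * (r * (10 * Real.exp (-(2 * y)))) +
      4 ^ F.card * (r * (8 * Real.exp (-z) / Real.exp (-(2 * y)))) := by ring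
  rw [e]
  linarith

end LIL

namespace LIL
open ProbabilityTheory

noncomputable def UU : Measure ℝ := volume.restrict (Set.Ico 0 1)

instance : IsProbabilityMeasure UU := ⟨by simp [UU]⟩

/-- the iid model -/
noncomputable def QQ : Measure (ℕ → ℝ) := Measure.infinitePi (fun _ : ℕ => UU)

instance : IsProbabilityMeasure QQ := by unfold QQ; infer_instance

def YY (n : ℕ) (ω : ℕ → ℝ) : ℝ := ω n

lemma measurable_YY (n : ℕ) : Measurable (YY n) := measurable_pi_apply n

lemma indep_YY : iIndepFun YY QQ :=
  iIndepFun_infinitePi (P := fun _ : ℕ => UU) (X := fun _ x => x) (fun _ => measurable_id)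

lemma integral_ind (n : ℕ) (a b : ℝ) (ha : 0 ≤ a) (hab : a < b) (hb : b ≤ 1) :
    ∫ ω, ind a b (YY n ω) ∂QQ = b - a := by
  have h1 : ∫ ω, ind a b (YY n ω) ∂QQ = ∫ x, ind a b x ∂UU := by
    rw [← Measure.infinitePi_map_eval (fun _ : ℕ => UU) n, integral_map]
    · rfl
    · exact (measurable_pi_apply n).aemeasurable
    · exact (measurable_ind a b).aestronglyMeasurable
  rw [h1]
  have hsub : Set.Ico a b ∩ Set.Ico 0 1 = Set.Ico a b := Set.inter_eq_left.2
    (fun x (hx : x ∈ Set.Ico a b) => (⟨ha.trans hx.1, hx.2.trans_le hb⟩ : x ∈ Set.Ico (0:ℝ) 1))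
  unfold ind UU
  rw [integral_indicator measurableSet_Ico, Measure.restrict_restrict measurableSet_Ico, hsub]
  simp [hab.le]

lemma Q_prod (F : Finset ℕ) (g : ℕ → ℝ → ℝ) (hg : ∀ n, Measurable (g n)) :
    ∫ ω, ∏ n ∈ F, g n (YY n ω) ∂QQ = ∏ n ∈ F, ∫ ω, g n (YY n ω) ∂QQ := by
  have h := iIndepFun.integral_fun_prod_comp (ι := F) (X := fun i : F => YY i) (f := fun i : F => g i)
    (indep_YY.precomp Subtype.val_injective)
    (fun i => (measurable_YY i).aemeasurable) (fun i => (hg i).aestronglyMeasurable)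
  rw [← Finset.prod_coe_sort F (fun n => ∫ ω, g n (YY n ω) ∂QQ), ← h]
  congr 1
  ext ω
  rw [← Finset.prod_coe_sort F (fun n => g n (YY n ω))]

lemma integrable_ind {Ω : Type*} [MeasurableSpace Ω] (P : Measure Ω) [IsProbabilityMeasure P]
    {X : Ω → ℝ} (hX : Measurable X) (a b : ℝ) : Integrable (fun ω => ind a b (X ω)) P :=
  Integrable.of_bound ((measurable_ind a b).comp hX).aestronglyMeasurable 1 (ae_of_all _ fun ω => by
    rw [Real.norm_of_nonneg (ind_nonneg _ _ _)]; exact ind_le_one _ _ _)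

lemma Q_affine (n : ℕ) (a b α γ : ℝ) (ha : 0 ≤ a) (hab : a < b) (hb : b ≤ 1) :
    ∫ ω, (α * ind a b (YY n ω) + γ) ∂QQ = α * (b - a) + γ := by
  rw [integral_add ((integrable_ind QQ (measurable_YY n) a b).const_mul α) (integrable_const γ),
    integral_const_mul, integral_ind n a b ha hab hb]
  simp

lemma Q_affine_prod (F : Finset ℕ) (a b : ℝ) (α γ : ℕ → ℝ) (ha : 0 ≤ a) (hab : a < b) (hb : b ≤ 1) :
    ∫ ω, ∏ n ∈ F, (α n * ind a b (YY n ω) + γ n) ∂QQ = ∏ n ∈ F, (α n * (b - a) + γ n) := by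
  rw [Q_prod F (fun n y => α n * ind a b y + γ n)
    (fun n => ((measurable_ind a b).const_mul _).add_const _)]
  exact Finset.prod_congr rfl fun n _ => Q_affine n a b _ _ ha hab hb

/-- weighted sums of centred indicators -/
noncomputable def Sm {Ω : Type*} (X : ℕ → Ω → ℝ) (F : Finset ℕ) (c : ℕ → ℝ) (a b : ℝ) (ω : Ω) : ℝ :=
  ∑ n ∈ F, c n * (ind a b (X n ω) - (b - a))

lemma measurable_Sm {Ω : Type*} [MeasurableSpace Ω] {X : ℕ → Ω → ℝ} (hX : ∀ n, Measurable (X n))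
    (F : Finset ℕ) (c : ℕ → ℝ) (a b : ℝ) : Measurable (Sm X F c a b) := by
  unfold Sm
  exact Finset.measurable_sum _ fun n _ =>
    (((measurable_ind a b).comp (hX n)).sub_const _).const_mul _

lemma abs_D_le (a b y : ℝ) (ha : 0 ≤ a) (hab : a < b) (hb : b ≤ 1) : |ind a b y - (b - a)| ≤ 1 := by
  rcases ind_mem a b y with h | h <;> rw [h, abs_le] <;> constructor <;> linarith

lemma abs_Sm_le {Ω : Type*} (X : ℕ → Ω → ℝ) (F : Finset ℕ) (c : ℕ → ℝ) (a b : ℝ) (ω : Ω)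
    (ha : 0 ≤ a) (hab : a < b) (hb : b ≤ 1) : |Sm X F c a b ω| ≤ ∑ n ∈ F, |c n| := by
  unfold Sm
  refine (Finset.abs_sum_le_sum_abs _ _).trans (Finset.sum_le_sum fun n _ => ?_)
  rw [abs_mul]
  exact mul_le_of_le_one_right (abs_nonneg _) (abs_D_le a b _ ha hab hb)

lemma D_pow (a b y : ℝ) (m : ℕ) : (ind a b y - (b - a)) ^ m =
    ((1 - (b - a)) ^ m - (-(b - a)) ^ m) * ind a b y + (-(b - a)) ^ m := by
  rcases ind_mem a b y with h | h <;> rw [h]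
  · simp
  · ring

lemma D_coef (l : ℝ) (m : ℕ) (h0 : 0 ≤ l) (h1 : l ≤ 1) : |(1 - l) ^ m - (-l) ^ m| ≤ 1 := by
  rcases Nat.eq_zero_or_pos m with rfl | hm
  · simp
  refine (abs_sub _ _).trans ?_
  rw [abs_pow, abs_pow, abs_neg, abs_of_nonneg h0, abs_of_nonneg (by linarith : 0 ≤ 1 - l)]
  have e1 := pow_le_of_le_one (by linarith : 0 ≤ 1 - l) (by linarith) hm.ne'
  have e2 := pow_le_of_le_one h0 h1 hm.ne'
  linarith

/-- the near independence at level `n0` -/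
def GoodAt {Ω : Type*} [MeasurableSpace Ω] (P : Measure Ω) (X : ℕ → Ω → ℝ) (n0 : ℕ) : Prop :=
  ∀ F : Finset ℕ, (∀ n ∈ F, n0 ≤ n) →
    (F.card : ℝ) ≤ Real.log n0 → ∀ a b : ℝ, 0 ≤ a → a < b → b ≤ 1 → ∀ α γ : ℕ → ℝ,
    (∀ n, |α n| ≤ 1) → (∀ n, |γ n| ≤ 1) →
    |∫ ω, ∏ n ∈ F, (α n * ind a b (X n ω) + γ n) ∂P - ∏ n ∈ F, (α n * (b - a) + γ n)| ≤
      Real.exp (-√(n0 : ℝ))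

section
variable {Ω : Type*} [MeasurableSpace Ω] {P : Measure Ω} [IsProbabilityMeasure P]
  {X : ℕ → Ω → ℝ}

lemma monomial_cmp (hX : ∀ n, Measurable (X n)) {n0 : ℕ} (hG : GoodAt P X n0) (F : Finset ℕ) (hF : ∀ n ∈ F, n0 ≤ n) (a b : ℝ)
    (ha : 0 ≤ a) (hab : a < b) (hb : b ≤ 1) (e : ℕ → ℕ) (he : ((∑ n ∈ F, e n : ℕ) : ℝ) ≤ Real.log n0) :
    |∫ ω, ∏ n ∈ F, (ind a b (X n ω) - (b - a)) ^ e n ∂P -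
      ∫ ω, ∏ n ∈ F, (ind a b (YY n ω) - (b - a)) ^ e n ∂QQ| ≤ Real.exp (-√(n0 : ℝ)) := by
  classical
  set G := F.filter (fun n => e n ≠ 0) with hGdef
  have hcard : (G.card : ℝ) ≤ Real.log n0 := by
    refine le_trans ?_ he
    have : G.card ≤ ∑ n ∈ F, e n := by
      calc G.card = ∑ n ∈ G, 1 := by simp
        _ ≤ ∑ n ∈ G, e n := Finset.sum_le_sum fun n hn => by
            have := (Finset.mem_filter.1 hn).2; omega
        _ ≤ _ := Finset.sum_le_sum_of_subset (Finset.filter_subset _ _)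
    exact_mod_cast this
  have hred : ∀ z : ℕ → ℝ, ∏ n ∈ F, z n ^ e n = ∏ n ∈ G, z n ^ e n := by
    intro z
    rw [hGdef, Finset.prod_filter]
    refine Finset.prod_congr rfl fun n _ => ?_
    split_ifs with h
    · rfl
    · push Not at h; simp [h]
  have h1 : ∀ ω, ∏ n ∈ F, (ind a b (X n ω) - (b - a)) ^ e n = ∏ n ∈ G,
      (((1 - (b - a)) ^ e n - (-(b - a)) ^ e n) * ind a b (X n ω) + (-(b - a)) ^ e n) := by
    intro ω
    rw [hred (fun n => ind a b (X n ω) - (b - a))]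
    exact Finset.prod_congr rfl fun n _ => D_pow _ _ _ _
  have h2 : ∀ ω, ∏ n ∈ F, (ind a b (YY n ω) - (b - a)) ^ e n = ∏ n ∈ G,
      (((1 - (b - a)) ^ e n - (-(b - a)) ^ e n) * ind a b (YY n ω) + (-(b - a)) ^ e n) := by
    intro ω
    rw [hred (fun n => ind a b (YY n ω) - (b - a))]
    exact Finset.prod_congr rfl fun n _ => D_pow _ _ _ _
  simp only [h1, h2]
  rw [Q_affine_prod G a b _ _ ha hab hb]
  refine hG G (fun n hn => hF n (Finset.mem_filter.1 hn).1) hcard a b ha hab hb _ _ (fun n => ?_) (fun n => ?_)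
  · exact D_coef _ _ (by linarith) (by linarith)
  · rw [abs_pow, abs_neg, abs_of_pos (by linarith)]
    exact pow_le_one₀ (by linarith) (by linarith)

lemma Sm_pow_eq {Ω' : Type*} (Z : ℕ → Ω' → ℝ) (F : Finset ℕ) (c : ℕ → ℝ) (a b : ℝ) (k : ℕ) (ω : Ω') :
    Sm Z F c a b ω ^ k = ∑ e ∈ Finset.piAntidiag F k, (Nat.multinomial F e * ∏ n ∈ F, c n ^ e n) *
      ∏ n ∈ F, (ind a b (Z n ω) - (b - a)) ^ e n := by
  unfold Sm
  rw [Finset.sum_pow_eq_sum_piAntidiag]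
  refine Finset.sum_congr rfl fun e _ => ?_
  rw [mul_assoc, ← Finset.prod_mul_distrib]
  simp only [mul_pow]

lemma integrable_mono {Ω' : Type*} [MeasurableSpace Ω'] (R : Measure Ω') [IsProbabilityMeasure R]
    (Z : ℕ → Ω' → ℝ) (hZ : ∀ n, Measurable (Z n)) (F : Finset ℕ) (a b : ℝ)
    (ha : 0 ≤ a) (hab : a < b) (hb : b ≤ 1) (e : ℕ → ℕ) :
    Integrable (fun ω => ∏ n ∈ F, (ind a b (Z n ω) - (b - a)) ^ e n) R := by
  refine Integrable.of_bound (Finset.measurable_prod _ fun n _ =>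
    (((measurable_ind a b).comp (hZ n)).sub_const _).pow_const _).aestronglyMeasurable 1
    (ae_of_all _ fun ω => ?_)
  rw [Real.norm_eq_abs, Finset.abs_prod]
  refine Finset.prod_le_one (fun _ _ => abs_nonneg _) fun n _ => ?_
  rw [abs_pow]
  exact pow_le_one₀ (abs_nonneg _) (abs_D_le _ _ _ ha hab hb)

/-- moment comparison -/
lemma moment_cmp (hX : ∀ n, Measurable (X n)) {n0 : ℕ} (hG : GoodAt P X n0) (F : Finset ℕ)
    (hF : ∀ n ∈ F, n0 ≤ n) (a b : ℝ)
    (ha : 0 ≤ a) (hab : a < b) (hb : b ≤ 1) (c : ℕ → ℝ) (k : ℕ) (hk : (k : ℝ) ≤ Real.log n0) :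
    |∫ ω, Sm X F c a b ω ^ k ∂P - ∫ ω, Sm YY F c a b ω ^ k ∂QQ| ≤
      (∑ n ∈ F, |c n|) ^ k * Real.exp (-√(n0 : ℝ)) := by
  simp only [Sm_pow_eq]
  rw [integral_finsetSum _ (fun e _ => (integrable_mono P X hX F a b ha hab hb e).const_mul _),
    integral_finsetSum _ (fun e _ => (integrable_mono QQ YY measurable_YY F a b ha hab hb e).const_mul _),
    ← Finset.sum_sub_distrib, Finset.sum_pow_eq_sum_piAntidiag, Finset.sum_mul]
  refine (Finset.abs_sum_le_sum_abs _ _).trans (Finset.sum_le_sum fun e he => ?_)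
  rw [integral_const_mul, integral_const_mul, ← mul_sub, abs_mul, abs_mul, Finset.abs_prod, Nat.abs_cast]
  simp only [abs_pow]
  gcongr
  refine monomial_cmp hX hG F hF a b ha hab hb e ?_
  rw [(Finset.mem_piAntidiag.1 he).1]
  exact hk

lemma pow_le_cosh (z : ℝ) (p : ℕ) : z ^ (2 * p) ≤ (2 * p).factorial * Real.cosh z := by
  have h := Real.hasSum_cosh z
  have h2 := h.summable.le_tsum p (fun j _ => by
    have : 0 ≤ z ^ (2 * j) := by rw [pow_mul]; positivity
    positivity)
  rw [h.tsum_eq, div_le_iff₀ (by positivity)] at h2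
  linarith

lemma integrable_Sm_fun {Ω' : Type*} [MeasurableSpace Ω'] (R : Measure Ω') [IsProbabilityMeasure R]
    (Z : ℕ → Ω' → ℝ) (hZ : ∀ n, Measurable (Z n)) (F : Finset ℕ) (c : ℕ → ℝ) (a b : ℝ)
    (ha : 0 ≤ a) (hab : a < b) (hb : b ≤ 1) {E : Type*} [NormedAddCommGroup E]
    [SecondCountableTopologyEither ℝ E]
    (f : ℝ → E) (hf : Continuous f) :
    Integrable (fun ω => f (Sm Z F c a b ω)) R := by
  obtain ⟨C, hC⟩ := (isCompact_Icc (a := -∑ n ∈ F, |c n|) (b := ∑ n ∈ F, |c n|)).exists_bound_of_continuousOn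
    hf.continuousOn
  refine Integrable.of_bound ?_ C (ae_of_all _ fun ω => hC _ (abs_le.1 (abs_Sm_le Z F c a b ω ha hab hb)))
  exact hf.comp_aestronglyMeasurable (measurable_Sm hZ F c a b).aestronglyMeasurable

/-- moments of the iid model -/
lemma Q_moment (F : Finset ℕ) (a b : ℝ) (ha : 0 ≤ a) (hab : a < b) (hb : b ≤ 1) (c : ℕ → ℝ) (p : ℕ)
    (t K : ℝ) (ht : 0 < t) (hK : ∫ ω, Real.cosh (t * Sm YY F c a b ω) ∂QQ ≤ K) :
    ∫ ω, Sm YY F c a b ω ^ (2 * p) ∂QQ ≤ (2 * p).factorial * K / t ^ (2 * p) := by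
  rw [le_div_iff₀ (by positivity), mul_comm, ← integral_const_mul]
  calc _ ≤ ∫ ω, (2 * p).factorial * Real.cosh (t * Sm YY F c a b ω) ∂QQ := by
        refine integral_mono ?_ ?_ fun ω => ?_
        · exact integrable_Sm_fun QQ YY measurable_YY F c a b ha hab hb
            (fun z => t ^ (2 * p) * z ^ (2 * p)) (by fun_prop)
        · exact integrable_Sm_fun QQ YY measurable_YY F c a b ha hab hb
            (fun z => (2 * p).factorial * Real.cosh (t * z)) (by fun_prop)
        · have := pow_le_cosh (t * Sm YY F c a b ω) p
          rwa [mul_pow] at this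
    _ ≤ _ := by
        rw [integral_const_mul]; gcongr

/-- the tail bound -/
lemma tail (hX : ∀ n, Measurable (X n)) {n0 : ℕ} (hG : GoodAt P X n0) (F : Finset ℕ)
    (hF : ∀ n ∈ F, n0 ≤ n) (a b : ℝ)
    (ha : 0 ≤ a) (hab : a < b) (hb : b ≤ 1) (c : ℕ → ℝ) (p : ℕ) (hp : ((2 * p : ℕ) : ℝ) ≤ Real.log n0)
    (t K u : ℝ) (ht : 0 < t) (hu : 0 < u) (hK : ∫ ω, Real.cosh (t * Sm YY F c a b ω) ∂QQ ≤ K) :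
    P.real {ω | u ≤ |Sm X F c a b ω|} ≤
      ((2 * p).factorial * K / t ^ (2 * p) + (∑ n ∈ F, |c n|) ^ (2 * p) * Real.exp (-√(n0 : ℝ))) / u ^ (2 * p) := by
  rw [le_div_iff₀ (by positivity)]
  have h1 := moment_cmp hX hG F hF a b ha hab hb c (2 * p) hp
  have h2 := Q_moment F a b ha hab hb c p t K ht hK
  have h3 := (le_abs_self _).trans h1
  have hi : Integrable (fun ω => Sm X F c a b ω ^ (2 * p)) P :=
    integrable_Sm_fun P X hX F c a b ha hab hb (fun z => z ^ (2 * p)) (by fun_prop)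
  have hm := mul_meas_ge_le_integral_of_nonneg (μ := P)
    (f := fun ω => Sm X F c a b ω ^ (2 * p)) (ae_of_all _ fun ω => by
      change (0:ℝ) ≤ Sm X F c a b ω ^ (2 * p)
      rw [pow_mul]; positivity) hi (u ^ (2 * p))
  have hsub : {ω | u ≤ |Sm X F c a b ω|} ⊆ {ω | u ^ (2 * p) ≤ Sm X F c a b ω ^ (2 * p)} := by
    intro ω hω
    have hω' : u ≤ |Sm X F c a b ω| := hω
    have : u ^ (2 * p) ≤ |Sm X F c a b ω| ^ (2 * p) := by gcongr
    rwa [pow_mul |Sm X F c a b ω|, sq_abs, ← pow_mul] at this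
  have hmono : P.real {ω | u ≤ |Sm X F c a b ω|} ≤ P.real {ω | u ^ (2 * p) ≤ Sm X F c a b ω ^ (2 * p)} :=
    measureReal_mono hsub
  have : 0 < u ^ (2 * p) := by positivity
  nlinarith
end

end LIL

namespace LIL
open ProbabilityTheory

lemma mgf1 (n : ℕ) (a b s : ℝ) (ha : 0 ≤ a) (hab : a < b) (hb : b ≤ 1) :
    ∫ ω, Real.exp (s * (ind a b (YY n ω) - (b - a))) ∂QQ =
      (b - a) * Real.exp (s * (1 - (b - a))) + (1 - (b - a)) * Real.exp (-(s * (b - a))) := by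
  have h : ∀ ω, Real.exp (s * (ind a b (YY n ω) - (b - a))) =
      (Real.exp (s * (1 - (b - a))) - Real.exp (-(s * (b - a)))) * ind a b (YY n ω) +
        Real.exp (-(s * (b - a))) := by
    intro ω
    rcases ind_mem a b (YY n ω) with h | h <;> rw [h]
    · simp; ring
    · ring
  simp only [h]
  rw [Q_affine n a b _ _ ha hab hb]
  ring

lemma mgf_Q (F : Finset ℕ) (c : ℕ → ℝ) (a b t : ℝ) :
    ∫ ω, Real.exp (t * Sm YY F c a b ω) ∂QQ =
      ∏ n ∈ F, ∫ ω, Real.exp ((t * c n) * (ind a b (YY n ω) - (b - a))) ∂QQ := by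
  rw [← Q_prod F (fun n y => Real.exp ((t * c n) * (ind a b y - (b - a))))
    (fun n => Real.measurable_exp.comp (((measurable_ind a b).sub_const _).const_mul _))]
  congr 1
  ext ω
  rw [← Real.exp_sum]
  unfold Sm
  rw [Finset.mul_sum]
  simp only [mul_assoc]

lemma mgf1_hoeff (n : ℕ) (a b s : ℝ) (ha : 0 ≤ a) (hab : a < b) (hb : b ≤ 1) :
    ∫ ω, Real.exp (s * (ind a b (YY n ω) - (b - a))) ∂QQ ≤ Real.exp (s ^ 2 / 8) := by
  have h := (hasSubgaussianMGF_of_mem_Icc (μ := QQ) (X := fun ω => ind a b (YY n ω)) (a := 0) (b := 1)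
    ((measurable_ind a b).comp (measurable_YY n)).aemeasurable
    (ae_of_all _ fun ω => ⟨ind_nonneg _ _ _, ind_le_one _ _ _⟩)).mgf_le s
  unfold mgf at h
  rw [integral_ind n a b ha hab hb] at h
  refine h.trans (le_of_eq ?_)
  congr 1
  simp
  ring

lemma mgf1_small (n : ℕ) (a b s : ℝ) (ha : 0 ≤ a) (hab : a < b) (hb : b ≤ 1) (hs : |s| ≤ 1) :
    ∫ ω, Real.exp (s * (ind a b (YY n ω) - (b - a))) ∂QQ ≤ Real.exp (s ^ 2 * (b - a)) := by
  rw [mgf1 n a b s ha hab hb]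
  have e1 : (b - a) * Real.exp (s * (1 - (b - a))) + (1 - (b - a)) * Real.exp (-(s * (b - a))) =
      Real.exp (-(s * (b - a))) * ((b - a) * (Real.exp s - 1) + 1) := by
    rw [show s * (1 - (b - a)) = -(s * (b - a)) + s by ring, Real.exp_add]
    ring
  rw [e1]
  have e2 := Real.add_one_le_exp ((b - a) * (Real.exp s - 1))
  have e3 := (le_abs_self _).trans (Real.abs_exp_sub_one_sub_id_le hs)
  calc _ ≤ Real.exp (-(s * (b - a))) * Real.exp ((b - a) * (Real.exp s - 1)) := by gcongr
    _ = Real.exp ((b - a) * (Real.exp s - 1 - s)) := by rw [← Real.exp_add]; ring_nf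
    _ ≤ _ := by
      rw [mul_comm (s ^ 2)]
      have : 0 < b - a := by linarith
      gcongr

lemma cosh_of_exp (F : Finset ℕ) (c : ℕ → ℝ) (a b t K : ℝ) (ha : 0 ≤ a) (hab : a < b) (hb : b ≤ 1)
    (h1 : ∫ ω, Real.exp (t * Sm YY F c a b ω) ∂QQ ≤ K) (h2 : ∫ ω, Real.exp ((-t) * Sm YY F c a b ω) ∂QQ ≤ K) :
    ∫ ω, Real.cosh (t * Sm YY F c a b ω) ∂QQ ≤ K := by
  have i1 : Integrable (fun ω => Real.exp (t * Sm YY F c a b ω)) QQ :=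
    integrable_Sm_fun QQ YY measurable_YY F c a b ha hab hb (fun z => Real.exp (t * z)) (by fun_prop)
  have i2 : Integrable (fun ω => Real.exp ((-t) * Sm YY F c a b ω)) QQ :=
    integrable_Sm_fun QQ YY measurable_YY F c a b ha hab hb (fun z => Real.exp ((-t) * z)) (by fun_prop)
  have : ∫ ω, Real.cosh (t * Sm YY F c a b ω) ∂QQ =
      (∫ ω, Real.exp (t * Sm YY F c a b ω) ∂QQ + ∫ ω, Real.exp ((-t) * Sm YY F c a b ω) ∂QQ) / 2 := by
    rw [← integral_add i1 i2, ← integral_div]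
    simp only [Real.cosh_eq, neg_mul]
  rw [this]
  linarith

lemma mgf_hoeff (F : Finset ℕ) (c : ℕ → ℝ) (a b t : ℝ) (ha : 0 ≤ a) (hab : a < b) (hb : b ≤ 1) :
    ∫ ω, Real.exp (t * Sm YY F c a b ω) ∂QQ ≤ Real.exp (t ^ 2 * (∑ n ∈ F, c n ^ 2) / 8) := by
  rw [mgf_Q]
  calc _ ≤ ∏ n ∈ F, Real.exp ((t * c n) ^ 2 / 8) :=
        Finset.prod_le_prod (fun n _ => integral_nonneg fun ω => (Real.exp_pos _).le)
          fun n _ => mgf1_hoeff n a b _ ha hab hb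
    _ = _ := by
      rw [← Real.exp_sum, Finset.mul_sum, Finset.sum_div]
      simp only [mul_pow]

lemma cosh_hoeff (F : Finset ℕ) (c : ℕ → ℝ) (a b t : ℝ) (ha : 0 ≤ a) (hab : a < b) (hb : b ≤ 1) :
    ∫ ω, Real.cosh (t * Sm YY F c a b ω) ∂QQ ≤ Real.exp (t ^ 2 * (∑ n ∈ F, c n ^ 2) / 8) := by
  refine cosh_of_exp F c a b t _ ha hab hb (mgf_hoeff F c a b t ha hab hb) ?_
  have := mgf_hoeff F c a b (-t) ha hab hb
  rwa [neg_sq] at this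

lemma cosh_small (F : Finset ℕ) (a b t : ℝ) (ha : 0 ≤ a) (hab : a < b) (hb : b ≤ 1) (ht : |t| ≤ 1) :
    ∫ ω, Real.cosh (t * Sm YY F (fun _ => 1) a b ω) ∂QQ ≤ Real.exp (t ^ 2 * (b - a) * F.card) := by
  have key : ∀ t : ℝ, |t| ≤ 1 → ∫ ω, Real.exp (t * Sm YY F (fun _ => 1) a b ω) ∂QQ ≤
      Real.exp (t ^ 2 * (b - a) * F.card) := by
    intro t ht
    rw [mgf_Q]
    calc _ ≤ ∏ n ∈ F, Real.exp (t ^ 2 * (b - a)) :=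
          Finset.prod_le_prod (fun n _ => integral_nonneg fun ω => (Real.exp_pos _).le)
            fun n _ => by
              have := mgf1_small n a b t ha hab hb ht
              simpa using this
      _ = _ := by
        rw [Finset.prod_const, ← Real.exp_nat_mul]; ring_nf
  refine cosh_of_exp F _ a b t _ ha hab hb (key t ht) ?_
  have := key (-t) (by rwa [abs_neg])
  rwa [neg_sq] at this

/-- a Stirling type upper bound -/
lemma factorial_le (n : ℕ) (hn : 1 ≤ n) :
    (n.factorial : ℝ) ≤ Real.exp 1 * n * (n / Real.exp 1) ^ n := by
  induction n, hn using Nat.le_induction with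
  | base =>
    simp
  | succ n hn ih =>
    have hn' : (0:ℝ) < n := by exact_mod_cast hn
    have key : Real.exp 1 * (n:ℝ) * (n / Real.exp 1) ^ n ≤ Real.exp 1 * ((n + 1) / Real.exp 1) ^ (n + 1) := by
      have h1 : Real.exp 1 * (n:ℝ) ^ (n + 1) ≤ ((n:ℝ) + 1) ^ (n + 1) := by
        have h2 : Real.exp (1 / (n + 1)) ≤ ((n:ℝ) + 1) / n := by
          have := Real.add_one_le_exp (-(1 / ((n:ℝ) + 1)))
          have h3 : (n:ℝ) / (n + 1) ≤ Real.exp (-(1 / ((n:ℝ) + 1))) := by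
            refine le_trans (le_of_eq ?_) this
            field_simp; ring
          rw [Real.exp_neg] at h3
          rw [le_div_iff₀ hn']
          have h4 := mul_le_mul_of_nonneg_right h3 (Real.exp_pos (1 / ((n:ℝ) + 1))).le
          rw [inv_mul_cancel₀ (Real.exp_pos _).ne', div_mul_eq_mul_div, div_le_one (by positivity)] at h4
          linarith
        have h5 : Real.exp 1 = Real.exp (1 / ((n:ℝ) + 1)) ^ (n + 1) := by
          rw [← Real.exp_nat_mul]; congr 1; push_cast; field_simp
        rw [h5, ← mul_pow]
        have : Real.exp (1 / ((n:ℝ) + 1)) * n ≤ n + 1 := by rwa [le_div_iff₀ hn'] at h2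
        gcongr
      rw [div_pow, div_pow]
      have he := Real.exp_pos 1
      rw [mul_div_assoc', mul_div_assoc', div_le_div_iff₀ (by positivity) (by positivity)]
      have e1 : Real.exp 1 * (n:ℝ) * n ^ n * Real.exp 1 ^ (n + 1) =
        (Real.exp 1 * n ^ (n + 1)) * Real.exp 1 ^ (n + 1) := by ring
      have e2 : Real.exp 1 * ((n:ℝ) + 1) ^ (n + 1) * Real.exp 1 ^ n =
        ((n:ℝ) + 1) ^ (n + 1) * Real.exp 1 ^ (n + 1) := by ring
      rw [e1, e2]
      gcongr
    rw [Nat.factorial_succ]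
    push_cast
    calc ((n:ℝ) + 1) * n.factorial ≤ (n + 1) * (Real.exp 1 * ((n + 1) / Real.exp 1) ^ (n + 1)) := by
          gcongr; exact ih.trans key
      _ = _ := by ring

end LIL

namespace LIL
open ProbabilityTheory

/-- centred counting function -/
noncomputable def T (z : ℕ → ℝ) (F : Finset ℕ) (a b : ℝ) : ℝ := ∑ n ∈ F, (ind a b (z n) - (b - a))

lemma Sm_one {Ω : Type*} (X : ℕ → Ω → ℝ) (F : Finset ℕ) (a b : ℝ) (ω : Ω) :
    Sm X F (fun _ => 1) a b ω = T (fun n => X n ω) F a b := by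
  simp [Sm, T]

lemma ind_split (a b y : ℝ) (ha : 0 ≤ a) (hab : a ≤ b) : ind a b y = ind 0 b y - ind 0 a y := by
  unfold ind
  by_cases h0 : 0 ≤ y <;> by_cases h1 : y < a <;> by_cases h2 : y < b <;>
    simp [Set.indicator, h0, h1, h2, not_le.2, not_lt.1] <;> linarith

lemma ind_mono (b c y : ℝ) (hbc : b ≤ c) : ind 0 b y ≤ ind 0 c y := by
  have hc := ind_nonneg 0 c y
  unfold ind at *
  by_cases h0 : y ∈ Set.Ico 0 b
  · rw [Set.indicator_of_mem h0, Set.indicator_of_mem (show y ∈ Set.Ico 0 c from ⟨h0.1, h0.2.trans_le hbc⟩)]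
  · rw [Set.indicator_of_notMem h0]; exact hc

lemma T_split (z : ℕ → ℝ) (F : Finset ℕ) (a b : ℝ) (ha : 0 ≤ a) (hab : a ≤ b) :
    T z F a b = T z F 0 b - T z F 0 a := by
  unfold T
  rw [← Finset.sum_sub_distrib]
  refine Finset.sum_congr rfl fun n _ => ?_
  rw [ind_split a b _ ha hab]; ring

lemma T_cons (z : ℕ → ℝ) (i j k : ℕ) (h1 : i ≤ j) (h2 : j ≤ k) (a b : ℝ) :
    T z (Finset.Ioc i k) a b = T z (Finset.Ioc i j) a b + T z (Finset.Ioc j k) a b :=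
  (Finset.sum_Ioc_consecutive _ h1 h2).symm

lemma abs_T_le (z : ℕ → ℝ) (F : Finset ℕ) (a b : ℝ) (ha : 0 ≤ a) (hab : a < b) (hb : b ≤ 1) :
    |T z F a b| ≤ F.card := by
  unfold T
  refine (Finset.abs_sum_le_sum_abs _ _).trans ?_
  refine (Finset.sum_le_sum fun n _ => abs_D_le a b (z n) ha hab hb).trans ?_
  simp

lemma T_mono (z : ℕ → ℝ) (F : Finset ℕ) (b c : ℝ) (hbc : b ≤ c) :
    T z F 0 b ≤ T z F 0 c + F.card * (c - b) := by
  have : F.card * (c - b) = ∑ n ∈ F, (c - b) := by simp [mul_sub]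
  unfold T
  rw [this, ← Finset.sum_add_distrib]
  refine Finset.sum_le_sum fun n _ => ?_
  have := ind_mono b c (z n) hbc
  linarith

lemma T_zero (z : ℕ → ℝ) (F : Finset ℕ) : T z F 0 0 = 0 := by
  simp [T, ind]

lemma T_one (z : ℕ → ℝ) (hz : ∀ n, z n ∈ Set.Ico (0:ℝ) 1) (F : Finset ℕ) : T z F 0 1 = 0 := by
  unfold T ind
  refine Finset.sum_eq_zero fun n _ => ?_
  rw [Set.indicator_of_mem (hz n)]; simp

def pr (K l τ : ℕ) : ℕ := τ / 2 ^ (K - l) * 2 ^ (K - l)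

lemma pr_zero (K τ : ℕ) (h : τ < 2 ^ K) : pr K 0 τ = 0 := by
  simp [pr, Nat.div_eq_of_lt h]

lemma pr_top (K τ : ℕ) : pr K K τ = τ := by simp [pr]

lemma pr_le (K l τ : ℕ) : pr K l τ ≤ τ := Nat.div_mul_le_self _ _

lemma pr_step (K l τ : ℕ) (hl : l < K) (h : τ < 2 ^ K) : pr K (l + 1) τ = pr K l τ ∨
    ∃ i < 2 ^ l, pr K l τ = 2 * i * 2 ^ (K - l - 1) ∧ pr K (l + 1) τ = (2 * i + 1) * 2 ^ (K - l - 1) := by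
  have e1 : K - (l + 1) = K - l - 1 := by omega
  have e2 : 2 ^ (K - l) = 2 ^ (K - l - 1) * 2 := by rw [← pow_succ]; congr 1; omega
  unfold pr
  rw [e1, e2]
  set w := 2 ^ (K - l - 1) with hw
  rw [← Nat.div_div_eq_div_mul]
  set v := τ / w
  rcases Nat.even_or_odd' v with ⟨i, hi | hi⟩
  · left; rw [hi]; simp; ring
  · right
    refine ⟨i, ?_, ?_, ?_⟩
    · have h3 : 2 ^ K = 2 ^ l * (w * 2) := by rw [← e2, ← pow_add]; congr 1; omega
      have h4 : τ / (w * 2) < 2 ^ l := Nat.div_lt_of_lt_mul (by rw [h3] at h; linarith)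
      rw [← Nat.div_div_eq_div_mul] at h4
      omega
    · rw [hi, show (2 * i + 1) / 2 = i by omega]; ring
    · rw [hi]

noncomputable def H (z : ℕ → ℝ) (J τ q : ℕ) : ℝ :=
  T z (Finset.Ioc (2 ^ J) (τ * 2 ^ J)) 0 ((q : ℝ) / 2 ^ (J + 2))

lemma H_zero_left (z : ℕ → ℝ) (J q : ℕ) : H z J 0 q = 0 := by simp [H, T]
lemma H_zero_right (z : ℕ → ℝ) (J τ : ℕ) : H z J τ 0 = 0 := by simp [H, T_zero]

lemma H_mixed (z : ℕ → ℝ) (J τ τ' q q' : ℕ) (h1 : τ' ≤ τ) (h2 : q' ≤ q) :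
    H z J τ q - H z J τ' q - H z J τ q' + H z J τ' q' =
      T z (Finset.Ioc (max (2 ^ J) (τ' * 2 ^ J)) (τ * 2 ^ J)) ((q' : ℝ) / 2 ^ (J + 2))
        ((q : ℝ) / 2 ^ (J + 2)) := by
  rw [T_split _ _ _ _ (by positivity) (by gcongr)]
  rcases Nat.eq_zero_or_pos τ' with rfl | hp
  · rw [H_zero_left, H_zero_left]
    simp [H]
  · have h3 : 2 ^ J ≤ τ' * 2 ^ J := Nat.le_mul_of_pos_left _ hp
    have h4 : τ' * 2 ^ J ≤ τ * 2 ^ J := by gcongr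
    rw [max_eq_right h3]
    unfold H
    rw [T_cons z (2 ^ J) (τ' * 2 ^ J) (τ * 2 ^ J) h3 h4, T_cons z (2 ^ J) (τ' * 2 ^ J) (τ * 2 ^ J) h3 h4]
    ring

lemma tele2 (f : ℕ → ℕ → ℝ) (h1 : ∀ m, f 0 m = 0) (h2 : ∀ l, f l 0 = 0) (i j : ℕ) :
    ∑ x ∈ Finset.range i ×ˢ Finset.range j,
      (f (x.1 + 1) (x.2 + 1) - f x.1 (x.2 + 1) - f (x.1 + 1) x.2 + f x.1 x.2) = f i j := by
  rw [Finset.sum_product]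
  have h : ∀ l, ∑ m ∈ Finset.range j, (f (l + 1) (m + 1) - f l (m + 1) - f (l + 1) m + f l m) =
      f (l + 1) j - f l j := by
    intro l
    have := Finset.sum_range_sub (fun m => f (l + 1) m - f l m) j
    rw [h2, h2] at this
    rw [show f (l + 1) j - f l j = f (l + 1) j - f l j - (0 - 0) by ring, ← this]
    exact Finset.sum_congr rfl fun m _ => by ring
  simp only [h]
  rw [Finset.sum_range_sub (fun l => f l j), h1, sub_zero]

lemma sum_geom_le (K : ℕ) : ∑ l ∈ Finset.range K, (9 / 10 : ℝ) ^ l ≤ 10 := by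
  rw [geom_sum_eq (by norm_num)]
  have : (0:ℝ) ≤ (9 / 10) ^ K := by positivity
  rw [div_le_iff_of_neg (by norm_num)]
  linarith

/-- fine boxes are controlled -/
def Fine (z : ℕ → ℝ) (J g : ℕ) : Prop :=
  ∀ l < J + 2, ∀ m < J + 2, (g ≤ l ∨ g ≤ m) → ∀ i < 2 ^ l, ∀ j < 2 ^ m,
    |T z (Finset.Ioc (max (2 ^ J) (2 * i * 2 ^ (J + 2 - l - 1) * 2 ^ J)) ((2 * i + 1) * 2 ^ (J + 2 - l - 1) * 2 ^ J))
      (((2 * j * 2 ^ (J + 2 - m - 1) : ℕ) : ℝ) / 2 ^ (J + 2))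
      ((((2 * j + 1) * 2 ^ (J + 2 - m - 1) : ℕ) : ℝ) / 2 ^ (J + 2))| ≤ 2 ^ (J + 2) * (9 / 10) ^ (l + m)

lemma chain (z : ℕ → ℝ) (J g τ q : ℕ) (hg : g ≤ J + 2) (hF : Fine z J g) (hτ : τ < 2 ^ (J + 2))
    (hq : q < 2 ^ (J + 2)) :
    |H z J τ q - H z J (pr (J + 2) g τ) (pr (J + 2) g q)| ≤ 100 * 2 ^ (J + 2) := by
  classical
  set K := J + 2 with hK
  set f : ℕ → ℕ → ℝ := fun l m => H z J (pr K l τ) (pr K m q) with hf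
  have f1 : ∀ m, f 0 m = 0 := fun m => by simp only [hf]; rw [pr_zero K τ hτ, H_zero_left]
  have f2 : ∀ l, f l 0 = 0 := fun l => by simp only [hf]; rw [pr_zero K q hq, H_zero_right]
  have t1 := tele2 f f1 f2 K K
  have t2 := tele2 f f1 f2 g g
  have hsub : Finset.range g ×ˢ Finset.range g ⊆ Finset.range K ×ˢ Finset.range K :=
    Finset.product_subset_product (Finset.range_mono hg) (Finset.range_mono hg)
  have t3 := Finset.sum_sdiff (f := fun x : ℕ × ℕ =>
    (f (x.1 + 1) (x.2 + 1) - f x.1 (x.2 + 1) - f (x.1 + 1) x.2 + f x.1 x.2)) hsub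
  rw [t1, t2] at t3
  have e1 : f K K = H z J τ q := by simp only [hf]; rw [pr_top, pr_top]
  rw [show H z J (pr K g τ) (pr K g q) = f g g from rfl, ← e1, ← t3, add_sub_cancel_right]
  refine (Finset.abs_sum_le_sum_abs _ _).trans ?_
  calc _ ≤ ∑ x ∈ (Finset.range K ×ˢ Finset.range K) \ (Finset.range g ×ˢ Finset.range g),
        ((2:ℝ) ^ K * (9 / 10) ^ (x.1 + x.2)) := by
        refine Finset.sum_le_sum fun x hx => ?_
        obtain ⟨l, m⟩ := x
        simp only [Finset.mem_sdiff, Finset.mem_product, Finset.mem_range] at hx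
        obtain ⟨⟨hl, hm⟩, hx⟩ := hx
        have hlm : g ≤ l ∨ g ≤ m := by
          by_contra hcon; push Not at hcon; exact hx hcon
        simp only [hf]
        rcases pr_step K l τ hl hτ with h | ⟨i, hi, hi1, hi2⟩
        · rw [h]; ring_nf; rw [abs_zero]; positivity
        rcases pr_step K m q hm hq with h | ⟨j, hj, hj1, hj2⟩
        · rw [h]; ring_nf; rw [abs_zero]; positivity
        rw [H_mixed z J _ _ _ _ (by rw [hi1, hi2]; gcongr; omega) (by rw [hj1, hj2]; gcongr; omega)]
        rw [hi1, hi2, hj1, hj2]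
        exact hF l hl m hm hlm i hi j hj
    _ ≤ ∑ x ∈ Finset.range K ×ˢ Finset.range K, ((2:ℝ) ^ K * (9 / 10) ^ (x.1 + x.2)) :=
        Finset.sum_le_sum_of_subset_of_nonneg Finset.sdiff_subset fun _ _ _ => by positivity
    _ = 2 ^ K * ((∑ l ∈ Finset.range K, (9 / 10 : ℝ) ^ l) * (∑ l ∈ Finset.range K, (9 / 10 : ℝ) ^ l)) := by
        rw [Finset.sum_mul_sum, ← Finset.sum_product', Finset.mul_sum]
        exact Finset.sum_congr rfl fun x _ => by rw [pow_add (9 / 10 : ℝ)]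
    _ ≤ 2 ^ K * (10 * 10) := by
        have := sum_geom_le K
        have h0 : 0 ≤ ∑ l ∈ Finset.range K, (9 / 10 : ℝ) ^ l := Finset.sum_nonneg fun _ _ => by positivity
        gcongr
    _ = _ := by ring

/-- coarse boxes are controlled -/
def Coarse (z : ℕ → ℝ) (J g : ℕ) (U : ℝ) : Prop :=
  ∀ i ≤ 2 ^ g, 1 ≤ i → ∀ k ≤ 2 ^ g, ∀ j < k,
    |T z (Finset.Ioc (2 ^ J) (i * 2 ^ (J + 2 - g) * 2 ^ J)) (((j * 2 ^ (J + 2 - g) : ℕ) : ℝ) / 2 ^ (J + 2))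
      (((k * 2 ^ (J + 2 - g) : ℕ) : ℝ) / 2 ^ (J + 2))| ≤ U * √((i * 2 ^ (J + 2 - g) * 2 ^ J : ℕ) : ℝ)

lemma det (z : ℕ → ℝ) (hz : ∀ n, z n ∈ Set.Ico (0:ℝ) 1) (J g : ℕ) (U : ℝ) (hU : 0 ≤ U) (hg : g ≤ J + 2)
    (hF : Fine z J g) (hC : Coarse z J g U) (N : ℕ) (hN1 : 4 ^ J ≤ N) (hN2 : N < 4 ^ (J + 1)) (a b : ℝ)
    (ha : 0 ≤ a) (hab : a < b) (hb : b ≤ 1) :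
    |T z (Finset.Icc 1 N) a b| ≤ U * √N + 1000 * 2 ^ J := by
  set τ := N / 2 ^ J with hτdef
  have h2J : 0 < 2 ^ J := by positivity
  have h4 : 4 ^ J = 2 ^ J * 2 ^ J := by rw [← mul_pow]; norm_num
  have h4' : 4 ^ (J + 1) = 2 ^ (J + 2) * 2 ^ J := by rw [pow_succ, h4]; ring
  have hτ : τ < 2 ^ (J + 2) := Nat.div_lt_of_lt_mul (by rw [h4'] at hN2; linarith)
  have hτN : τ * 2 ^ J ≤ N := Nat.div_mul_le_self _ _
  have hτN2 : N < τ * 2 ^ J + 2 ^ J := Nat.lt_div_mul_add h2J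
  have hτ1 : 1 ≤ τ := by
    rw [hτdef, Nat.one_le_div_iff h2J]
    calc 2 ^ J ≤ 4 ^ J := Nat.pow_le_pow_left (by norm_num) J
      _ ≤ N := hN1
  -- comparison of H on the time tau
  have hH : ∀ q ≤ 2 ^ (J + 2), |H z J τ q - H z J (pr (J + 2) g τ) (pr (J + 2) g q)| ≤ 100 * 2 ^ (J + 2) := by
    intro q hq
    rcases hq.lt_or_eq with hq | rfl
    · exact chain z J g τ q hg hF hτ hq
    · have e : pr (J + 2) g (2 ^ (J + 2)) = 2 ^ (J + 2) := by
        unfold pr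
        exact Nat.div_mul_cancel (pow_dvd_pow 2 (Nat.sub_le _ _))
      rw [e]
      have e2 : ∀ τ, H z J τ (2 ^ (J + 2)) = 0 := by
        intro τ; unfold H
        have : ((2 ^ (J + 2) : ℕ) : ℝ) / 2 ^ (J + 2) = 1 := by push_cast; field_simp
        rw [this, T_one z hz]
      rw [e2, e2]; simp
  have hHc : ∀ q q', q ≤ 2 ^ (J + 2) → q' ≤ q →
      |H z J (pr (J + 2) g τ) (pr (J + 2) g q) - H z J (pr (J + 2) g τ) (pr (J + 2) g q')| ≤ U * √N := by
    intro q q' hq hqq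
    rcases Nat.eq_zero_or_pos (τ / 2 ^ (J + 2 - g)) with h0 | h0
    · have : pr (J + 2) g τ = 0 := by simp [pr, h0]
      rw [this, H_zero_left, H_zero_left]; simp; positivity
    have hle : q' / 2 ^ (J + 2 - g) ≤ q / 2 ^ (J + 2 - g) := Nat.div_le_div_right hqq
    rcases hle.eq_or_lt with he | hlt
    · unfold pr; rw [he]; simp; positivity
    have h2g : 2 ^ (J + 2) = 2 ^ (J + 2 - g) * 2 ^ g := by rw [← pow_add]; congr 1; omega
    have hc := hC (τ / 2 ^ (J + 2 - g)) (by
      refine Nat.div_le_of_le_mul ?_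
      rw [← h2g]; exact hτ.le) h0 (q / 2 ^ (J + 2 - g)) (by
      refine Nat.div_le_of_le_mul ?_
      rw [← h2g]; exact hq) _ hlt
    rw [T_split _ _ _ _ (by positivity) (by gcongr)] at hc
    refine hc.trans ?_
    have : τ / 2 ^ (J + 2 - g) * 2 ^ (J + 2 - g) * 2 ^ J ≤ N :=
      le_trans (Nat.mul_le_mul_right _ (Nat.div_mul_le_self _ _)) hτN
    gcongr
  have hHH : ∀ q q', q ≤ 2 ^ (J + 2) → q' ≤ 2 ^ (J + 2) →
      H z J τ q - H z J τ q' ≤ U * √N + 200 * 2 ^ (J + 2) := by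
    intro q q' hq hq'
    have a1 := abs_le.1 (hH q hq)
    have a2 := abs_le.1 (hH q' hq')
    rcases le_total q q' with h | h
    · have a3 := abs_le.1 (hHc q' q hq' h)
      linarith [a1.2, a2.1, a3.1]
    · have a3 := abs_le.1 (hHc q q' hq h)
      linarith [a1.2, a2.1, a3.2]
  -- decomposition
  set M := Finset.Ioc (2 ^ J) (τ * 2 ^ J) with hM
  have d1 : T z (Finset.Icc 1 N) a b = T z (Finset.Ioc 0 (2 ^ J)) a b + T z M a b +
      T z (Finset.Ioc (τ * 2 ^ J) N) a b := by
    have : Finset.Icc 1 N = Finset.Ioc 0 N := by ext n; simp; omega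
    rw [this, T_cons z 0 (τ * 2 ^ J) N (Nat.zero_le _) hτN,
      T_cons z 0 (2 ^ J) (τ * 2 ^ J) (Nat.zero_le _) (Nat.le_mul_of_pos_left _ hτ1)]
  have d2 : |T z (Finset.Ioc 0 (2 ^ J)) a b| ≤ 2 ^ J := by
    refine (abs_T_le z _ a b ha hab hb).trans ?_
    simp
  have d3 : |T z (Finset.Ioc (τ * 2 ^ J) N) a b| ≤ 2 ^ J := by
    refine (abs_T_le z _ a b ha hab hb).trans ?_
    rw [Nat.card_Ioc]
    have : N - τ * 2 ^ J ≤ 2 ^ J := by omega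
    exact_mod_cast this
  have hcard : (M.card : ℝ) ≤ 2 ^ (J + 2) * 2 ^ J := by
    rw [hM, Nat.card_Ioc]
    have : τ * 2 ^ J - 2 ^ J ≤ 2 ^ (J + 2) * 2 ^ J := by
      rw [← h4']; omega
    exact_mod_cast this
  have hround : ∀ x : ℝ, 0 ≤ x → x ≤ 1 → ∃ q ≤ 2 ^ (J + 2), ∃ q' ≤ 2 ^ (J + 2),
      T z M 0 x ≤ H z J τ q + 2 ^ J ∧ H z J τ q' - 2 ^ J ≤ T z M 0 x := by
    intro x hx0 hx1
    have hp : (0:ℝ) < 2 ^ (J + 2) := by positivity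
    refine ⟨⌈x * 2 ^ (J + 2)⌉₊, ?_, ⌊x * 2 ^ (J + 2)⌋₊, ?_, ?_, ?_⟩
    · rw [Nat.ceil_le]; push_cast; nlinarith
    · refine Nat.floor_le_of_le ?_; push_cast; nlinarith
    · have h1 := Nat.le_ceil (x * 2 ^ (J + 2))
      have h2 := (Nat.ceil_lt_add_one (a := x * 2 ^ (J + 2)) (by positivity)).le
      have := T_mono z M x ((⌈x * 2 ^ (J + 2)⌉₊ : ℝ) / 2 ^ (J + 2)) (by rw [le_div_iff₀ hp]; exact h1)
      refine this.trans ?_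
      unfold H
      gcongr
      have h3 : (⌈x * 2 ^ (J + 2)⌉₊ : ℝ) / 2 ^ (J + 2) - x ≤ 1 / 2 ^ (J + 2) := by
        rw [sub_le_iff_le_add, div_le_iff₀ hp, add_mul, one_div, inv_mul_cancel₀ hp.ne']; linarith
      calc (M.card : ℝ) * ((⌈x * 2 ^ (J + 2)⌉₊ : ℝ) / 2 ^ (J + 2) - x) ≤ (M.card : ℝ) * (1 / 2 ^ (J + 2)) := by gcongr
        _ ≤ (2 ^ (J + 2) * 2 ^ J) * (1 / 2 ^ (J + 2)) := by gcongr
        _ = _ := by field_simp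
    · have h1 := Nat.floor_le (a := x * 2 ^ (J + 2)) (by positivity)
      have h2 := (Nat.lt_floor_add_one (x * 2 ^ (J + 2))).le
      have := T_mono z M ((⌊x * 2 ^ (J + 2)⌋₊ : ℝ) / 2 ^ (J + 2)) x (by rw [div_le_iff₀ hp]; exact h1)
      rw [sub_le_iff_le_add]
      refine this.trans ?_
      gcongr
      have h3 : x - (⌊x * 2 ^ (J + 2)⌋₊ : ℝ) / 2 ^ (J + 2) ≤ 1 / 2 ^ (J + 2) := by
        rw [sub_le_iff_le_add, ← add_div, le_div_iff₀ hp]; linarith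
      calc (M.card : ℝ) * (x - (⌊x * 2 ^ (J + 2)⌋₊ : ℝ) / 2 ^ (J + 2)) ≤ (M.card : ℝ) * (1 / 2 ^ (J + 2)) := by gcongr
        _ ≤ (2 ^ (J + 2) * 2 ^ J) * (1 / 2 ^ (J + 2)) := by gcongr
        _ = _ := by field_simp
  have hT : |T z M a b| ≤ U * √N + 200 * 2 ^ (J + 2) + 2 * 2 ^ J := by
    rw [T_split z M a b ha hab.le]
    obtain ⟨q1, hq1, q2, hq2, r1, r2⟩ := hround a ha (by linarith)
    obtain ⟨q3, hq3, q4, hq4, r3, r4⟩ := hround b (by linarith) hb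
    have := hHH q3 q2 hq3 hq2
    have := hHH q1 q4 hq1 hq4
    rw [abs_le]; constructor <;> linarith
  rw [d1]
  refine (abs_add_three _ _ _).trans ?_
  have : (2:ℝ) ^ (J + 2) = 4 * 2 ^ J := by ring
  have : (0:ℝ) < 2 ^ J := by positivity
  linarith

end LIL

namespace LIL
open ProbabilityTheory

section
variable {Ω : Type*} [MeasurableSpace Ω] {P : Measure Ω} [IsProbabilityMeasure P]
  {X : ℕ → Ω → ℝ}

lemma union_le {ι : Type*} (S : Finset ι) (E : ι → Set Ω) (B : Set Ω) (hB : ∀ ω ∈ B, ∃ x ∈ S, ω ∈ E x)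
    (c : ι → ℝ) (h : ∀ x ∈ S, P.real (E x) ≤ c x) : P.real B ≤ ∑ x ∈ S, c x := by
  have h1 : B ⊆ ⋃ x ∈ S, E x := by
    intro ω hω
    obtain ⟨x, hx, hx2⟩ := hB ω hω
    exact Set.mem_biUnion (show x ∈ (S : Set ι) from hx) hx2
  calc P.real B ≤ P.real (⋃ x ∈ S, E x) := measureReal_mono h1 (measure_ne_top _ _)
    _ ≤ ∑ x ∈ S, P.real (E x) := measureReal_biUnion_finset_le _ _
    _ ≤ _ := Finset.sum_le_sum h

lemma borel_cantelli (B : ℕ → Set Ω) (f : ℕ → ℝ) (hf : Summable f) (h : ∀ᶠ J in atTop, P.real (B J) ≤ f J) :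
    ∀ᵐ ω ∂P, ∀ᶠ J in atTop, ω ∉ B J := by
  obtain ⟨J0, hJ0⟩ := eventually_atTop.1 h
  have hs : Summable (fun J => P.real (B (J + J0))) :=
    Summable.of_nonneg_of_le (fun _ => measureReal_nonneg) (fun J => hJ0 _ (by omega))
      ((summable_nat_add_iff J0).2 hf)
  have h1 : ∑' J, P (B (J + J0)) ≠ ⊤ := by
    have : ∀ J, P (B (J + J0)) = ENNReal.ofReal (P.real (B (J + J0))) := fun J => by
      rw [ofReal_measureReal]
    simp only [this]
    exact hs.tsum_ofReal_ne_top
  have h2 := ae_eventually_notMem h1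
  filter_upwards [h2] with ω hω
  obtain ⟨k, hk⟩ := eventually_atTop.1 hω
  refine eventually_atTop.2 ⟨k + J0, fun J hJ => ?_⟩
  have := hk (J - J0) (by omega)
  rwa [Nat.sub_add_cancel (by omega)] at this

lemma coarse_tail (hX : ∀ n, Measurable (X n)) {n0 : ℕ} (hG : GoodAt P X n0) (F : Finset ℕ)
    (hF : ∀ n ∈ F, n0 ≤ n) (a b : ℝ) (ha : 0 ≤ a) (hab : a < b) (hb : b ≤ 1) (q N' : ℝ) (hq : 1 ≤ q)
    (hp : ((2 * ⌈q⌉₊ : ℕ) : ℝ) ≤ Real.log n0) (hN : 2 ≤ N') (hcard : (F.card : ℝ) ≤ N') :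
    P.real {ω | √(q * N' / 2) ≤ |T (fun n => X n ω) F a b|} ≤
      2 * Real.exp 3 * (q + 1) * Real.exp (-q) + N' ^ (2 * ⌈q⌉₊) * Real.exp (-√(n0 : ℝ)) := by
  set p := ⌈q⌉₊ with hpdef
  set u := √(q * N' / 2) with hu
  have hqp : q ≤ p := Nat.le_ceil q
  have hpq : (p : ℝ) ≤ q + 1 := (Nat.ceil_lt_add_one (by linarith)).le
  have hu2 : u ^ 2 = q * N' / 2 := Real.sq_sqrt (by positivity)
  have hu1 : 1 ≤ u := by rw [hu]; exact Real.one_le_sqrt.2 (by nlinarith)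
  have hp0 : (0:ℝ) < p := by linarith
  have hp1 : 1 ≤ p := by exact_mod_cast hp0
  have ht := tail hX hG F hF a b ha hab hb (fun _ => 1) p hp (2 * p / u) (Real.exp (p + 2)) u
    (by positivity) (by linarith) (by
      refine (cosh_hoeff F _ a b _ ha hab hb).trans (Real.exp_le_exp.2 ?_)
      simp only [one_pow, Finset.sum_const, nsmul_eq_mul, mul_one]
      calc (2 * p / u) ^ 2 * (F.card : ℝ) / 8 ≤ (2 * p / u) ^ 2 * N' / 8 := by gcongr
        _ = p ^ 2 / q := by
          rw [div_pow, hu2]; field_simp; ring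
        _ ≤ p + 2 := by
          rw [div_le_iff₀ (by linarith)]
          nlinarith)
  simp only [Sm_one] at ht
  refine ht.trans ?_
  rw [add_div]
  refine add_le_add ?_ ?_
  · have hf := factorial_le (2 * p) (by omega)
    rw [div_pow, div_div, div_mul_cancel₀ _ (by positivity), div_le_iff₀ (by positivity)]
    push_cast at hf
    calc ((2 * p).factorial : ℝ) * Real.exp (p + 2) ≤
          (Real.exp 1 * (2 * p) * (2 * p / Real.exp 1) ^ (2 * p)) * Real.exp (p + 2) := by gcongr
      _ = 2 * p * (Real.exp 1 * Real.exp (p + 2) / Real.exp 1 ^ (2 * p)) * (2 * p) ^ (2 * p) := by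
          rw [div_pow]; ring
      _ = 2 * p * (Real.exp 3 * Real.exp (-p)) * (2 * p) ^ (2 * p) := by
          congr 2
          rw [← Real.exp_add, ← Real.exp_nat_mul, ← Real.exp_sub, ← Real.exp_add]
          congr 1; push_cast; ring
      _ ≤ 2 * (q + 1) * (Real.exp 3 * Real.exp (-q)) * (2 * p) ^ (2 * p) := by gcongr
      _ = _ := by ring
  · refine div_le_of_le_mul₀ (by positivity) (by positivity) ?_
    simp only [abs_one, Finset.sum_const, nsmul_eq_mul, mul_one]
    calc (F.card : ℝ) ^ (2 * p) * Real.exp (-√(n0:ℝ)) ≤ N' ^ (2 * p) * Real.exp (-√(n0:ℝ)) := by gcongr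
      _ ≤ _ := le_mul_of_one_le_right (by positivity) (one_le_pow₀ hu1)

lemma fine_tail (hX : ∀ n, Measurable (X n)) {n0 : ℕ} (hG : GoodAt P X n0) (F : Finset ℕ)
    (hF : ∀ n ∈ F, n0 ≤ n) (a b : ℝ) (ha : 0 ≤ a) (hab : a < b) (hb : b ≤ 1) (p : ℕ) (t x N' : ℝ)
    (hp : ((2 * p : ℕ) : ℝ) ≤ Real.log n0) (ht : 0 < t) (ht1 : t ≤ 1) (hx : 1 ≤ x)
    (htv : t ^ 2 * (b - a) * F.card ≤ 1) (hcard : (F.card : ℝ) ≤ N') :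
    P.real {ω | x ≤ |T (fun n => X n ω) F a b|} ≤
      3 * (2 * p).factorial / (t * x) ^ (2 * p) + N' ^ (2 * p) * Real.exp (-√(n0 : ℝ)) := by
  have h := tail hX hG F hF a b ha hab hb (fun _ => 1) p hp t 3 x ht (by linarith) (by
    refine (cosh_small F a b t ha hab hb (by rw [abs_of_pos ht]; exact ht1)).trans ?_
    refine (Real.exp_le_exp.2 htv).trans ?_
    linarith [Real.exp_one_lt_d9])
  simp only [Sm_one] at h
  refine h.trans ?_
  rw [add_div]
  refine add_le_add (le_of_eq ?_) ?_
  · rw [mul_pow, div_div, mul_comm (3:ℝ)]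
  · have : 0 ≤ N' := (Nat.cast_nonneg _).trans hcard
    refine div_le_of_le_mul₀ (by positivity) (by positivity) ?_
    simp only [abs_one, Finset.sum_const, nsmul_eq_mul, mul_one]
    calc (F.card : ℝ) ^ (2 * p) * Real.exp (-√(n0:ℝ)) ≤ N' ^ (2 * p) * Real.exp (-√(n0:ℝ)) := by gcongr
      _ ≤ _ := le_mul_of_one_le_right (by positivity) (one_le_pow₀ hx)

lemma tendsto_two_pow : Tendsto (fun J : ℕ => ((2 ^ J : ℕ) : ℝ)) atTop atTop := by
  have : Tendsto (fun J : ℕ => (2:ℝ) ^ J) atTop atTop := tendsto_pow_atTop_atTop_of_one_lt (by norm_num)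
  simpa using this

lemma err_small : ∀ᶠ J : ℕ in atTop, ∀ p ≤ J, ∀ x : ℝ, 0 ≤ x → x ≤ 4 ^ (J + 1) →
    x ^ (2 * p) * Real.exp (-√((2 ^ J : ℕ) : ℝ)) ≤ (1 / 64 : ℝ) ^ J := by
  filter_upwards [tendsto_two_pow.eventually (ev_log' 10 (1 / 4) (by norm_num) (by norm_num)),
    eventually_ge_atTop 1] with J h1 hJ p hp x hx0 hx
  set n := ((2 ^ J : ℕ) : ℝ) with hn
  have hn0 : 0 < n := by rw [hn]; positivity
  have hJ' : (1:ℝ) ≤ J := by exact_mod_cast hJ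
  have hlog : Real.log n = J * Real.log 2 := by rw [hn]; push_cast; rw [Real.log_pow]
  have hsq : (n ^ (1 / 4 : ℝ)) ^ 2 = √n := by
    rw [← Real.rpow_natCast, ← Real.rpow_mul hn0.le, Real.sqrt_eq_rpow]; norm_num
  have l2 := Real.log_two_gt_d9
  have l2' := Real.log_two_lt_d9
  have hb : (5 * (J:ℝ)) ^ 2 ≤ √n := by
    rw [← hsq]
    have : 5 * (J:ℝ) ≤ n ^ (1 / 4 : ℝ) := by
      refine le_trans ?_ h1; rw [hlog]; nlinarith
    gcongr
  have l4 : Real.log 4 = 2 * Real.log 2 := by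
    rw [show (4:ℝ) = 2 ^ 2 by norm_num, Real.log_pow]; norm_num
  have l64 : Real.log 64 = 6 * Real.log 2 := by
    rw [show (64:ℝ) = 2 ^ 6 by norm_num, Real.log_pow]; norm_num
  calc x ^ (2 * p) * Real.exp (-√n) ≤ (4 ^ (J + 1)) ^ (2 * p) * Real.exp (-√n) := by gcongr
    _ ≤ (4 ^ (J + 1)) ^ (2 * J) * Real.exp (-√n) := by
        gcongr
        exact one_le_pow₀ (by norm_num)
    _ = Real.exp ((J + 1) * (2 * J) * Real.log 4 - √n) := by
        rw [sub_eq_add_neg, Real.exp_add, ← pow_mul]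
        congr 1
        rw [← Real.rpow_natCast, Real.rpow_def_of_pos (by norm_num)]
        push_cast; ring_nf
    _ ≤ Real.exp (-(J * Real.log 64)) := by
        apply Real.exp_le_exp.2
        rw [l4, l64]
        nlinarith [mul_nonneg (by linarith : (0:ℝ) ≤ J) (by linarith : (0:ℝ) ≤ 1 - Real.log 2)]
    _ = _ := by
        rw [one_div, inv_pow, Real.exp_neg, Real.exp_nat_mul, Real.exp_log (by norm_num)]

lemma fine_prob (hX : ∀ n, Measurable (X n)) (J g p : ℕ) (hG : GoodAt P X (2 ^ J))
    (hp : ((2 * p : ℕ) : ℝ) ≤ Real.log (2 ^ J : ℕ))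
    (herr : ∀ x : ℝ, 0 ≤ x → x ≤ 4 ^ (J + 1) →
      x ^ (2 * p) * Real.exp (-√((2 ^ J : ℕ) : ℝ)) ≤ (1 / 64 : ℝ) ^ J)
    (hρ : 2 / (162 / 100 : ℝ) ^ p ≤ 1) :
    P.real {ω | ¬ Fine (fun n => X n ω) J g} ≤
      ((J:ℝ) + 2) ^ 2 * (3 * (2 * p).factorial * (2 / (162 / 100 : ℝ) ^ p) ^ g + 16 * (1 / 16) ^ J) := by
  classical
  set K := J + 2 with hK
  set ρ := 2 / (162 / 100 : ℝ) ^ p with hρd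
  set Ev : ℕ × ℕ → ℕ × ℕ → Set Ω := fun x y => {ω | (2:ℝ) ^ (J + 2) * (9 / 10) ^ (x.1 + x.2) ≤
    |T (fun n => X n ω) (Finset.Ioc (max (2 ^ J) (2 * y.1 * 2 ^ (J + 2 - x.1 - 1) * 2 ^ J))
      ((2 * y.1 + 1) * 2 ^ (J + 2 - x.1 - 1) * 2 ^ J))
      (((2 * y.2 * 2 ^ (J + 2 - x.2 - 1) : ℕ) : ℝ) / 2 ^ (J + 2))
      ((((2 * y.2 + 1) * 2 ^ (J + 2 - x.2 - 1) : ℕ) : ℝ) / 2 ^ (J + 2))|} with hEv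
  have main := union_le (P := P) ((Finset.range K ×ˢ Finset.range K).filter (fun x => g ≤ x.1 ∨ g ≤ x.2))
    (fun x => {ω | ∃ y ∈ Finset.range (2 ^ x.1) ×ˢ Finset.range (2 ^ x.2), ω ∈ Ev x y})
    {ω | ¬ Fine (fun n => X n ω) J g} ?_
    (fun _ => 3 * (2 * p).factorial * ρ ^ g + 16 * (1 / 16) ^ J) ?_
  · refine main.trans ?_
    rw [Finset.sum_const, nsmul_eq_mul]
    have hc : (((Finset.range K ×ˢ Finset.range K).filter (fun x => g ≤ x.1 ∨ g ≤ x.2)).card : ℝ) ≤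
        ((J:ℝ) + 2) ^ 2 := by
      have := Finset.card_filter_le (Finset.range K ×ˢ Finset.range K) (fun x => g ≤ x.1 ∨ g ≤ x.2)
      rw [Finset.card_product, Finset.card_range] at this
      have h2 : ((K * K : ℕ) : ℝ) = ((J:ℝ) + 2) ^ 2 := by rw [hK]; push_cast; ring
      rw [← h2]; exact_mod_cast this
    gcongr
  · intro ω hω
    have hω : ¬ Fine (fun n => X n ω) J g := hω
    unfold Fine at hω
    push Not at hω
    obtain ⟨l, hl, m, hm, hlm, i, hi, j, hj, h⟩ := hω
    refine ⟨(l, m), ?_, (i, j), ?_, h.le⟩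
    · simp [hK, hl, hm, hlm]
    · simp [hi, hj]
  · rintro ⟨l, m⟩ hlm
    simp only [Finset.mem_filter, Finset.mem_product, Finset.mem_range] at hlm
    obtain ⟨⟨hl, hm⟩, hlm⟩ := hlm
    refine (union_le (P := P) (Finset.range (2 ^ l) ×ˢ Finset.range (2 ^ m)) (Ev (l, m)) _
      (fun ω hω => hω) (fun _ => 3 * (2 * p).factorial / ((162 / 100 : ℝ) ^ (l + m)) ^ p + (1 / 64) ^ J) ?_).trans ?_
    · rintro ⟨i, j⟩ hij
      simp only [Finset.mem_product, Finset.mem_range] at hij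
      obtain ⟨hi, hj⟩ := hij
      simp only [hEv]
      set w := 2 ^ (J + 2 - l - 1) with hw
      set w' := 2 ^ (J + 2 - m - 1) with hw'
      have ew : w * 2 ^ l * 2 = 2 ^ K := by
        rw [hw, ← pow_add, ← pow_succ]; congr 1; omega
      have ew' : w' * 2 ^ m * 2 = 2 ^ K := by
        rw [hw', ← pow_add, ← pow_succ]; congr 1; omega
      have eJ : 2 ^ J * 4 = 2 ^ K := by rw [hK, pow_add]; norm_num
      have ewR : (w:ℝ) * 2 ^ l * 2 = 2 ^ K := by exact_mod_cast ew
      have ewR' : (w':ℝ) * 2 ^ m * 2 = 2 ^ K := by exact_mod_cast ew'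
      have eJR : (2:ℝ) ^ J * 4 = 2 ^ K := by exact_mod_cast eJ
      have hwp : 0 < w := by positivity
      have hwp' : 0 < w' := by positivity
      have hcard : (Finset.Ioc (max (2 ^ J) (2 * i * w * 2 ^ J)) ((2 * i + 1) * w * 2 ^ J)).card ≤ w * 2 ^ J := by
        rw [Nat.card_Ioc]
        have h1 : 2 * i * w * 2 ^ J ≤ max (2 ^ J) (2 * i * w * 2 ^ J) := le_max_right _ _
        have h2 : (2 * i + 1) * w * 2 ^ J = 2 * i * w * 2 ^ J + w * 2 ^ J := by ring
        omega
      have hcardR : ((Finset.Ioc (max (2 ^ J) (2 * i * w * 2 ^ J)) ((2 * i + 1) * w * 2 ^ J)).card : ℝ) ≤ w * 2 ^ J := by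
        exact_mod_cast hcard
      have hKp : (0:ℝ) < 2 ^ K := by positivity
      have e4 : ((4:ℝ)) ^ (J + 1) = 2 ^ K * 2 ^ J := by
        rw [show (4:ℝ) = 2 * 2 by norm_num, mul_pow, hK]; ring
      have e4K : (2:ℝ) ^ K * 2 ^ K = 4 ^ K := by rw [← mul_pow]; norm_num
      have hdiff : (((2 * j + 1) * w' : ℕ) : ℝ) / 2 ^ K - ((2 * j * w' : ℕ) : ℝ) / 2 ^ K = w' / 2 ^ K := by
        push_cast; ring
      have hl2 : (1:ℝ) ≤ 2 ^ l := one_le_pow₀ (by norm_num)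
      have hm2 : (1:ℝ) ≤ 2 ^ m := one_le_pow₀ (by norm_num)
      have hlm2 : ((2:ℝ) ^ (l + m)) ≤ 4 ^ K := by
        rw [show (4:ℝ) = 2 ^ 2 by norm_num, ← pow_mul]
        exact pow_le_pow_right₀ (by norm_num) (by omega)
      have hwK : (w : ℝ) ≤ 2 ^ K := by rw [← ewR]; nlinarith [(Nat.cast_pos (α := ℝ)).2 hwp]
      have htsq : (√((2:ℝ) ^ (l + m)) / 2 ^ K) ^ 2 = 2 ^ (l + m) / 4 ^ K := by
        rw [div_pow, Real.sq_sqrt (by positivity), ← e4K, sq]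
      have := fine_tail hX hG (Finset.Ioc (max (2 ^ J) (2 * i * w * 2 ^ J)) ((2 * i + 1) * w * 2 ^ J))
        (fun n hn => ((le_max_left _ _).trans_lt (Finset.mem_Ioc.1 hn).1).le)
        (((2 * j * w' : ℕ) : ℝ) / 2 ^ K) ((((2 * j + 1) * w' : ℕ) : ℝ) / 2 ^ K) (by positivity)
        (by gcongr; omega) (by
          rw [div_le_one hKp]
          have : (2 * j + 1) * w' ≤ 2 ^ K := by
            rw [← ew']
            calc (2 * j + 1) * w' ≤ (2 ^ m * 2) * w' := by gcongr; omega
              _ = _ := by ring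
          exact_mod_cast this) p (√(2 ^ (l + m)) / 2 ^ K) (2 ^ K * (9 / 10) ^ (l + m)) (4 ^ (J + 1)) hp
          (by positivity) (by
            rw [div_le_one hKp]
            refine Real.sqrt_le_iff.2 ⟨hKp.le, ?_⟩
            rw [sq, e4K]; exact hlm2) (by
            calc (1:ℝ) ≤ (2 * (81 / 100)) ^ K := one_le_pow₀ (by norm_num)
              _ = 2 ^ K * (9 / 10) ^ (2 * K) := by rw [mul_pow, pow_mul]; norm_num
              _ ≤ _ := by
                refine mul_le_mul_of_nonneg_left ?_ hKp.le
                exact pow_le_pow_of_le_one (a := (9 / 10 : ℝ)) (by norm_num) (by norm_num) (by omega)) (by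
            rw [htsq, hdiff]
            calc (2:ℝ) ^ (l + m) / 4 ^ K * (w' / 2 ^ K) * _ ≤ 2 ^ (l + m) / 4 ^ K * (w' / 2 ^ K) * (w * 2 ^ J) := by
                  gcongr
              _ = (w * 2 ^ l * 2) * (w' * 2 ^ m * 2) * (2 ^ J * 4) / (16 * (2 ^ K * 2 ^ K * 2 ^ K)) := by
                  rw [← e4K, pow_add]; field_simp; norm_num
              _ ≤ 1 := by
                  rw [ewR, ewR', eJR, div_le_one (by positivity)]
                  have : (0:ℝ) < 2 ^ K * 2 ^ K * 2 ^ K := by positivity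
                  linarith) (by
            refine hcardR.trans ?_
            rw [e4]; gcongr)
      refine this.trans ?_
      refine add_le_add (le_of_eq ?_) (herr _ (by positivity) le_rfl)
      congr 1
      rw [pow_mul]
      congr 1
      rw [show √((2:ℝ) ^ (l + m)) / 2 ^ K * (2 ^ K * (9 / 10) ^ (l + m)) = √(2 ^ (l + m)) * (9 / 10) ^ (l + m) by
        field_simp, mul_pow, Real.sq_sqrt (by positivity), ← pow_mul, mul_comm (l + m) 2, pow_mul, ← mul_pow]
      norm_num
    · rw [Finset.sum_const, nsmul_eq_mul, Finset.card_product, Finset.card_range, Finset.card_range, ← pow_add,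
        mul_add]
      push_cast
      refine add_le_add ?_ ?_
      · calc (2:ℝ) ^ (l + m) * (3 * (2 * p).factorial / ((162 / 100 : ℝ) ^ (l + m)) ^ p) =
            3 * (2 * p).factorial * ρ ^ (l + m) := by
              rw [hρd, div_pow (2:ℝ), ← pow_mul, ← pow_mul, mul_comm p]; ring
          _ ≤ _ := by
            gcongr 3 * _ * ?_
            exact pow_le_pow_of_le_one (by positivity) hρ (by omega)
      · calc (2:ℝ) ^ (l + m) * (1 / 64) ^ J ≤ 2 ^ (2 * J + 4) * (1 / 64) ^ J := by
              gcongr ?_ * _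
              exact pow_le_pow_right₀ (by norm_num) (by omega)
          _ = 16 * ((4:ℝ) ^ J * (1 / 64) ^ J) := by rw [pow_add, pow_mul]; norm_num; ring
          _ = _ := by rw [← mul_pow]; norm_num

lemma coarse_prob (hX : ∀ n, Measurable (X n)) (J g : ℕ) (q : ℝ) (hq : 1 ≤ q) (hJ : 1 ≤ J) (hg : g ≤ J + 2)
    (hG : GoodAt P X (2 ^ J))
    (hp : ((2 * ⌈q⌉₊ : ℕ) : ℝ) ≤ Real.log (2 ^ J : ℕ))
    (herr : ∀ x : ℝ, 0 ≤ x → x ≤ 4 ^ (J + 1) →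
      x ^ (2 * ⌈q⌉₊) * Real.exp (-√((2 ^ J : ℕ) : ℝ)) ≤ (1 / 64 : ℝ) ^ J) :
    P.real {ω | ¬ Coarse (fun n => X n ω) J g √(q / 2)} ≤
      ((2:ℝ) ^ g + 1) ^ 3 * (2 * Real.exp 3 * (q + 1) * Real.exp (-q) + (1 / 64) ^ J) := by
  classical
  set S := ((Finset.range (2 ^ g + 1)) ×ˢ (Finset.range (2 ^ g + 1)) ×ˢ (Finset.range (2 ^ g + 1))).filter
    (fun x => 1 ≤ x.1 ∧ x.2.2 < x.2.1) with hS
  have main := union_le (P := P) S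
    (fun x => {ω | √(q * ((x.1 * 2 ^ (J + 2 - g) * 2 ^ J : ℕ) : ℝ) / 2) ≤ |T (fun n => X n ω)
      (Finset.Ioc (2 ^ J) (x.1 * 2 ^ (J + 2 - g) * 2 ^ J)) (((x.2.2 * 2 ^ (J + 2 - g) : ℕ) : ℝ) / 2 ^ (J + 2))
      (((x.2.1 * 2 ^ (J + 2 - g) : ℕ) : ℝ) / 2 ^ (J + 2))|})
    {ω | ¬ Coarse (fun n => X n ω) J g √(q / 2)} ?_
    (fun _ => 2 * Real.exp 3 * (q + 1) * Real.exp (-q) + (1 / 64) ^ J) ?_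
  · refine main.trans ?_
    rw [Finset.sum_const, nsmul_eq_mul]
    have hc : (S.card : ℝ) ≤ ((2:ℝ) ^ g + 1) ^ 3 := by
      have := Finset.card_filter_le ((Finset.range (2 ^ g + 1)) ×ˢ (Finset.range (2 ^ g + 1)) ×ˢ
        (Finset.range (2 ^ g + 1))) (fun x => 1 ≤ x.1 ∧ x.2.2 < x.2.1)
      rw [Finset.card_product, Finset.card_product, Finset.card_range] at this
      have h2 : (((2 ^ g + 1) * ((2 ^ g + 1) * (2 ^ g + 1)) : ℕ) : ℝ) = ((2:ℝ) ^ g + 1) ^ 3 := by push_cast; ring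
      rw [← h2]; exact_mod_cast this
    gcongr
  · intro ω hω
    have hω : ¬ Coarse (fun n => X n ω) J g √(q / 2) := hω
    unfold Coarse at hω
    push Not at hω
    obtain ⟨i, hi, hi1, k, hk, j, hj, h⟩ := hω
    refine ⟨(i, k, j), ?_, ?_⟩
    · simp [hS, hi1, hj]; omega
    · refine le_trans (le_of_eq ?_) h.le
      rw [← Real.sqrt_mul (by positivity)]
      congr 1; push_cast; ring
  · rintro ⟨i, k, j⟩ hx
    simp only [hS, Finset.mem_filter, Finset.mem_product, Finset.mem_range] at hx
    obtain ⟨⟨hi, hk, hj⟩, hi1, hjk⟩ := hx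
    have h2g : 2 ^ (J + 2) = 2 ^ g * 2 ^ (J + 2 - g) := by rw [← pow_add]; congr 1; omega
    have hb : k * 2 ^ (J + 2 - g) ≤ 2 ^ (J + 2) := by rw [h2g]; gcongr; omega
    have hb2 : i * 2 ^ (J + 2 - g) ≤ 2 ^ (J + 2) := by rw [h2g]; gcongr; omega
    have hN2 : 2 ≤ i * 2 ^ (J + 2 - g) * 2 ^ J := by
      calc 2 = 1 * 1 * 2 ^ 1 := by norm_num
        _ ≤ _ := by gcongr <;> first | exact Nat.one_le_two_pow | norm_num
    have h4 : i * 2 ^ (J + 2 - g) * 2 ^ J ≤ 4 ^ (J + 1) := by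
      calc _ ≤ 2 ^ (J + 2) * 2 ^ J := by gcongr
        _ = _ := by rw [show 4 = 2 ^ 2 by norm_num, ← pow_mul, ← pow_add]; congr 1; ring
    refine (coarse_tail hX hG _ (fun n hn => (Finset.mem_Ioc.1 hn).1.le) _ _ (by positivity)
      (by gcongr) (by rw [div_le_one (by positivity)]; exact_mod_cast hb) q _ hq hp (by exact_mod_cast hN2)
      (by rw [Nat.card_Ioc]; exact_mod_cast Nat.sub_le _ _)).trans ?_
    gcongr
    exact herr _ (by positivity) (by exact_mod_cast h4)

end

end LIL

namespace LIL
open ProbabilityTheory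

section
variable {Ω : Type*} [MeasurableSpace Ω] {P : Measure Ω} [IsProbabilityMeasure P]
  {X : ℕ → Ω → ℝ}

lemma good_at (hG : Good P X) : ∀ᶠ n0 : ℕ in atTop, GoodAt P X n0 := hG.2

lemma tendsto_two_pow_nat : Tendsto (fun J : ℕ => 2 ^ J) atTop atTop :=
  tendsto_pow_atTop_atTop_of_one_lt (by norm_num)

lemma upper_events (hG : Good P X) (ε : ℝ) (hε : 0 < ε) (hε1 : ε ≤ 1) :
    ∃ h : ℕ, ∀ᵐ ω ∂P, ∀ᶠ J : ℕ in atTop, Fine (fun n => X n ω) J (Nat.log 2 J / h) ∧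
      Coarse (fun n => X n ω) J (Nat.log 2 J / h) √((1 + ε) * Real.log J / 2) := by
  obtain ⟨h, hh⟩ := exists_nat_gt (12 / ε)
  have hh0 : (0:ℝ) < h := lt_trans (by positivity) hh
  have hhpos : 0 < h := by exact_mod_cast hh0
  obtain ⟨p, hp⟩ := pow_unbounded_of_one_lt ((2:ℝ) ^ (5 * h + 1)) (by norm_num : (1:ℝ) < 162 / 100)
  set ρ := 2 / (162 / 100 : ℝ) ^ p with hρd
  have hρ : ρ ≤ ((2:ℝ) ^ (5 * h))⁻¹ := by
    rw [hρd, div_le_iff₀ (by positivity), inv_mul_eq_div, le_div_iff₀ (by positivity)]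
    rw [pow_succ] at hp; linarith
  have hρ0 : 0 ≤ ρ := by positivity
  refine ⟨h, ?_⟩
  set δ := ε / 4 with hδ
  set C1 : ℝ := 27 * (2 * p).factorial * (2 ^ h) ^ 5 with hC1
  set f : ℕ → ℝ := fun J => C1 * (1 / (J:ℝ) ^ 3) + 64 * (1 / 4) ^ J + 1 / (J:ℝ) ^ (1 + 2 * δ) + 8 * (1 / 8) ^ J with hf
  have hfs : Summable f := by
    refine Summable.add (Summable.add (Summable.add ?_ ?_) ?_) ?_
    · exact (Real.summable_one_div_nat_pow.2 (by norm_num)).mul_left _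
    · exact (summable_geometric_of_lt_one (by norm_num) (by norm_num)).mul_left _
    · exact Real.summable_one_div_nat_rpow.2 (by linarith [div_pos hε (by norm_num : (0:ℝ) < 4)])
    · exact (summable_geometric_of_lt_one (by norm_num) (by norm_num)).mul_left _
  have hBC := borel_cantelli (P := P)
    (fun J => {ω | ¬ Fine (fun n => X n ω) J (Nat.log 2 J / h)} ∪
      {ω | ¬ Coarse (fun n => X n ω) J (Nat.log 2 J / h) √((1 + ε) * Real.log J / 2)}) f hfs ?_
  · filter_upwards [hBC] with ω hω
    filter_upwards [hω] with J hJ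
    have := not_or.1 (fun hh => hJ ((Set.mem_union _ _ _).2 hh))
    exact ⟨not_not.1 this.1, not_not.1 this.2⟩
  have key := tendsto_natCast_atTop_atTop (R := ℝ)
  filter_upwards [tendsto_two_pow_nat.eventually (good_at hG), err_small, eventually_ge_atTop 6,
    eventually_ge_atTop (4 * p), key.eventually (ev_log' 16 1 (by norm_num) (by norm_num)),
    key.eventually (ev_log' (48 * Real.exp 3) δ (by positivity) (by positivity))]
    with J hGJ herr hJ6 hJp hJlog hJδ
  rw [Real.rpow_one] at hJlog
  set g := Nat.log 2 J / h with hg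
  set q := (1 + ε) * Real.log J with hq
  have hJ : (6:ℝ) ≤ J := by exact_mod_cast hJ6
  have hlogJ : 1 ≤ Real.log J := by
    rw [Real.le_log_iff_exp_le (by linarith)]
    linarith [Real.exp_one_lt_d9]
  have hq1 : 1 ≤ q := by nlinarith
  have hq3 : q + 1 ≤ 3 * Real.log J := by nlinarith
  have hl2 := Real.log_two_gt_d9
  have hlog2J : Real.log ((2 ^ J : ℕ) : ℝ) = J * Real.log 2 := by push_cast; rw [Real.log_pow]
  have hpq : (⌈q⌉₊ : ℝ) ≤ J / 4 := by
    have := (Nat.ceil_lt_add_one (a := q) (by linarith)).le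
    linarith
  have hpqJ : ⌈q⌉₊ ≤ J := by
    have : (⌈q⌉₊ : ℝ) ≤ J := by linarith
    exact_mod_cast this
  have hlogn : Nat.log 2 J ≤ J := Nat.log_le_self 2 J
  have hgle : g ≤ Nat.log 2 J := Nat.div_le_self _ _
  have h1 := fine_prob (P := P) hG.1 J g p hGJ (by
      rw [hlog2J]
      have : ((4 * p : ℕ) : ℝ) ≤ J := by exact_mod_cast hJp
      push_cast at this ⊢; nlinarith) (herr p (by omega)) (by
      refine hρ.trans ?_
      exact inv_le_one_of_one_le₀ (one_le_pow₀ (by norm_num)))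
  have h2 := coarse_prob (P := P) hG.1 J g q hq1 (by omega) (by omega) hGJ (by
      rw [hlog2J]; push_cast; nlinarith) (herr _ hpqJ)
  refine (measureReal_union_le _ _).trans ((add_le_add h1 h2).trans ?_)
  have hgh : 2 ^ (g * h) ≤ J := by
    calc 2 ^ (g * h) ≤ 2 ^ (Nat.log 2 J) := Nat.pow_le_pow_right (by norm_num) (Nat.div_mul_le_self _ _)
      _ ≤ J := Nat.pow_log_le_self 2 (by omega)
  have hgh2 : J < 2 ^ (g * h) * 2 ^ h := by
    calc J < 2 ^ (Nat.log 2 J).succ := Nat.lt_pow_succ_log_self (by norm_num) J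
      _ ≤ 2 ^ (g * h + h) := Nat.pow_le_pow_right (by norm_num) (Nat.lt_div_mul_add hhpos)
      _ = _ := pow_add _ _ _
  have hghR : ((2:ℝ) ^ g) ^ h ≤ J := by rw [← pow_mul]; exact_mod_cast hgh
  have hgh2R : (J:ℝ) < ((2:ℝ) ^ g) ^ h * 2 ^ h := by rw [← pow_mul]; exact_mod_cast hgh2
  have hJpow : (J:ℝ) + 2 ≤ 2 * 2 ^ J := by
    have : J < 2 ^ J := Nat.lt_two_pow_self
    have : (J:ℝ) + 1 ≤ 2 ^ J := by exact_mod_cast this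
    linarith
  have g0 : (1:ℝ) ≤ 2 ^ g := one_le_pow₀ (by norm_num)
  -- term 1
  have b1 : ((J:ℝ) + 2) ^ 2 * (3 * (2 * p).factorial * ρ ^ g) ≤ C1 * (1 / (J:ℝ) ^ 3) := by
    have e1 : ρ ^ g ≤ (2 ^ h / J) ^ 5 := by
      calc ρ ^ g ≤ (((2:ℝ) ^ (5 * h))⁻¹) ^ g := by gcongr
        _ = ((((2:ℝ) ^ g) ^ h)⁻¹) ^ 5 := by
          rw [inv_pow, inv_pow, ← pow_mul, ← pow_mul, ← pow_mul]; congr 2; ring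
        _ ≤ _ := by
          gcongr
          rw [inv_le_iff_one_le_mul₀' (by positivity), mul_div_assoc', le_div_iff₀ (by linarith)]
          linarith
    calc ((J:ℝ) + 2) ^ 2 * (3 * (2 * p).factorial * ρ ^ g) ≤ (3 * J) ^ 2 * (3 * (2 * p).factorial * (2 ^ h / J) ^ 5) := by
          gcongr; linarith
      _ = _ := by rw [hC1]; field_simp; ring
  have b2 : ((J:ℝ) + 2) ^ 2 * (16 * (1 / 16) ^ J) ≤ 64 * (1 / 4) ^ J := by
    calc ((J:ℝ) + 2) ^ 2 * (16 * (1 / 16) ^ J) ≤ (2 * 2 ^ J) ^ 2 * (16 * (1 / 16) ^ J) := by gcongr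
      _ = 64 * (((2:ℝ) ^ 2) ^ J * (1 / 16) ^ J) := by rw [← pow_mul, mul_comm 2 J, pow_mul]; ring
      _ = _ := by rw [← mul_pow]; norm_num
  have b3 : ((2:ℝ) ^ g + 1) ^ 3 * (2 * Real.exp 3 * (q + 1) * Real.exp (-q)) ≤ 1 / (J:ℝ) ^ (1 + 2 * δ) := by
    have e1 : ((2:ℝ) ^ g) ^ 3 ≤ (J:ℝ) ^ δ := by
      have : (2:ℝ) ^ g ≤ (J:ℝ) ^ (1 / h : ℝ) := by
        rw [one_div, Real.le_rpow_inv_iff_of_pos (by positivity) (by positivity) hh0, Real.rpow_natCast]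
        exact hghR
      calc ((2:ℝ) ^ g) ^ 3 ≤ ((J:ℝ) ^ (1 / h : ℝ)) ^ 3 := by gcongr
        _ = (J:ℝ) ^ (3 / h : ℝ) := by
          rw [← Real.rpow_natCast, ← Real.rpow_mul (by positivity)]; congr 1; push_cast; ring
        _ ≤ _ := by
          refine Real.rpow_le_rpow_of_exponent_le (by linarith) ?_
          rw [div_le_iff₀ hh0, hδ]
          rw [div_lt_iff₀ hε] at hh
          linarith
    have e2 : Real.exp (-q) = (J:ℝ) ^ (-(1 + ε)) := by
      rw [Real.rpow_def_of_pos (by linarith), hq]; ring_nf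
    calc ((2:ℝ) ^ g + 1) ^ 3 * (2 * Real.exp 3 * (q + 1) * Real.exp (-q)) ≤
          (2 * 2 ^ g) ^ 3 * (2 * Real.exp 3 * (3 * Real.log J) * Real.exp (-q)) := by
            gcongr; linarith
      _ = ((2:ℝ) ^ g) ^ 3 * (48 * Real.exp 3 * Real.log J) * Real.exp (-q) := by ring
      _ ≤ (J:ℝ) ^ δ * (J:ℝ) ^ δ * (J:ℝ) ^ (-(1 + ε)) := by rw [e2]; gcongr
      _ = _ := by
        rw [← Real.rpow_add (by linarith), ← Real.rpow_add (by linarith), one_div, ← Real.rpow_neg (by linarith)]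
        congr 1; rw [hδ]; ring
  have b4 : ((2:ℝ) ^ g + 1) ^ 3 * (1 / 64) ^ J ≤ 8 * (1 / 8) ^ J := by
    have : (2:ℝ) ^ g ≤ 2 ^ J := pow_le_pow_right₀ (by norm_num) (by omega)
    calc ((2:ℝ) ^ g + 1) ^ 3 * (1 / 64) ^ J ≤ (2 * 2 ^ J) ^ 3 * (1 / 64) ^ J := by gcongr; linarith
      _ = 8 * (((2:ℝ) ^ 3) ^ J * (1 / 64) ^ J) := by rw [← pow_mul, mul_comm 3 J, pow_mul]; ring
      _ = _ := by rw [← mul_pow]; norm_num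
  rw [mul_add, mul_add, ← hρd]
  refine (add_le_add (add_le_add b1 b2) (add_le_add b3 b4)).trans (le_of_eq ?_)
  simp only [hf]
  rw [← add_assoc]

lemma loglog_tendsto : Tendsto (fun N : ℕ => Real.log (Real.log N)) atTop atTop :=
  Real.tendsto_log_atTop.comp (Real.tendsto_log_atTop.comp tendsto_natCast_atTop_atTop)

theorem upper_LIL (h01 : ∀ n ω, X n ω ∈ Set.Ico (0:ℝ) 1) (hG : Good P X) (ε : ℝ) (hε : 0 < ε) (hε1 : ε ≤ 1) :
    ∀ᵐ ω ∂P, ∀ᶠ N : ℕ in atTop, ∀ a b : ℝ, 0 ≤ a → a < b → b ≤ 1 →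
      |T (fun n => X n ω) (Finset.Icc 1 N) a b| ≤ (1 / √2 + ε) * √(N * Real.log (Real.log N)) := by
  obtain ⟨h, hev⟩ := upper_events hG ε hε hε1
  filter_upwards [hev] with ω hω
  obtain ⟨J0, hJ0⟩ := eventually_atTop.1 hω
  filter_upwards [eventually_ge_atTop (4 ^ (J0 + 1)),
    loglog_tendsto.eventually (eventually_ge_atTop ((2000 / ε) ^ 2))] with N hN hLL a b ha hab hb
  set J := Nat.log 4 N with hJdef
  have hN0 : N ≠ 0 := by
    have : 0 < 4 ^ (J0 + 1) := by positivity
    omega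
  have hJ : J0 + 1 ≤ J := Nat.le_log_of_pow_le (by norm_num) hN
  have hN1 : 4 ^ J ≤ N := Nat.pow_log_le_self 4 hN0
  have hN2 : N < 4 ^ (J + 1) := Nat.lt_pow_succ_log_self (by norm_num) N
  obtain ⟨hF, hC⟩ := hJ0 J (by omega)
  have hd := det (fun n => X n ω) (fun n => h01 n ω) J (Nat.log 2 J / h) _ (Real.sqrt_nonneg _)
    (by have := Nat.div_le_self (Nat.log 2 J) h; have := Nat.log_le_self 2 J; omega) hF hC N hN1 hN2 a b ha hab hb
  refine hd.trans ?_
  have hJR : (1:ℝ) ≤ J := by exact_mod_cast (by omega : 1 ≤ J)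
  have hNR : (4:ℝ) ^ J ≤ N := by exact_mod_cast hN1
  have hlN : (J:ℝ) ≤ Real.log N := by
    calc (J:ℝ) ≤ J * Real.log 4 := by
          have : 1 ≤ Real.log 4 := by
            rw [Real.le_log_iff_exp_le (by norm_num)]; linarith [Real.exp_one_lt_d9]
          nlinarith
      _ = Real.log ((4:ℝ) ^ J) := by rw [Real.log_pow]
      _ ≤ _ := Real.log_le_log (by positivity) hNR
  set LL := Real.log (Real.log N) with hLLd
  have hlJ : Real.log J ≤ LL := Real.log_le_log (by linarith) hlN
  have hLL0 : 0 ≤ LL := le_trans (by positivity) hLL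
  have h2J : (2:ℝ) ^ J ≤ √N := by
    refine Real.le_sqrt_of_sq_le ?_
    rw [← pow_mul, mul_comm, pow_mul]; norm_num; exact hNR
  have hsq : 2000 / ε ≤ √LL := Real.le_sqrt_of_sq_le hLL
  rw [Real.sqrt_mul (by positivity), mul_comm √(N:ℝ) √LL, ← mul_assoc]
  have e1 : √((1 + ε) * Real.log J / 2) ≤ (1 / √2 + ε / 2) * √LL := by
    have : (1 / √2 + ε / 2) * √LL = √((1 / √2 + ε / 2) ^ 2 * LL) := by
      rw [Real.sqrt_mul (by positivity), Real.sqrt_sq (by positivity)]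
    rw [this]
    apply Real.sqrt_le_sqrt
    have h5 : (1 + ε) / 2 ≤ (1 / √2 + ε / 2) ^ 2 := by
      have hs : (1 / √2) ^ 2 = 1 / 2 := by rw [div_pow, Real.sq_sqrt (by norm_num)]; norm_num
      have hs2 : 1 / 2 ≤ 1 / √2 := by
        gcongr
        exact Real.sqrt_le_iff.2 ⟨by norm_num, by norm_num⟩
      nlinarith
    calc (1 + ε) * Real.log J / 2 = (1 + ε) / 2 * Real.log J := by ring
      _ ≤ (1 + ε) / 2 * LL := by gcongr
      _ ≤ _ := by gcongr
  have e2 : 1000 ≤ ε / 2 * √LL := by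
    rw [div_le_iff₀ hε] at hsq; linarith
  calc √((1 + ε) * Real.log J / 2) * √N + 1000 * 2 ^ J ≤
        (1 / √2 + ε / 2) * √LL * √N + (ε / 2 * √LL) * √N := by gcongr
    _ = _ := by ring

end

end LIL

namespace LIL
open ProbabilityTheory

lemma taylor_cos (γ : ℝ) (n : ℕ) : ∃ c : ℕ → ℝ, (∀ m, |c m| ≤ 1) ∧ ∀ z : ℝ,
    |Real.cos (z + γ) - ∑ m ∈ Finset.range (n + 1), c m * z ^ m / m.factorial| ≤
      |z| ^ (n + 1) / (n + 1).factorial := by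
  refine ⟨fun m => iteratedDeriv m Real.cos γ, fun m => Real.abs_iteratedDeriv_cos_le_one m γ, fun z => ?_⟩
  rcases eq_or_ne z 0 with rfl | hz
  · rw [Finset.sum_range_succ']
    simp
  have hne : γ ≠ z + γ := fun h => hz (by linarith)
  obtain ⟨x', _, hx'⟩ := taylor_mean_remainder_lagrange_iteratedDeriv (n := n) (f := Real.cos) hne
    Real.contDiff_cos.contDiffOn
  rw [taylor_within_apply] at hx'
  have h2 : ∑ m ∈ Finset.range (n + 1), iteratedDeriv m Real.cos γ * z ^ m / m.factorial =
      ∑ k ∈ Finset.range (n + 1), ((k.factorial : ℝ)⁻¹ * (z + γ - γ) ^ k) •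
        iteratedDerivWithin k Real.cos (Set.uIcc γ (z + γ)) γ := by
    refine Finset.sum_congr rfl fun m _ => ?_
    rw [iteratedDerivWithin_eq_iteratedDeriv (uniqueDiffOn_uIcc hne) Real.contDiff_cos.contDiffAt
      Set.left_mem_uIcc, smul_eq_mul]
    simp only [add_sub_cancel_right]
    field_simp
  rw [h2, hx', abs_div, abs_mul, Nat.abs_cast, add_sub_cancel_right, abs_pow]
  have := Real.abs_iteratedDeriv_cos_le_one (n + 1) x'
  gcongr
  exact mul_le_of_le_one_left (by positivity) this

section
variable {Ω : Type*} [MeasurableSpace Ω] {P : Measure Ω} [IsProbabilityMeasure P]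
  {X : ℕ → Ω → ℝ}

lemma taylor_int {Ω' : Type*} [MeasurableSpace Ω'] (ν : Measure Ω') [IsProbabilityMeasure ν]
    (Z : ℕ → Ω' → ℝ) (hZ : ∀ n, Measurable (Z n)) (F : Finset ℕ) (c : ℕ → ℝ) (a b : ℝ)
    (ha : 0 ≤ a) (hab : a < b) (hb : b ≤ 1) (γ : ℝ) (p : ℕ) (d : ℕ → ℝ)
    (hd : ∀ z : ℝ, |Real.cos (z + γ) - ∑ m ∈ Finset.range (2 * p), d m * z ^ m / m.factorial| ≤
      |z| ^ (2 * p) / (2 * p).factorial) :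
    |∫ ω, Real.cos (Sm Z F c a b ω + γ) ∂ν - ∑ m ∈ Finset.range (2 * p), d m / m.factorial * ∫ ω, Sm Z F c a b ω ^ m ∂ν| ≤
      (∫ ω, Sm Z F c a b ω ^ (2 * p) ∂ν) / (2 * p).factorial := by
  have h1 : ∑ m ∈ Finset.range (2 * p), d m / m.factorial * ∫ ω, Sm Z F c a b ω ^ m ∂ν =
      ∫ ω, ∑ m ∈ Finset.range (2 * p), d m * Sm Z F c a b ω ^ m / m.factorial ∂ν := by
    rw [integral_finsetSum _ (fun m _ => integrable_Sm_fun ν Z hZ F c a b ha hab hb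
      (fun z => d m * z ^ m / m.factorial) (by fun_prop))]
    refine Finset.sum_congr rfl fun m _ => ?_
    rw [← integral_const_mul]
    congr 1; ext ω; ring
  rw [h1, ← integral_sub (integrable_Sm_fun ν Z hZ F c a b ha hab hb (fun z => Real.cos (z + γ)) (by fun_prop))
    (integrable_Sm_fun ν Z hZ F c a b ha hab hb
      (fun z => ∑ m ∈ Finset.range (2 * p), d m * z ^ m / m.factorial) (by fun_prop)), ← integral_div]
  refine (abs_integral_le_integral_abs).trans (integral_mono ?_ ?_ fun ω => ?_)
  · exact integrable_Sm_fun ν Z hZ F c a b ha hab hb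
      (fun z => |Real.cos (z + γ) - ∑ m ∈ Finset.range (2 * p), d m * z ^ m / m.factorial|) (by fun_prop)
  · exact integrable_Sm_fun ν Z hZ F c a b ha hab hb (fun z => z ^ (2 * p) / (2 * p).factorial) (by fun_prop)
  · refine (hd _).trans (le_of_eq ?_)
    rw [pow_mul, sq_abs, ← pow_mul]

/-- comparison of characteristic functions -/
lemma cos_cmp (hX : ∀ n, Measurable (X n)) {n0 : ℕ} (hG : GoodAt P X n0) (F : Finset ℕ)
    (hF : ∀ n ∈ F, n0 ≤ n) (a b : ℝ)
    (ha : 0 ≤ a) (hab : a < b) (hb : b ≤ 1) (c : ℕ → ℝ) (p : ℕ) (hp1 : 1 ≤ p)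
    (hp : ((2 * p : ℕ) : ℝ) ≤ Real.log n0)
    (γ t : ℝ) (ht : 0 < t) (A : ℝ) (hA : ∑ n ∈ F, |c n| ≤ A) (hA1 : 1 ≤ A) :
    |∫ ω, Real.cos (Sm X F c a b ω + γ) ∂P - ∫ ω, Real.cos (Sm YY F c a b ω + γ) ∂QQ| ≤
      2 * Real.exp (t ^ 2 * (∑ n ∈ F, c n ^ 2) / 8) / t ^ (2 * p) + 4 * (A ^ (2 * p) * Real.exp (-√(n0 : ℝ))) := by
  obtain ⟨d, hd1, hd2⟩ := taylor_cos γ (2 * p - 1)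
  rw [Nat.sub_add_cancel (by omega)] at hd2
  set E := Real.exp (-√(n0 : ℝ)) with hE
  have hE0 : 0 < E := Real.exp_pos _
  have h1 := taylor_int P X hX F c a b ha hab hb γ p d hd2
  have h2 := taylor_int QQ YY measurable_YY F c a b ha hab hb γ p d hd2
  have hS0 : 0 ≤ ∑ n ∈ F, |c n| := Finset.sum_nonneg fun _ _ => abs_nonneg _
  have hmom : ∀ m ≤ 2 * p, |∫ ω, Sm X F c a b ω ^ m ∂P - ∫ ω, Sm YY F c a b ω ^ m ∂QQ| ≤ A ^ (2 * p) * E := by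
    intro m hm
    refine (moment_cmp hX hG F hF a b ha hab hb c m ?_).trans ?_
    · refine le_trans ?_ hp
      exact_mod_cast hm
    · refine mul_le_mul_of_nonneg_right ?_ hE0.le
      exact (pow_le_pow_left₀ hS0 hA m).trans (pow_le_pow_right₀ hA1 hm)
  have hQ := Q_moment F a b ha hab hb c p t _ ht (cosh_hoeff F c a b t ha hab hb)
  set K := Real.exp (t ^ 2 * (∑ n ∈ F, c n ^ 2) / 8) with hK
  have hf : (0:ℝ) < (2 * p).factorial := by positivity
  have hf1 : (1:ℝ) ≤ (2 * p).factorial := by exact_mod_cast Nat.one_le_iff_ne_zero.2 (Nat.factorial_ne_zero _)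
  have hQ' : (∫ ω, Sm YY F c a b ω ^ (2 * p) ∂QQ) / (2 * p).factorial ≤ K / t ^ (2 * p) := by
    rw [div_le_iff₀ hf]; refine hQ.trans (le_of_eq ?_); ring
  have hAE : 0 ≤ A ^ (2 * p) * E := by positivity
  have hP' : (∫ ω, Sm X F c a b ω ^ (2 * p) ∂P) / (2 * p).factorial ≤ K / t ^ (2 * p) + A ^ (2 * p) * E := by
    have h3 := (le_abs_self _).trans (hmom (2 * p) le_rfl)
    have h4 : (∫ ω, Sm X F c a b ω ^ (2 * p) ∂P) / (2 * p).factorial ≤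
        (∫ ω, Sm YY F c a b ω ^ (2 * p) ∂QQ) / (2 * p).factorial + A ^ (2 * p) * E / (2 * p).factorial := by
      rw [← add_div]; gcongr; linarith
    have h5 := div_le_self hAE hf1
    linarith
  have hmid : |∑ m ∈ Finset.range (2 * p), d m / m.factorial * ∫ ω, Sm X F c a b ω ^ m ∂P -
      ∑ m ∈ Finset.range (2 * p), d m / m.factorial * ∫ ω, Sm YY F c a b ω ^ m ∂QQ| ≤ 3 * (A ^ (2 * p) * E) := by
    rw [← Finset.sum_sub_distrib]
    calc _ ≤ ∑ m ∈ Finset.range (2 * p), 1 / (m.factorial : ℝ) * (A ^ (2 * p) * E) := by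
          refine (Finset.abs_sum_le_sum_abs _ _).trans (Finset.sum_le_sum fun m hm => ?_)
          rw [← mul_sub, abs_mul, abs_div, Nat.abs_cast]
          have := hmom m (Finset.mem_range.1 hm).le
          have := hd1 m
          gcongr
      _ = (∑ m ∈ Finset.range (2 * p), (1:ℝ) ^ m / (m.factorial : ℝ)) * (A ^ (2 * p) * E) := by
          rw [Finset.sum_mul]; simp
      _ ≤ Real.exp 1 * (A ^ (2 * p) * E) := by
          gcongr
          exact Real.sum_le_exp_of_nonneg (by norm_num) _
      _ ≤ _ := by
          have := Real.exp_one_lt_d9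
          gcongr; linarith
  have e : 2 * K / t ^ (2 * p) = K / t ^ (2 * p) + K / t ^ (2 * p) := by ring
  rw [e]
  rw [abs_le] at *
  constructor <;> linarith [h1.1, h1.2, h2.1, h2.2, hmid.1, hmid.2]
end

end LIL

namespace LIL
open ProbabilityTheory

section
variable {Ω Ω' : Type*} [MeasurableSpace Ω] [MeasurableSpace Ω'] {P : Measure Ω} [IsProbabilityMeasure P]
  {Q : Measure Ω'} [IsProbabilityMeasure Q]

lemma int_bdd (f : Ω → ℝ) (hf : Measurable f) (h : ∀ ω, |f ω| ≤ 1) : Integrable f P :=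
  Integrable.of_bound hf.aestronglyMeasurable 1 (ae_of_all _ h)

lemma abs_cos_pow (x y z : ℝ) (m m' : ℕ) : |Real.cos x ^ m * Real.cos y ^ m' * Real.cos z| ≤ 1 := by
  rw [abs_mul, abs_mul, abs_pow, abs_pow]
  have h1 := pow_le_one₀ (n := m) (abs_nonneg _) (Real.abs_cos_le_one x)
  have h2 := pow_le_one₀ (n := m') (abs_nonneg _) (Real.abs_cos_le_one y)
  have h3 := Real.abs_cos_le_one z
  exact mul_le_one₀ (mul_le_one₀ h1 (by positivity) h2) (by positivity) h3

lemma cos_split (Z : Ω → ℝ) (u A B : Ω → ℝ) (hZ : Measurable Z) (hA : Measurable A)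
    (hB : Measurable B) (hZ1 : ∀ ω, |Z ω * Real.cos (A ω)| ≤ 1) (hZ2 : ∀ ω, |Z ω * Real.cos (B ω)| ≤ 1)
    (C : Ω → ℝ) (h : ∀ ω, A ω = C ω + u ω) (h' : ∀ ω, B ω = C ω - u ω) :
    ∫ ω, Real.cos (u ω) * Z ω * Real.cos (C ω) ∂P =
      ((∫ ω, Z ω * Real.cos (A ω) ∂P) + ∫ ω, Z ω * Real.cos (B ω) ∂P) / 2 := by
  rw [← integral_add (int_bdd _ (by fun_prop) hZ1) (int_bdd _ (by fun_prop) hZ2), ← integral_div]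
  congr 1; ext ω
  rw [h, h', Real.cos_add, Real.cos_sub]; ring

lemma half_bound (a b c d δ : ℝ) (h1 : |a - c| ≤ δ) (h2 : |b - d| ≤ δ) : |(a + b) / 2 - (c + d) / 2| ≤ δ := by
  rw [abs_le] at *; constructor <;> linarith [h1.1, h1.2, h2.1, h2.2]

lemma cos_pow_cmp (s1 s2 : Ω → ℝ) (r1 r2 : Ω' → ℝ) (hs1 : Measurable s1) (hs2 : Measurable s2)
    (hr1 : Measurable r1) (hr2 : Measurable r2) (α β δ τ : ℝ) (hα : 0 ≤ α)
    (H : ∀ t t' γ : ℝ, |t| ≤ τ → |t'| ≤ τ → |∫ ω, Real.cos (t * s1 ω + t' * s2 ω + γ) ∂P -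
      ∫ ω, Real.cos (t * r1 ω + t' * r2 ω + γ) ∂Q| ≤ δ) (m m' : ℕ) :
    ∀ t t' γ : ℝ, |t| + m * α ≤ τ → |t'| + m' * α ≤ τ →
    |∫ ω, Real.cos (α * s1 ω - β) ^ m * Real.cos (α * s2 ω - β) ^ m' * Real.cos (t * s1 ω + t' * s2 ω + γ) ∂P -
     ∫ ω, Real.cos (α * r1 ω - β) ^ m * Real.cos (α * r2 ω - β) ^ m' * Real.cos (t * r1 ω + t' * r2 ω + γ) ∂Q| ≤ δ := by
  induction m with
  | zero =>
    induction m' with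
    | zero =>
      intro t t' γ h1 h2
      simpa using H t t' γ (by simpa using h1) (by simpa using h2)
    | succ m' ih =>
      intro t t' γ h1 h2
      push_cast at h2
      have a1 : |t' + α| ≤ |t'| + α := (abs_add_le _ _).trans (by rw [abs_of_nonneg hα])
      have a2 : |t' - α| ≤ |t'| + α := (abs_sub _ _).trans (by rw [abs_of_nonneg hα])
      have e1 := ih t (t' + α) (γ - β) h1 (by linarith)
      have e2 := ih t (t' - α) (γ + β) h1 (by linarith)
      have eP := cos_split (P := P) (fun ω => Real.cos (α * s1 ω - β) ^ 0 * Real.cos (α * s2 ω - β) ^ m')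
        (fun ω => α * s2 ω - β) (fun ω => t * s1 ω + (t' + α) * s2 ω + (γ - β))
        (fun ω => t * s1 ω + (t' - α) * s2 ω + (γ + β)) (by fun_prop) (by fun_prop) (by fun_prop)
        (fun ω => abs_cos_pow _ _ _ _ _) (fun ω => abs_cos_pow _ _ _ _ _)
        (fun ω => t * s1 ω + t' * s2 ω + γ) (fun ω => by ring) (fun ω => by ring)
      have eQ := cos_split (P := Q) (fun ω => Real.cos (α * r1 ω - β) ^ 0 * Real.cos (α * r2 ω - β) ^ m')
        (fun ω => α * r2 ω - β) (fun ω => t * r1 ω + (t' + α) * r2 ω + (γ - β))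
        (fun ω => t * r1 ω + (t' - α) * r2 ω + (γ + β)) (by fun_prop) (by fun_prop) (by fun_prop)
        (fun ω => abs_cos_pow _ _ _ _ _) (fun ω => abs_cos_pow _ _ _ _ _)
        (fun ω => t * r1 ω + t' * r2 ω + γ) (fun ω => by ring) (fun ω => by ring)
      have key := half_bound _ _ _ _ _ e1 e2
      rw [← eP, ← eQ] at key
      refine le_of_eq_of_le ?_ key
      congr 2 <;> (congr 1; ext ω; rw [pow_succ]; ring)
  | succ m ih =>
      intro t t' γ h1 h2
      push_cast at h1
      have a1 : |t + α| ≤ |t| + α := (abs_add_le _ _).trans (by rw [abs_of_nonneg hα])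
      have a2 : |t - α| ≤ |t| + α := (abs_sub _ _).trans (by rw [abs_of_nonneg hα])
      have e1 := ih (t + α) t' (γ - β) (by linarith) h2
      have e2 := ih (t - α) t' (γ + β) (by linarith) h2
      have eP := cos_split (P := P) (fun ω => Real.cos (α * s1 ω - β) ^ m * Real.cos (α * s2 ω - β) ^ m')
        (fun ω => α * s1 ω - β) (fun ω => (t + α) * s1 ω + t' * s2 ω + (γ - β))
        (fun ω => (t - α) * s1 ω + t' * s2 ω + (γ + β)) (by fun_prop) (by fun_prop) (by fun_prop)
        (fun ω => abs_cos_pow _ _ _ _ _) (fun ω => abs_cos_pow _ _ _ _ _)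
        (fun ω => t * s1 ω + t' * s2 ω + γ) (fun ω => by ring) (fun ω => by ring)
      have eQ := cos_split (P := Q) (fun ω => Real.cos (α * r1 ω - β) ^ m * Real.cos (α * r2 ω - β) ^ m')
        (fun ω => α * r1 ω - β) (fun ω => (t + α) * r1 ω + t' * r2 ω + (γ - β))
        (fun ω => (t - α) * r1 ω + t' * r2 ω + (γ + β)) (by fun_prop) (by fun_prop) (by fun_prop)
        (fun ω => abs_cos_pow _ _ _ _ _) (fun ω => abs_cos_pow _ _ _ _ _)
        (fun ω => t * r1 ω + t' * r2 ω + γ) (fun ω => by ring) (fun ω => by ring)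
      have key := half_bound _ _ _ _ _ e1 e2
      rw [← eP, ← eQ] at key
      refine le_of_eq_of_le ?_ key
      congr 2 <;> (congr 1; ext ω; rw [pow_succ]; ring)

/-- second moment method -/
lemma second_moment {ι : Type*} [DecidableEq ι] (I : Finset ι) (G : ι → Ω → ℝ) (hG : ∀ i, Measurable (G i))
    (h0 : ∀ i ω, 0 ≤ G i ω) (h1 : ∀ i ω, G i ω ≤ 1) (m : ι → ℝ) (hm0 : ∀ i ∈ I, 0 ≤ m i) (hm1 : ∀ i ∈ I, m i ≤ 1) (δ : ℝ)
    (e1 : ∀ i ∈ I, |∫ ω, G i ω ∂P - m i| ≤ δ)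
    (e2 : ∀ i ∈ I, ∀ j ∈ I, i ≠ j → |∫ ω, G i ω * G j ω ∂P - m i * m j| ≤ δ)
    (hM : 0 < ∑ i ∈ I, m i) :
    P.real {ω | ∑ i ∈ I, G i ω ≤ (∑ i ∈ I, m i) / 2} ≤
      4 * ((∑ i ∈ I, m i) + 3 * I.card ^ 2 * δ) / (∑ i ∈ I, m i) ^ 2 := by
  set M := ∑ i ∈ I, m i with hMdef
  have iG : ∀ i, Integrable (G i) P := fun i => int_bdd _ (hG i) fun ω => by
    rw [abs_of_nonneg (h0 i ω)]; exact h1 i ω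
  have iGG : ∀ i j, Integrable (fun ω => G i ω * G j ω) P := fun i j =>
    int_bdd _ ((hG i).mul (hG j)) fun ω => by
      rw [abs_of_nonneg (mul_nonneg (h0 i ω) (h0 j ω))]; exact mul_le_one₀ (h1 i ω) (h0 j ω) (h1 j ω)
  have iD : ∀ i j, Integrable (fun ω => (G i ω - m i) * (G j ω - m j)) P := fun i j => by
    have : (fun ω => (G i ω - m i) * (G j ω - m j)) =
      fun ω => G i ω * G j ω - m j * G i ω - m i * G j ω + m i * m j := by ext ω; ring
    rw [this]
    exact (((iGG i j).sub ((iG i).const_mul _)).sub ((iG j).const_mul _)).add (integrable_const _)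
  have vD : ∀ i j, ∫ ω, (G i ω - m i) * (G j ω - m j) ∂P =
      ∫ ω, G i ω * G j ω ∂P - m j * ∫ ω, G i ω ∂P - m i * ∫ ω, G j ω ∂P + m i * m j := fun i j => by
    have : (fun ω => (G i ω - m i) * (G j ω - m j)) =
      fun ω => G i ω * G j ω - m j * G i ω - m i * G j ω + m i * m j := by ext ω; ring
    have q1 : Integrable (fun ω => m j * G i ω) P := (iG i).const_mul _
    have q2 : Integrable (fun ω => m i * G j ω) P := (iG j).const_mul _
    have q3 : Integrable (fun ω => G i ω * G j ω - m j * G i ω) P := (iGG i j).sub q1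
    have q4 : Integrable (fun ω => G i ω * G j ω - m j * G i ω - m i * G j ω) P := q3.sub q2
    rw [this, integral_add q4 (integrable_const _), integral_sub q3 q2, integral_sub (iGG i j) q1,
      integral_const_mul, integral_const_mul]
    simp
  have hsq : ∀ ω, (∑ i ∈ I, G i ω - M) ^ 2 = ∑ i ∈ I, ∑ j ∈ I, (G i ω - m i) * (G j ω - m j) := fun ω => by
    rw [hMdef, ← Finset.sum_sub_distrib, sq, Finset.sum_mul_sum]
  have iV : Integrable (fun ω => (∑ i ∈ I, G i ω - M) ^ 2) P := by
    simp only [hsq]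
    exact integrable_finsetSum _ fun i _ => integrable_finsetSum _ fun j _ => iD i j
  have hV : ∫ ω, (∑ i ∈ I, G i ω - M) ^ 2 ∂P ≤ M + 3 * I.card ^ 2 * δ := by
    simp only [hsq]
    rw [integral_finsetSum _ fun i _ => integrable_finsetSum _ fun j _ => iD i j]
    have hb : ∀ i ∈ I, ∀ j ∈ I, ∫ ω, (G i ω - m i) * (G j ω - m j) ∂P ≤ (if i = j then m i else 0) + 3 * δ := by
      intro i hi j hj
      rw [vD]
      have a1 := abs_le.1 (e1 i hi)
      have a2 := abs_le.1 (e1 j hj)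
      have := hm0 i hi
      have := hm0 j hj
      have := hm1 i hi
      have := hm1 j hj
      split_ifs with hij
      · subst hij
        have : ∫ ω, G i ω * G i ω ∂P ≤ ∫ ω, G i ω ∂P :=
          integral_mono (iGG i i) (iG i) fun ω => mul_le_of_le_one_right (h0 i ω) (h1 i ω)
        nlinarith
      · have a3 := abs_le.1 (e2 i hi j hj hij)
        nlinarith
    calc _ ≤ ∑ i ∈ I, ∑ j ∈ I, ((if i = j then m i else 0) + 3 * δ) := by
          refine Finset.sum_le_sum fun i hi => ?_
          rw [integral_finsetSum _ fun j _ => iD i j]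
          exact Finset.sum_le_sum fun j hj => hb i hi j hj
      _ = _ := by
          simp only [Finset.sum_add_distrib, Finset.sum_ite_eq, Finset.sum_const, nsmul_eq_mul]
          rw [Finset.sum_congr rfl (fun i hi => if_pos hi)]
          ring
  have hm := mul_meas_ge_le_integral_of_nonneg (μ := P) (f := fun ω => (∑ i ∈ I, G i ω - M) ^ 2)
    (ae_of_all _ fun ω => sq_nonneg _) iV (M ^ 2 / 4)
  have hsub : {ω | ∑ i ∈ I, G i ω ≤ M / 2} ⊆ {ω | M ^ 2 / 4 ≤ (∑ i ∈ I, G i ω - M) ^ 2} := by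
    intro ω hω
    have hω' : ∑ i ∈ I, G i ω ≤ M / 2 := hω
    change M ^ 2 / 4 ≤ (∑ i ∈ I, G i ω - M) ^ 2
    nlinarith
  have hmono := measureReal_mono (μ := P) hsub (measure_ne_top _ _)
  rw [le_div_iff₀ (by positivity)]
  have : 0 < M ^ 2 := by positivity
  change M ^ 2 / 4 * P.real _ ≤ _ at hm
  nlinarith

end

/-- independence of blocks in the model -/
lemma Q_indep (F1 F2 : Finset ℕ) (h : Disjoint F1 F2) (c1 c2 : ℕ → ℝ) (a b : ℝ) (f g : ℝ → ℝ)
    (hf : Measurable f) (hg : Measurable g) :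
    ∫ ω, f (Sm YY F1 c1 a b ω) * g (Sm YY F2 c2 a b ω) ∂QQ =
      (∫ ω, f (Sm YY F1 c1 a b ω) ∂QQ) * ∫ ω, g (Sm YY F2 c2 a b ω) ∂QQ := by
  have hi := indep_YY.indepFun_finset F1 F2 h measurable_YY
  have key : ∀ (F : Finset ℕ) (c : ℕ → ℝ) (f : ℝ → ℝ), Measurable f → ∃ φ : (F → ℝ) → ℝ, Measurable φ ∧
      ∀ ω, f (Sm YY F c a b ω) = φ (fun i : F => YY i ω) := by
    intro F c f hf
    refine ⟨fun y => f (∑ i : F, c i * (ind a b (y i) - (b - a))), ?_, fun ω => ?_⟩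
    · refine hf.comp (Finset.measurable_sum _ fun i _ => ?_)
      exact (((measurable_ind a b).comp (measurable_pi_apply i)).sub_const _).const_mul _
    · unfold Sm
      rw [← Finset.sum_coe_sort F (fun n => c n * (ind a b (YY n ω) - (b - a)))]
  obtain ⟨φ, hφ, e1⟩ := key F1 c1 f hf
  obtain ⟨ψ, hψ, e2⟩ := key F2 c2 g hg
  simp only [e1, e2]
  refine hi.integral_fun_comp_mul_comp ?_ ?_ hφ.aestronglyMeasurable hψ.aestronglyMeasurable
  · exact (measurable_pi_iff.2 fun i : F1 => measurable_YY i.1).aemeasurable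
  · exact (measurable_pi_iff.2 fun i : F2 => measurable_YY i.1).aemeasurable

end LIL

namespace LIL
open ProbabilityTheory

section
variable {Ω : Type*} [MeasurableSpace Ω] {P : Measure Ω} [IsProbabilityMeasure P]
  {X : ℕ → Ω → ℝ}

lemma Sm_comb {Ω' : Type*} (Z : ℕ → Ω' → ℝ) (F1 F2 : Finset ℕ) (h : Disjoint F1 F2) (d1 d2 t t' a b : ℝ) (ω : Ω') :
    t * Sm Z F1 (fun _ => d1) a b ω + t' * Sm Z F2 (fun _ => d2) a b ω =
      Sm Z (F1 ∪ F2) (fun n => if n ∈ F1 then t * d1 else t' * d2) a b ω := by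
  unfold Sm
  rw [Finset.sum_union h, Finset.mul_sum, Finset.mul_sum]
  congr 1
  · refine Finset.sum_congr rfl fun n hn => ?_
    simp only [if_pos hn]; ring
  · refine Finset.sum_congr rfl fun n hn => ?_
    simp only [if_neg (Finset.disjoint_right.1 h hn)]; ring

lemma sum_comb (F1 F2 : Finset ℕ) (h : Disjoint F1 F2) (x y : ℝ) (f : ℝ → ℝ) :
    ∑ n ∈ F1 ∪ F2, f (if n ∈ F1 then x else y) = F1.card * f x + F2.card * f y := by
  rw [Finset.sum_union h, Finset.sum_congr rfl (g := fun _ => f x) (fun n hn => by rw [if_pos hn]),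
    Finset.sum_congr (s₁ := F2) rfl (g := fun _ => f y)
      (fun n hn => by rw [if_neg (Finset.disjoint_right.1 h hn)])]
  simp

lemma block_cos (hX : ∀ n, Measurable (X n)) {n0 : ℕ} (hG : GoodAt P X n0) (F1 F2 : Finset ℕ)
    (h : Disjoint F1 F2) (hF1 : ∀ n ∈ F1, n0 ≤ n) (hF2 : ∀ n ∈ F2, n0 ≤ n) (d1 d2 τ A : ℝ)
    (h1 : F1.card * d1 ^ 2 ≤ 4) (h2 : F2.card * d2 ^ 2 ≤ 4)
    (h1' : τ * (F1.card * |d1|) ≤ A / 2) (h2' : τ * (F2.card * |d2|) ≤ A / 2) (hA1 : 1 ≤ A)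
    (p : ℕ) (hp1 : 1 ≤ p) (hp : ((2 * p : ℕ) : ℝ) ≤ Real.log n0) (t t' γ : ℝ) (ht : |t| ≤ τ) (ht' : |t'| ≤ τ) :
    |∫ ω, Real.cos (t * Sm X F1 (fun _ => d1) 0 (1 / 2) ω + t' * Sm X F2 (fun _ => d2) 0 (1 / 2) ω + γ) ∂P -
     ∫ ω, Real.cos (t * Sm YY F1 (fun _ => d1) 0 (1 / 2) ω + t' * Sm YY F2 (fun _ => d2) 0 (1 / 2) ω + γ) ∂QQ| ≤
      2 * Real.exp (9 * τ ^ 2 - 2 * p) + 4 * (A ^ (2 * p) * Real.exp (-√(n0 : ℝ))) := by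
  simp only [Sm_comb _ F1 F2 h]
  have hτ : 0 ≤ τ := (abs_nonneg _).trans ht
  have q1 : t ^ 2 ≤ τ ^ 2 := by rw [← sq_abs]; gcongr
  have q2 : t' ^ 2 ≤ τ ^ 2 := by rw [← sq_abs]; gcongr
  refine (cos_cmp hX hG (F1 ∪ F2) (fun n hn => (Finset.mem_union.1 hn).elim (hF1 n) (hF2 n)) 0 (1 / 2) le_rfl
    (by norm_num) (by norm_num) _ p hp1 hp γ (Real.exp 1) (Real.exp_pos 1) A ?_ hA1).trans ?_
  · rw [sum_comb F1 F2 h _ _ abs, abs_mul, abs_mul]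
    have r1 : F1.card * (|t| * |d1|) ≤ τ * (F1.card * |d1|) := by
      rw [mul_left_comm]; gcongr
    have r2 : F2.card * (|t'| * |d2|) ≤ τ * (F2.card * |d2|) := by
      rw [mul_left_comm]; gcongr
    linarith
  · rw [sum_comb F1 F2 h _ _ (fun x => x ^ 2)]
    simp only [mul_pow]
    have he := Real.exp_one_lt_d9
    have he0 := Real.exp_pos 1
    have r1 : F1.card * (t ^ 2 * d1 ^ 2) ≤ 4 * τ ^ 2 := by
      calc _ = t ^ 2 * (F1.card * d1 ^ 2) := by ring
        _ ≤ τ ^ 2 * 4 := by gcongr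
        _ = _ := by ring
    have r2 : F2.card * (t' ^ 2 * d2 ^ 2) ≤ 4 * τ ^ 2 := by
      calc _ = t' ^ 2 * (F2.card * d2 ^ 2) := by ring
        _ ≤ τ ^ 2 * 4 := by gcongr
        _ = _ := by ring
    have r3 : Real.exp 1 ^ 2 ≤ 9 := by nlinarith
    have hexp : Real.exp 1 ^ 2 * (F1.card * (t ^ 2 * d1 ^ 2) + F2.card * (t' ^ 2 * d2 ^ 2)) / 8 ≤ 9 * τ ^ 2 := by
      calc _ ≤ 9 * (4 * τ ^ 2 + 4 * τ ^ 2) / 8 := by gcongr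
        _ = _ := by ring
    have h5 := Real.exp_le_exp.2 hexp
    have h6 : 2 * Real.exp (9 * τ ^ 2 - 2 * p) = 2 * Real.exp (9 * τ ^ 2) / Real.exp 1 ^ (2 * p) := by
      rw [Real.exp_sub, show Real.exp (2 * (p:ℝ)) = Real.exp 1 ^ (2 * p) by
        rw [← Real.exp_nat_mul]; push_cast; ring_nf, mul_div_assoc]
    rw [h6]
    refine add_le_add ?_ le_rfl
    exact div_le_div_of_nonneg_right (by linarith) (by positivity)

/-- the model mean of the test function -/
noncomputable def mm (F : Finset ℕ) (d α β : ℝ) (k : ℕ) : ℝ :=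
  ∫ ω, Real.cos (α * Sm YY F (fun _ => d) 0 (1 / 2) ω - β) ^ (2 * k) ∂QQ

lemma block_two (hX : ∀ n, Measurable (X n)) {n0 : ℕ} (hG : GoodAt P X n0) (F1 F2 : Finset ℕ)
    (h : Disjoint F1 F2) (hF1 : ∀ n ∈ F1, n0 ≤ n) (hF2 : ∀ n ∈ F2, n0 ≤ n) (d1 d2 τ A : ℝ)
    (h1 : F1.card * d1 ^ 2 ≤ 4) (h2 : F2.card * d2 ^ 2 ≤ 4)
    (h1' : τ * (F1.card * |d1|) ≤ A / 2) (h2' : τ * (F2.card * |d2|) ≤ A / 2) (hA1 : 1 ≤ A)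
    (p : ℕ) (hp1 : 1 ≤ p) (hp : ((2 * p : ℕ) : ℝ) ≤ Real.log n0) (α β : ℝ) (hα : 0 ≤ α) (k : ℕ)
    (hτ : 2 * k * α ≤ τ) :
    |∫ ω, Real.cos (α * Sm X F1 (fun _ => d1) 0 (1 / 2) ω - β) ^ (2 * k) *
      Real.cos (α * Sm X F2 (fun _ => d2) 0 (1 / 2) ω - β) ^ (2 * k) ∂P - mm F1 d1 α β k * mm F2 d2 α β k| ≤
      2 * Real.exp (9 * τ ^ 2 - 2 * p) + 4 * (A ^ (2 * p) * Real.exp (-√(n0 : ℝ))) := by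
  have key := cos_pow_cmp (P := P) (Q := QQ) _ _ _ _ (measurable_Sm hX F1 (fun _ => d1) 0 (1 / 2))
    (measurable_Sm hX F2 (fun _ => d2) 0 (1 / 2)) (measurable_Sm measurable_YY F1 (fun _ => d1) 0 (1 / 2))
    (measurable_Sm measurable_YY F2 (fun _ => d2) 0 (1 / 2)) α β _ τ hα
    (block_cos hX hG F1 F2 h hF1 hF2 d1 d2 τ A h1 h2 h1' h2' hA1 p hp1 hp) (2 * k) (2 * k) 0 0 0
    (by push_cast; simpa using hτ) (by push_cast; simpa using hτ)
  simp only [zero_mul, add_zero, Real.cos_zero, mul_one] at key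
  rwa [Q_indep F1 F2 h _ _ 0 (1 / 2) (fun z => Real.cos (α * z - β) ^ (2 * k))
    (fun z => Real.cos (α * z - β) ^ (2 * k)) (by fun_prop) (by fun_prop)] at key

lemma block_one (hX : ∀ n, Measurable (X n)) {n0 : ℕ} (hG : GoodAt P X n0) (F1 : Finset ℕ)
    (hF1 : ∀ n ∈ F1, n0 ≤ n) (d1 τ A : ℝ)
    (h1 : F1.card * d1 ^ 2 ≤ 4)
    (h1' : τ * (F1.card * |d1|) ≤ A / 2) (hA1 : 1 ≤ A)
    (p : ℕ) (hp1 : 1 ≤ p) (hp : ((2 * p : ℕ) : ℝ) ≤ Real.log n0) (α β : ℝ) (hα : 0 ≤ α) (k : ℕ)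
    (hτ : 2 * k * α ≤ τ) :
    |∫ ω, Real.cos (α * Sm X F1 (fun _ => d1) 0 (1 / 2) ω - β) ^ (2 * k) ∂P - mm F1 d1 α β k| ≤
      2 * Real.exp (9 * τ ^ 2 - 2 * p) + 4 * (A ^ (2 * p) * Real.exp (-√(n0 : ℝ))) := by
  have hτ0 : 0 ≤ τ := le_trans (by positivity) hτ
  have key := cos_pow_cmp (P := P) (Q := QQ) _ _ _ _ (measurable_Sm hX F1 (fun _ => d1) 0 (1 / 2))
    (measurable_Sm hX ∅ (fun _ => 0) 0 (1 / 2)) (measurable_Sm measurable_YY F1 (fun _ => d1) 0 (1 / 2))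
    (measurable_Sm measurable_YY ∅ (fun _ => 0) 0 (1 / 2)) α β _ τ hα
    (block_cos hX hG F1 ∅ (Finset.disjoint_empty_right _) hF1 (by simp) d1 0 τ A h1 (by simp) h1'
      (by simp; linarith) hA1 p hp1 hp) (2 * k) 0 0 0 0
    (by push_cast; simpa using hτ) (by simpa using hτ0)
  simp only [zero_mul, add_zero, Real.cos_zero, mul_one, pow_zero] at key
  exact key

end

lemma cosh_lower (y : ℝ) : 1 + y ^ 2 / 2 ≤ Real.cosh y := by
  have h := Real.hasSum_cosh y
  have := h.summable.sum_le_tsum (Finset.range 2) (fun j _ => by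
    have : 0 ≤ y ^ (2 * j) := by rw [pow_mul]; positivity
    positivity)
  rw [h.tsum_eq] at this
  simpa [Finset.sum_range_succ] using this

lemma exp_le_one_add (y : ℝ) (hy : 0 ≤ y) : Real.exp (y - y ^ 2) ≤ 1 + y := by
  have h := Real.add_one_le_exp (-(y / (1 + y)))
  have h2 : -(y / (1 + y)) + 1 = (1 + y)⁻¹ := by field_simp; ring
  rw [h2, Real.exp_neg] at h
  have h3 := (inv_le_inv₀ (by positivity) (Real.exp_pos _)).1 h
  refine le_trans (Real.exp_le_exp.2 ?_) h3
  rw [le_div_iff₀ (by positivity)]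
  nlinarith [pow_nonneg hy 3]

lemma mgf_lower (F : Finset ℕ) (d t : ℝ) (hF : 0 < F.card) (hd : F.card * d ^ 2 = 4) (ht : t ^ 4 ≤ F.card) :
    3 / 4 * Real.exp (t ^ 2 / 2) ≤ ∫ ω, Real.exp (t * Sm YY F (fun _ => d) 0 (1 / 2) ω) ∂QQ := by
  rw [mgf_Q]
  have h1 : ∀ n ∈ F, ∫ ω, Real.exp (t * d * (ind 0 (1 / 2) (YY n ω) - (1 / 2 - 0))) ∂QQ = Real.cosh (t * d / 2) := by
    intro n _
    rw [mgf1 n 0 (1 / 2) _ le_rfl (by norm_num) (by norm_num), Real.cosh_eq]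
    ring_nf
  rw [Finset.prod_congr rfl h1, Finset.prod_const]
  have hn : (0:ℝ) < F.card := by exact_mod_cast hF
  have hc : Real.exp ((t * d / 2) ^ 2 / 2 - ((t * d / 2) ^ 2 / 2) ^ 2) ≤ Real.cosh (t * d / 2) :=
    (exp_le_one_add _ (by positivity)).trans (cosh_lower _)
  have e : (F.card : ℝ) * ((t * d / 2) ^ 2 / 2 - ((t * d / 2) ^ 2 / 2) ^ 2) ≥ t ^ 2 / 2 - 1 / 4 := by
    have hd2 : d ^ 2 = 4 / F.card := by field_simp; linarith
    have : (t * d / 2) ^ 2 = t ^ 2 / F.card := by rw [div_pow, mul_pow, hd2]; field_simp; norm_num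
    rw [this]
    have : (F.card : ℝ) * (t ^ 2 / F.card / 2 - (t ^ 2 / F.card / 2) ^ 2) = t ^ 2 / 2 - t ^ 4 / F.card / 4 := by
      field_simp; ring
    rw [this]
    have : t ^ 4 / F.card ≤ 1 := (div_le_one hn).2 ht
    linarith
  calc 3 / 4 * Real.exp (t ^ 2 / 2) ≤ Real.exp (-(1 / 4)) * Real.exp (t ^ 2 / 2) := by
        gcongr
        have := Real.add_one_le_exp (-(1 / 4 : ℝ)); linarith
    _ = Real.exp (t ^ 2 / 2 - 1 / 4) := by rw [← Real.exp_add]; ring_nf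
    _ ≤ Real.exp ((F.card : ℝ) * ((t * d / 2) ^ 2 / 2 - ((t * d / 2) ^ 2 / 2) ^ 2)) := Real.exp_le_exp.2 e
    _ = Real.exp ((t * d / 2) ^ 2 / 2 - ((t * d / 2) ^ 2 / 2) ^ 2) ^ F.card := by rw [Real.exp_nat_mul]
    _ ≤ _ := by gcongr

lemma tilt_point (s u h : ℝ) (hu : 0 ≤ u) (hh : 0 ≤ h) (g ρ : ℝ) (hg : 0 ≤ g) (hρ : 0 ≤ ρ) (hgρ : |s - u| ≤ h → ρ ≤ g) :
    ρ * Real.exp (-(u * (u + h))) * (Real.exp (u * s) - Real.exp ((u + h) * s) * Real.exp (-(h * (u + h))) -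
      Real.exp ((u - h) * s) * Real.exp (h * (u - h))) ≤ g := by
  rw [← Real.exp_add, ← Real.exp_add]
  have p1 := Real.exp_pos ((u + h) * s + -(h * (u + h)))
  have p2 := Real.exp_pos ((u - h) * s + h * (u - h))
  have p3 := Real.exp_pos (-(u * (u + h)))
  by_cases hs : |s - u| ≤ h
  · refine le_trans ?_ (hgρ hs)
    rw [mul_assoc]
    refine mul_le_of_le_one_right hρ ?_
    have : Real.exp (-(u * (u + h))) * Real.exp (u * s) ≤ 1 := by
      rw [← Real.exp_add]
      refine Real.exp_le_one_iff.2 ?_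
      have := (abs_le.1 hs).2
      nlinarith
    nlinarith [mul_pos p3 p1, mul_pos p3 p2]
  · refine le_trans ?_ hg
    refine mul_nonpos_of_nonneg_of_nonpos (by positivity) ?_
    push Not at hs
    rcases lt_abs.1 hs with h1 | h1
    · have : Real.exp (u * s) ≤ Real.exp ((u + h) * s + -(h * (u + h))) := Real.exp_le_exp.2 (by nlinarith)
      linarith
    · have : Real.exp (u * s) ≤ Real.exp ((u - h) * s + h * (u - h)) := Real.exp_le_exp.2 (by nlinarith)
      linarith

lemma lower_m (F : Finset ℕ) (d u h : ℝ) (hF : 0 < F.card) (hd : F.card * d ^ 2 = 4) (hu4 : u ^ 4 ≤ F.card)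
    (hu : 0 ≤ u) (hh : 0 ≤ h) (hh2 : Real.exp (-(h ^ 2 / 2)) ≤ 1 / 4)
    (α β : ℝ) (k : ℕ) (ρ : ℝ) (hρ : 0 ≤ ρ) (hgρ : ∀ s : ℝ, |s - u| ≤ h → ρ ≤ Real.cos (α * s - β) ^ (2 * k)) :
    ρ * (1 / 4 * Real.exp (-(u ^ 2 / 2 + u * h))) ≤ mm F d α β k := by
  have ii : ∀ f : ℝ → ℝ, Continuous f → Integrable (fun ω => f (Sm YY F (fun _ => d) 0 (1 / 2) ω)) QQ :=
    fun f hf => integrable_Sm_fun QQ YY measurable_YY F _ 0 (1 / 2) le_rfl (by norm_num) (by norm_num) f hf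
  have hup : ∀ t : ℝ, ∫ ω, Real.exp (t * Sm YY F (fun _ => d) 0 (1 / 2) ω) ∂QQ ≤ Real.exp (t ^ 2 / 2) := by
    intro t
    refine (mgf_hoeff F _ 0 (1 / 2) t le_rfl (by norm_num) (by norm_num)).trans (le_of_eq ?_)
    rw [Finset.sum_const, nsmul_eq_mul, hd]; ring_nf
  have h1 := mgf_lower F d u hF hd hu4
  have h2 := hup (u + h)
  have h3 := hup (u - h)
  have hmono : ∫ ω, ρ * Real.exp (-(u * (u + h))) * (Real.exp (u * Sm YY F (fun _ => d) 0 (1 / 2) ω) -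
      Real.exp ((u + h) * Sm YY F (fun _ => d) 0 (1 / 2) ω) * Real.exp (-(h * (u + h))) -
      Real.exp ((u - h) * Sm YY F (fun _ => d) 0 (1 / 2) ω) * Real.exp (h * (u - h))) ∂QQ ≤ mm F d α β k := by
    unfold mm
    refine integral_mono (ii (fun s => ρ * Real.exp (-(u * (u + h))) * (Real.exp (u * s) -
      Real.exp ((u + h) * s) * Real.exp (-(h * (u + h))) -
      Real.exp ((u - h) * s) * Real.exp (h * (u - h)))) (by fun_prop))
      (ii (fun s => Real.cos (α * s - β) ^ (2 * k)) (by fun_prop)) fun ω => ?_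
    exact tilt_point _ u h hu hh _ ρ (by rw [pow_mul]; positivity) hρ (hgρ _)
  refine le_trans ?_ hmono
  rw [integral_const_mul, integral_sub (ii (fun s => Real.exp (u * s) -
      Real.exp ((u + h) * s) * Real.exp (-(h * (u + h)))) (by fun_prop))
      (ii (fun s => Real.exp ((u - h) * s) * Real.exp (h * (u - h))) (by fun_prop)),
    integral_sub (ii (fun s => Real.exp (u * s)) (by fun_prop))
      (ii (fun s => Real.exp ((u + h) * s) * Real.exp (-(h * (u + h)))) (by fun_prop)),
    integral_mul_const, integral_mul_const, mul_assoc]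
  refine mul_le_mul_of_nonneg_left ?_ hρ
  set E := Real.exp (u ^ 2 / 2)
  have hE : 0 < E := Real.exp_pos _
  have k2 : (∫ ω, Real.exp ((u + h) * Sm YY F (fun _ => d) 0 (1 / 2) ω) ∂QQ) * Real.exp (-(h * (u + h))) ≤ E * (1 / 4) := by
    calc _ ≤ Real.exp ((u + h) ^ 2 / 2) * Real.exp (-(h * (u + h))) := by gcongr
      _ = E * Real.exp (-(h ^ 2 / 2)) := by rw [← Real.exp_add, ← Real.exp_add]; ring_nf
      _ ≤ _ := by gcongr
  have k3 : (∫ ω, Real.exp ((u - h) * Sm YY F (fun _ => d) 0 (1 / 2) ω) ∂QQ) * Real.exp (h * (u - h)) ≤ E * (1 / 4) := by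
    calc _ ≤ Real.exp ((u - h) ^ 2 / 2) * Real.exp (h * (u - h)) := by gcongr
      _ = E * Real.exp (-(h ^ 2 / 2)) := by rw [← Real.exp_add, ← Real.exp_add]; ring_nf
      _ ≤ _ := by gcongr
  calc 1 / 4 * Real.exp (-(u ^ 2 / 2 + u * h)) = Real.exp (-(u * (u + h))) * (1 / 4 * E) := by
        rw [mul_left_comm, ← Real.exp_add]; ring_nf
    _ ≤ _ := by
        refine mul_le_mul_of_nonneg_left ?_ (Real.exp_pos _).le
        linarith

end LIL

namespace LIL
open ProbabilityTheory

/-- geometric blocks -/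
def FF (g j : ℕ) : Finset ℕ := Finset.Ioc (2 ^ (g * j)) (2 ^ (g * (j + 1)))

noncomputable def dd (g j : ℕ) : ℝ := 2 / √((FF g j).card : ℝ)

lemma FF_card (g j : ℕ) : ((FF g j).card : ℝ) = 2 ^ (g * (j + 1)) - 2 ^ (g * j) := by
  have : (2:ℕ) ^ (g * j) ≤ 2 ^ (g * (j + 1)) := Nat.pow_le_pow_right (by norm_num) (by nlinarith)
  rw [FF, Nat.card_Ioc, Nat.cast_sub this]; push_cast; rfl

lemma FF_card_lower (g j : ℕ) (hg : 1 ≤ g) : (2:ℝ) ^ (g * j) ≤ (FF g j).card := by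
  have : (2:ℝ) ^ (g * j + 1) ≤ 2 ^ (g * (j + 1)) := pow_le_pow_right₀ (by norm_num) (by nlinarith)
  rw [FF_card]; rw [pow_succ] at this; linarith

lemma FF_card_pos (g j : ℕ) (hg : 1 ≤ g) : (0:ℝ) < (FF g j).card :=
  lt_of_lt_of_le (by positivity) (FF_card_lower g j hg)

lemma FF_dd (g j : ℕ) (hg : 1 ≤ g) : (FF g j).card * dd g j ^ 2 = 4 := by
  have := FF_card_pos g j hg
  rw [dd, div_pow, Real.sq_sqrt this.le]; field_simp; norm_num

lemma FF_dd' (g j : ℕ) : (FF g j).card * |dd g j| = 2 * √((FF g j).card : ℝ) := by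
  rw [dd, abs_of_nonneg (by positivity), mul_div_assoc', mul_comm, mul_div_assoc, Real.div_sqrt]

lemma FF_ge (g j J n : ℕ) (h : J ≤ j) (hn : n ∈ FF g j) : 2 ^ (g * J) ≤ n := by
  have h1 := (Finset.mem_Ioc.1 hn).1
  have : (2:ℕ) ^ (g * J) ≤ 2 ^ (g * j) := Nat.pow_le_pow_right (by norm_num) (Nat.mul_le_mul_left _ h)
  omega

lemma FF_disj (g i j : ℕ) (h : i ≠ j) : Disjoint (FF g i) (FF g j) := by
  wlog hij : i < j generalizing i j
  · exact (this j i h.symm (by omega)).symm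
  rw [Finset.disjoint_left]
  intro n h1 h2
  have a1 := (Finset.mem_Ioc.1 h1).2
  have a2 := (Finset.mem_Ioc.1 h2).1
  have : (2:ℕ) ^ (g * (i + 1)) ≤ 2 ^ (g * j) := Nat.pow_le_pow_right (by norm_num) (Nat.mul_le_mul_left _ hij)
  omega

lemma cos_pow_lower (x y : ℝ) (k : ℕ) (hy : |y| ≤ x) (hx : x ≤ 1) :
    Real.exp (-(2 * k * x ^ 2)) ≤ Real.cos y ^ (2 * k) := by
  have h0 : 0 ≤ x := (abs_nonneg _).trans hy
  have h1 : y ^ 2 ≤ x ^ 2 := by rw [← sq_abs]; gcongr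
  have h2 := Real.one_sub_sq_div_two_le_cos (x := y)
  have h3 : Real.exp (-x ^ 2) ≤ 1 - x ^ 2 / 2 := by
    have h4 := Real.add_one_le_exp (x ^ 2)
    rw [Real.exp_neg, inv_le_iff_one_le_mul₀ (Real.exp_pos _)]
    have hx2 : x ^ 2 ≤ 1 := by nlinarith
    calc (1:ℝ) ≤ (1 - x ^ 2 / 2) * (x ^ 2 + 1) := by nlinarith [sq_nonneg x]
      _ ≤ _ := mul_le_mul_of_nonneg_left h4 (by linarith)
  calc Real.exp (-(2 * k * x ^ 2)) = Real.exp (-x ^ 2) ^ (2 * k) := by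
        rw [← Real.exp_nat_mul]; push_cast; ring_nf
    _ ≤ _ := by
      apply pow_le_pow_left₀ (Real.exp_pos _).le
      linarith

lemma cos_pow_upper (y : ℝ) (k : ℕ) (hy : |y| ≤ Real.pi / 2) :
    Real.cos y ^ (2 * k) ≤ Real.exp (-(4 * k * y ^ 2 / Real.pi ^ 2)) := by
  have h1 := Real.cos_le_one_sub_mul_cos_sq (x := y) (by linarith [Real.pi_pos])
  have h2 := Real.cos_nonneg_of_mem_Icc (x := y) ⟨by linarith [neg_abs_le y], by linarith [le_abs_self y]⟩
  have h3 := Real.add_one_le_exp (-(2 / Real.pi ^ 2 * y ^ 2))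
  calc Real.cos y ^ (2 * k) ≤ Real.exp (-(2 / Real.pi ^ 2 * y ^ 2)) ^ (2 * k) := by
        apply pow_le_pow_left₀ h2; linarith
    _ = _ := by rw [← Real.exp_nat_mul]; push_cast; ring_nf

noncomputable def al (L : ℝ) : ℝ := Real.pi / (36 * √L)
noncomputable def kk (ε L : ℝ) : ℕ := ⌈36 ^ 2 * L / ε ^ 2⌉₊

section
variable {Ω : Type*} [MeasurableSpace Ω] {P : Measure Ω} [IsProbabilityMeasure P]
  {X : ℕ → Ω → ℝ}

lemma mm_lower (g j : ℕ) (hg : 1 ≤ g) (ε L : ℝ) (hε : 0 < ε) (hε1 : ε ≤ 1 / 4) (hL1 : 1 ≤ L) (hL : 1600 ≤ ε ^ 4 * L)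
    (hc : 4 * L ^ 2 ≤ (FF g j).card) :
    1 / 4 * Real.exp (-((1 - ε) * L)) ≤ mm (FF g j) (dd g j) (al L) (al L * ((√2 - ε) * √L)) (kk ε L) := by
  have hs : √L ^ 2 = L := Real.sq_sqrt (by linarith)
  have hs0 : 0 < √L := Real.sqrt_pos.2 (by linarith)
  have h2 : √2 ^ 2 = 2 := Real.sq_sqrt (by norm_num)
  have h20 : 1.41 ≤ √2 := Real.le_sqrt_of_sq_le (by norm_num)
  have h21 : √2 ≤ 1.42 := Real.sqrt_le_iff.2 ⟨by norm_num, by norm_num⟩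
  have hpi := Real.pi_pos
  have hpi2 := Real.pi_le_four
  have hpi3 : Real.pi ^ 2 ≤ 10 := by nlinarith [Real.pi_lt_d2]
  have hk : (kk ε L : ℝ) ≤ 2 * (36 ^ 2 * L / ε ^ 2) := by
    have h1 : 1 ≤ 36 ^ 2 * L / ε ^ 2 := by
      rw [le_div_iff₀ (by positivity)]; nlinarith
    have := (Nat.ceil_lt_add_one (a := 36 ^ 2 * L / ε ^ 2) (by positivity)).le
    unfold kk; linarith
  have key := lower_m (FF g j) (dd g j) ((√2 - ε) * √L) (ε ^ 2 / 20 * √L) (by exact_mod_cast FF_card_pos g j hg)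
    (FF_dd g j hg) ?_ (by apply mul_nonneg <;> linarith) (by positivity) ?_ (al L) (al L * ((√2 - ε) * √L)) (kk ε L)
    (Real.exp (-(ε ^ 2 / 10 * L))) (Real.exp_pos _).le ?_
  · refine le_trans ?_ key
    rw [mul_left_comm, ← Real.exp_add]
    gcongr
    have e : ((√2 - ε) * √L) ^ 2 / 2 + (√2 - ε) * √L * (ε ^ 2 / 20 * √L) + ε ^ 2 / 10 * L =
       ((√2 - ε) ^ 2 / 2 + (√2 - ε) * (ε ^ 2 / 20) + ε ^ 2 / 10) * L := by
      rw [mul_pow, hs]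
      linear_combination (√2 - ε) * ε ^ 2 / 20 * hs
    have e2 : ((√2 - ε) ^ 2 / 2 + (√2 - ε) * (ε ^ 2 / 20) + ε ^ 2 / 10) ≤ 1 - ε := by
      nlinarith
    have e3 := mul_le_mul_of_nonneg_right e2 (by linarith : 0 ≤ L)
    linarith
  · calc ((√2 - ε) * √L) ^ 4 = ((√2 - ε) ^ 2 * √L ^ 2) ^ 2 := by ring
      _ ≤ (2 * L) ^ 2 := by
        rw [hs]
        apply pow_le_pow_left₀ (by positivity)
        gcongr
        nlinarith
      _ = 4 * L ^ 2 := by ring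
      _ ≤ _ := hc
  · have : 2 ≤ (ε ^ 2 / 20 * √L) ^ 2 / 2 := by
      rw [mul_pow, hs]; nlinarith
    calc Real.exp (-((ε ^ 2 / 20 * √L) ^ 2 / 2)) ≤ Real.exp (-2) := by gcongr
      _ ≤ 1 / 4 := by
        rw [Real.exp_neg, inv_le_comm₀ (Real.exp_pos _) (by norm_num)]
        have := Real.add_one_le_exp (1:ℝ)
        have h4 : Real.exp 2 = Real.exp 1 * Real.exp 1 := by rw [← Real.exp_add]; norm_num
        rw [h4]; nlinarith
  · intro s hs1
    have hx : |al L * s - al L * ((√2 - ε) * √L)| ≤ Real.pi * ε ^ 2 / 720 := by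
      rw [← mul_sub, abs_mul, abs_of_nonneg (by unfold al; positivity)]
      calc al L * |s - (√2 - ε) * √L| ≤ al L * (ε ^ 2 / 20 * √L) := by
            gcongr; unfold al; positivity
        _ = _ := by unfold al; field_simp; norm_num
    refine le_trans ?_ (cos_pow_lower _ _ (kk ε L) hx (by nlinarith))
    refine Real.exp_le_exp.2 (neg_le_neg ?_)
    calc 2 * (kk ε L : ℝ) * (Real.pi * ε ^ 2 / 720) ^ 2 ≤ 2 * (2 * (36 ^ 2 * L / ε ^ 2)) * (Real.pi * ε ^ 2 / 720) ^ 2 := by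
          gcongr
      _ = Real.pi ^ 2 * (ε ^ 2 * L / 100) := by field_simp; norm_num
      _ ≤ 10 * (ε ^ 2 * L / 100) := by gcongr
      _ = _ := by ring

set_option maxHeartbeats 800000 in
lemma lower_prob (hG : Good P X) (g : ℕ) (hg : 1 ≤ g) (ε : ℝ) (hε : 0 < ε) (hε1 : ε ≤ 1 / 4) :
    ∀ᶠ J : ℕ in atTop, P.real {ω | ∑ j ∈ Finset.Ico J (2 * J),
      Real.cos (al (Real.log J) * Sm X (FF g j) (fun _ => dd g j) 0 (1 / 2) ω -
        al (Real.log J) * ((√2 - ε) * √(Real.log J))) ^ (2 * kk ε (Real.log J)) ≤ (J:ℝ) ^ ε / 8} ≤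
      304 * ((J:ℝ) ^ ε)⁻¹ := by
  set τ0 : ℝ := 144 * Real.pi / ε ^ 2 with hτ0
  set C : ℝ := 9 * τ0 ^ 2 + 4 with hC
  have hτ0p : 0 < τ0 := by positivity
  have hCp : 0 < C := by positivity
  have tcast := tendsto_natCast_atTop_atTop (R := ℝ)
  have tg : Tendsto (fun J : ℕ => g * J) atTop atTop :=
    tendsto_atTop_mono (fun J => Nat.le_mul_of_pos_left J hg) tendsto_id
  filter_upwards [(tendsto_two_pow_nat.comp tg).eventually (good_at hG), tg.eventually err_small,
    (Real.tendsto_log_atTop.comp tcast).eventually (eventually_ge_atTop 1),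
    (Real.tendsto_log_atTop.comp tcast).eventually (eventually_ge_atTop (1600 / ε ^ 4)),
    tcast.eventually (ev_log' (4 * (C + 1)) 1 (by positivity) (by norm_num)),
    tcast.eventually (ev_log' τ0 1 (by positivity) (by norm_num)),
    tcast.eventually (ev_log' 2 (1 / 2) (by positivity) (by norm_num)),
    tcast.eventually (ev_const 4 ε hε), eventually_ge_atTop 1] with J hGJ herr hL1 hL2 hCJ hτJ hLJ hM hJ1
  simp only [Function.comp] at hGJ hL1 hL2
  rw [Real.rpow_one] at hCJ hτJ
  set L := Real.log (J:ℝ) with hL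
  have hJ0 : (0:ℝ) < J := by exact_mod_cast hJ1
  have hJ1R : (1:ℝ) ≤ J := by exact_mod_cast hJ1
  have hL0 : 0 < L := by linarith
  have hs : √L ^ 2 = L := Real.sq_sqrt (by linarith)
  have hs1 : 1 ≤ √L := Real.one_le_sqrt.2 hL1
  have hsL : √L ≤ L := by nlinarith
  have hpi := Real.pi_pos
  have hexpL : Real.exp L = J := Real.exp_log hJ0
  have hJ2 : (J:ℝ) ≤ 2 ^ J := by exact_mod_cast (Nat.lt_two_pow_self (n := J)).le
  have hJg : (2:ℝ) ^ J ≤ 2 ^ (g * J) := pow_le_pow_right₀ (by norm_num) (Nat.le_mul_of_pos_left J hg)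
  set p := ⌈C * L⌉₊ with hp
  have hpl : C * L ≤ p := Nat.le_ceil _
  have hpu : (p:ℝ) ≤ (C + 1) * L := by
    have := (Nat.ceil_lt_add_one (a := C * L) (by positivity)).le
    linarith
  have hp1 : 1 ≤ p := Nat.one_le_ceil_iff.2 (by positivity)
  have hp4 : 4 * (p:ℝ) ≤ J := by linarith
  have hpJ : p ≤ g * J := by
    have : 4 * p ≤ J := by exact_mod_cast hp4
    nlinarith
  have hplog : ((2 * p : ℕ) : ℝ) ≤ Real.log ((2 ^ (g * J) : ℕ) : ℝ) := by
    push_cast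
    rw [Real.log_pow]
    have h1 : (J:ℝ) ≤ (g * J : ℕ) := by exact_mod_cast Nat.le_mul_of_pos_left J hg
    nlinarith [Real.log_two_gt_d9]
  set τ := τ0 * √L with hτ
  have hτ1 : 2 * (kk ε L : ℝ) * al L ≤ τ := by
    have hk : (kk ε L : ℝ) ≤ 2 * (36 ^ 2 * L / ε ^ 2) := by
      have h1 : 1 ≤ 36 ^ 2 * L / ε ^ 2 := by
        rw [le_div_iff₀ (by positivity)]; nlinarith
      have := (Nat.ceil_lt_add_one (a := 36 ^ 2 * L / ε ^ 2) (by positivity)).le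
      unfold kk; linarith
    have ha : 0 ≤ al L := by unfold al; positivity
    calc 2 * (kk ε L : ℝ) * al L ≤ 2 * (2 * (36 ^ 2 * (√L ^ 2) / ε ^ 2)) * al L := by
          rw [hs]; gcongr
      _ = τ := by
        rw [hτ, hτ0]; unfold al; field_simp; norm_num
  have hτle : τ ≤ 2 ^ (g * J) := by
    calc τ ≤ τ0 * L := by rw [hτ]; gcongr
      _ ≤ J := hτJ
      _ ≤ _ := hJ2.trans hJg
  have ha : 0 ≤ al L := by unfold al; positivity
  have hcA : ∀ j ∈ Finset.Ico J (2 * J), τ * ((FF g j).card * |dd g j|) ≤ 4 ^ (g * J + 1) / 2 := by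
    intro j hj
    have hj2 := (Finset.mem_Ico.1 hj).2
    rw [FF_dd']
    have : √((FF g j).card : ℝ) ≤ 2 ^ (g * J) := by
      rw [Real.sqrt_le_left (by positivity), FF_card, ← pow_mul]
      have h1 : (2:ℝ) ^ (g * (j + 1)) ≤ 2 ^ (g * J * 2) := pow_le_pow_right₀ (by norm_num) (by nlinarith)
      have h2 : (0:ℝ) < 2 ^ (g * j) := by positivity
      linarith
    calc τ * (2 * √((FF g j).card : ℝ)) ≤ 2 ^ (g * J) * (2 * 2 ^ (g * J)) := by gcongr
      _ = _ := by
        rw [show (4:ℝ) = 2 * 2 by norm_num, mul_pow]; ring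
  have herrs : 2 * Real.exp (9 * τ ^ 2 - 2 * p) + 4 * ((4 ^ (g * J + 1) : ℝ) ^ (2 * p) * Real.exp (-√((2 ^ (g * J) : ℕ) : ℝ))) ≤
      6 * ((J:ℝ) ^ 4)⁻¹ := by
    have h1 : Real.exp (9 * τ ^ 2 - 2 * p) ≤ ((J:ℝ) ^ 4)⁻¹ := by
      calc Real.exp (9 * τ ^ 2 - 2 * p) ≤ Real.exp (-(4 * L)) := by
            gcongr
            rw [hτ, mul_pow, hs]
            have : 0 ≤ τ0 ^ 2 * L := by positivity
            have hx : C * L = 9 * (τ0 ^ 2 * L) + 4 * L := by rw [hC]; ring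
            nlinarith
        _ = _ := by rw [Real.exp_neg, ← hexpL, ← Real.exp_nat_mul]; norm_num
    have h2 := herr p hpJ (4 ^ (g * J + 1)) (by positivity) le_rfl
    have h3 : ((1:ℝ) / 64) ^ (g * J) ≤ ((J:ℝ) ^ 4)⁻¹ := by
      rw [one_div, inv_pow]
      gcongr
      calc (J:ℝ) ^ 4 ≤ (2 ^ (g * J)) ^ 4 := by gcongr; exact hJ2.trans hJg
        _ = 16 ^ (g * J) := by rw [← pow_mul, mul_comm, pow_mul]; norm_num
        _ ≤ _ := by gcongr; norm_num
    linarith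
  have hm : ∀ j ∈ Finset.Ico J (2 * J), 1 / 4 * ((J:ℝ) ^ ε / J) ≤
      mm (FF g j) (dd g j) (al L) (al L * ((√2 - ε) * √L)) (kk ε L) := by
    intro j hj
    refine le_trans (le_of_eq ?_) (mm_lower g j hg ε L hε hε1 hL1 (by
      rw [div_le_iff₀ (by positivity)] at hL2; linarith) ?_)
    · rw [show -((1 - ε) * L) = L * ε - L by ring, Real.exp_sub, hexpL, Real.rpow_def_of_pos hJ0]
    · refine le_trans ?_ (FF_card_lower g j hg)
      calc 4 * L ^ 2 = (2 * L) ^ 2 := by ring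
        _ ≤ ((J:ℝ) ^ (1 / 2 : ℝ)) ^ 2 := by gcongr
        _ = J := by rw [← Real.rpow_natCast, ← Real.rpow_mul hJ0.le]; norm_num
        _ ≤ 2 ^ (g * J) := hJ2.trans hJg
        _ ≤ _ := pow_le_pow_right₀ (by norm_num) (Nat.mul_le_mul_left _ (Finset.mem_Ico.1 hj).1)
  have hm1 : ∀ j, mm (FF g j) (dd g j) (al L) (al L * ((√2 - ε) * √L)) (kk ε L) ≤ 1 := by
    intro j
    unfold mm
    calc _ ≤ ∫ _ω, (1:ℝ) ∂QQ := by
          refine integral_mono (integrable_Sm_fun QQ YY measurable_YY (FF g j) _ 0 (1 / 2) le_rfl (by norm_num) (by norm_num)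
            (fun s => Real.cos (al L * s - al L * ((√2 - ε) * √L)) ^ (2 * kk ε L)) (by fun_prop)) (integrable_const _) ?_
          intro ω
          simp only
          rw [pow_mul]
          exact pow_le_one₀ (sq_nonneg _) (Real.cos_sq_le_one _)
      _ = 1 := by simp
  set M := ∑ j ∈ Finset.Ico J (2 * J), mm (FF g j) (dd g j) (al L) (al L * ((√2 - ε) * √L)) (kk ε L) with hMd
  have hcard : ((Finset.Ico J (2 * J)).card : ℝ) = J := by
    rw [Nat.card_Ico]; congr 1; omega
  have hMl : (J:ℝ) ^ ε / 4 ≤ M := by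
    calc (J:ℝ) ^ ε / 4 = ∑ j ∈ Finset.Ico J (2 * J), 1 / 4 * ((J:ℝ) ^ ε / J) := by
          rw [Finset.sum_const, nsmul_eq_mul, hcard]; field_simp
      _ ≤ M := Finset.sum_le_sum hm
  have hM1 : 1 ≤ M := by linarith
  have sm := second_moment (P := P) (Finset.Ico J (2 * J)) (fun j ω =>
      Real.cos (al L * Sm X (FF g j) (fun _ => dd g j) 0 (1 / 2) ω - al L * ((√2 - ε) * √L)) ^ (2 * kk ε L))
    (fun j => by
      have := measurable_Sm hG.1 (FF g j) (fun _ => dd g j) 0 (1 / 2)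
      fun_prop)
    (fun j ω => by rw [pow_mul]; positivity)
    (fun j ω => by rw [pow_mul]; exact pow_le_one₀ (sq_nonneg _) (Real.cos_sq_le_one _))
    (fun j => mm (FF g j) (dd g j) (al L) (al L * ((√2 - ε) * √L)) (kk ε L))
    (fun j hj => le_trans (by positivity) (hm j hj)) (fun j _ => hm1 j) (6 * ((J:ℝ) ^ 4)⁻¹)
    (fun j hj => (block_one hG.1 hGJ (FF g j) (fun n hn => FF_ge g j J n (Finset.mem_Ico.1 hj).1 hn) (dd g j) τ _
      (FF_dd g j hg).le (hcA j hj) (one_le_pow₀ (by norm_num)) p hp1 hplog _ _ ha _ hτ1).trans herrs)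
    (fun i hi j hj hij => (block_two hG.1 hGJ (FF g i) (FF g j) (FF_disj g i j hij)
      (fun n hn => FF_ge g i J n (Finset.mem_Ico.1 hi).1 hn)
      (fun n hn => FF_ge g j J n (Finset.mem_Ico.1 hj).1 hn) (dd g i) (dd g j) τ _
      (FF_dd g i hg).le (FF_dd g j hg).le (hcA i hi) (hcA j hj) (one_le_pow₀ (by norm_num)) p hp1 hplog _ _ ha _ hτ1).trans herrs)
    (by linarith only [hM1])
  rw [← hMd, hcard] at sm
  refine (measureReal_mono (fun ω hω => ?_) (measure_ne_top _ _)).trans (sm.trans ?_)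
  · simp only [Set.mem_ofPred_eq] at hω ⊢
    exact le_trans hω (by linarith only [hMl])
  · have h1 : 3 * (J:ℝ) ^ 2 * (6 * ((J:ℝ) ^ 4)⁻¹) ≤ 18 := by
      have : 3 * (J:ℝ) ^ 2 * (6 * ((J:ℝ) ^ 4)⁻¹) = 18 * ((J:ℝ) ^ 2)⁻¹ := by field_simp; norm_num
      rw [this]
      have := inv_le_one_of_one_le₀ (one_le_pow₀ hJ1R (n := 2))
      linarith only [this]
    have hJε : 0 < (J:ℝ) ^ ε := by positivity
    rw [div_le_iff₀ (by positivity), ← div_eq_mul_inv (304:ℝ), div_mul_eq_mul_div, le_div_iff₀ hJε]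
    calc 4 * (M + 3 * (J:ℝ) ^ 2 * (6 * ((J:ℝ) ^ 4)⁻¹)) * (J:ℝ) ^ ε ≤ 4 * (M + 18 * M) * (4 * M) := by
          refine mul_le_mul (by linarith only [h1, hM1]) (by linarith only [hMl]) hJε.le (by linarith only [hM1])
      _ = _ := by ring

end
end LIL

namespace LIL
open ProbabilityTheory

lemma close_u (ε L s : ℝ) (hε : 0 < ε) (hL : 1 ≤ L) (hε1 : ε ≤ 1 / 4) (hs : |s| ≤ 16 * √L)
    (h : Real.exp (-L) < Real.cos (al L * s - al L * ((√2 - ε) * √L)) ^ (2 * kk ε L)) :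
    (√2 - 2 * ε) * √L ≤ s := by
  have h21 : √2 ≤ 1.42 := Real.sqrt_le_iff.2 ⟨by norm_num, by norm_num⟩
  have h20 : 1.41 ≤ √2 := Real.le_sqrt_of_sq_le (by norm_num)
  have hq : √L ^ 2 = L := Real.sq_sqrt (by linarith)
  have hq0 : 0 < √L := Real.sqrt_pos.2 (by linarith)
  have hpi := Real.pi_pos
  set u := (√2 - ε) * √L with hu
  have hu0 : 0 ≤ u := mul_nonneg (by linarith) hq0.le
  have hu1 : u ≤ 2 * √L := by rw [hu]; gcongr; linarith
  have hsu : |s - u| ≤ 18 * √L := by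
    have := abs_sub s u
    rw [abs_of_nonneg hu0] at this
    linarith
  rw [← mul_sub] at h
  have ha : 0 ≤ al L := by unfold al; positivity
  have hy : |al L * (s - u)| ≤ Real.pi / 2 := by
    rw [abs_mul, abs_of_nonneg ha]
    calc al L * |s - u| ≤ al L * (18 * √L) := by gcongr
      _ = _ := by unfold al; field_simp; norm_num
  have h1 := Real.exp_lt_exp.1 (h.trans_le (cos_pow_upper _ (kk ε L) hy))
  have hk : 36 ^ 2 * L / ε ^ 2 ≤ kk ε L := Nat.le_ceil _
  have h2 : 4 * (kk ε L : ℝ) * (al L * (s - u)) ^ 2 / Real.pi ^ 2 = 4 * kk ε L * (s - u) ^ 2 / (36 ^ 2 * L) := by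
    unfold al
    rw [mul_pow, div_pow, mul_pow, hq]
    field_simp
  have h3 : 4 * (36 ^ 2 * L / ε ^ 2) * (s - u) ^ 2 / (36 ^ 2 * L) ≤ 4 * kk ε L * (s - u) ^ 2 / (36 ^ 2 * L) := by gcongr
  have h4 : 4 * (36 ^ 2 * L / ε ^ 2) * (s - u) ^ 2 / (36 ^ 2 * L) = 4 * (s - u) ^ 2 / ε ^ 2 := by field_simp
  have h5 : 4 * (s - u) ^ 2 / ε ^ 2 < L := by linarith
  rw [div_lt_iff₀ (by positivity)] at h5
  have h6 : (s - u) ^ 2 ≤ (ε * √L) ^ 2 := by rw [mul_pow, hq]; nlinarith [sq_nonneg (s - u)]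
  have h7 := abs_le_of_sq_le_sq' h6 (by positivity)
  have : (√2 - 2 * ε) * √L = u - ε * √L := by rw [hu]; ring
  linarith [h7.1]

lemma fin_alg (ε a S Q q c TF T1 : ℝ) (hε : 0 < ε) (hε1 : ε ≤ 1 / 4) (ha : 0.7 ≤ a) (ha1 : a ≤ 1)
    (hS : 0 ≤ S) (hQ : 0 ≤ Q) (hq : (1 - ε) * Q ≤ q) (hc : (1 - ε) * S ≤ c)
    (h1 : (a - ε) * q * c ≤ TF) (h2 : |T1| ≤ 2 * (ε * S * Q)) : (a - 6 * ε) * (S * Q) ≤ T1 + TF := by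
  have e1 : (a - ε) * ((1 - ε) * Q) * ((1 - ε) * S) ≤ (a - ε) * q * c := by
    have : 0 ≤ a - ε := by linarith
    have : 0 ≤ 1 - ε := by linarith
    have : 0 ≤ q := le_trans (by positivity) hq
    gcongr
  have e2 : (a - 5 * ε + 2 * ε) * (S * Q) ≤ (a - ε) * ((1 - ε) * Q) * ((1 - ε) * S) := by
    have : (a - ε) * ((1 - ε) * Q) * ((1 - ε) * S) = (a - ε) * (1 - ε) ^ 2 * (S * Q) := by ring
    rw [this]
    have hSQ : 0 ≤ S * Q := by positivity
    refine mul_le_mul_of_nonneg_right ?_ hSQ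
    nlinarith only [mul_nonneg hε.le hε.le, mul_nonneg hε.le (by linarith : 0 ≤ 1 - a), mul_nonneg (mul_nonneg hε.le hε.le) (by linarith : 0 ≤ a - ε)]
  have e3 := neg_abs_le T1
  have hSQ : 0 ≤ ε * (S * Q) := by positivity
  nlinarith

set_option maxHeartbeats 800000 in
lemma det_lower (z : ℕ → ℝ) (g : ℕ) (hg : 1 ≤ g) (ε : ℝ) (hε : 0 < ε) (hε1 : ε ≤ 1 / 4) (hg2 : (1 / 2 : ℝ) ^ g ≤ ε ^ 2)
    (J : ℕ) (hJ1 : 1 ≤ J) (hL : 1 ≤ Real.log J) (hgL : Real.log (2 * g) ≤ ε * Real.log J) (hJε : 8 ≤ (J:ℝ) ^ ε)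
    (hup : ∀ N : ℕ, J ≤ N → |T z (Finset.Icc 1 N) 0 (1 / 2)| ≤ 2 * √(N * Real.log (Real.log N)))
    (hsum : (J:ℝ) ^ ε / 8 < ∑ j ∈ Finset.Ico J (2 * J),
      Real.cos (al (Real.log J) * (dd g j * T z (FF g j) 0 (1 / 2)) -
        al (Real.log J) * ((√2 - ε) * √(Real.log J))) ^ (2 * kk ε (Real.log J))) :
    ∃ N : ℕ, J ≤ N ∧ (1 / √2 - 6 * ε) * √(N * Real.log (Real.log N)) ≤ |T z (Finset.Icc 1 N) 0 (1 / 2)| := by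
  set L := Real.log (J:ℝ) with hLd
  have hJ0 : (0:ℝ) < J := by exact_mod_cast hJ1
  obtain ⟨j, hj, hjc⟩ : ∃ j ∈ Finset.Ico J (2 * J), (1:ℝ) / J <
      Real.cos (al L * (dd g j * T z (FF g j) 0 (1 / 2)) - al L * ((√2 - ε) * √L)) ^ (2 * kk ε L) := by
    by_contra hcon
    push Not at hcon
    have h1 := Finset.sum_le_sum hcon
    rw [Finset.sum_const, nsmul_eq_mul, Nat.card_Ico, show 2 * J - J = J by omega, mul_one_div_cancel hJ0.ne'] at h1
    linarith
  obtain ⟨hj1, hj2⟩ := Finset.mem_Ico.1 hj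
  obtain ⟨N, hN⟩ : ∃ N : ℕ, N = 2 ^ (g * (j + 1)) := ⟨_, rfl⟩
  obtain ⟨N', hN'⟩ : ∃ N : ℕ, N = 2 ^ (g * j) := ⟨_, rfl⟩
  have hlt : ∀ m, m ≤ 2 ^ (g * m) := fun m =>
    (Nat.le_mul_of_pos_left m hg).trans Nat.lt_two_pow_self.le
  have hJN' : J ≤ N' := hN' ▸ hj1.trans (hlt j)
  have hNN : N' ≤ N := by
    rw [hN, hN']
    exact Nat.pow_le_pow_right (by norm_num) (by nlinarith)
  refine ⟨N, hJN'.trans hNN, ?_⟩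
  have hNR : (N:ℝ) = 2 ^ (g * (j + 1)) := by rw [hN]; push_cast; rfl
  have hNR' : (N':ℝ) = 2 ^ (g * j) := by rw [hN']; push_cast; rfl
  have hN'0 : (0:ℝ) < N' := by rw [hNR']; positivity
  have hN0 : (0:ℝ) < N := by rw [hNR]; positivity
  have hN'N : (N':ℝ) ≤ ε ^ 2 * N := by
    calc (N':ℝ) = (1 / 2) ^ g * N := by
          rw [hNR, hNR', mul_add, mul_one, pow_add, mul_left_comm, ← mul_pow]; norm_num
      _ ≤ _ := by gcongr
  have hcard : ((FF g j).card : ℝ) = N - N' := by rw [FF_card, hNR, hNR']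
  -- the iterated logarithms
  have hlogN : Real.log N = g * (j + 1) * Real.log 2 := by rw [hNR, Real.log_pow]; push_cast; ring
  have hlogN' : Real.log N' = g * j * Real.log 2 := by rw [hNR', Real.log_pow]; push_cast; ring
  have hgR : (1:ℝ) ≤ g := by exact_mod_cast hg
  have hl2 := Real.log_two_gt_d9
  have hl2' := Real.log_two_lt_d9
  have hj1R : (J:ℝ) ≤ j := by exact_mod_cast hj1
  have hj2R : (j:ℝ) + 1 ≤ 2 * J := by exact_mod_cast hj2
  have hgj : (0:ℝ) < g * j := mul_pos (by linarith only [hgR]) (by linarith only [hJ0, hj1R])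
  set LL := Real.log (Real.log N) with hLL
  have hLLu : LL ≤ (1 + ε) * L := by
    have : Real.log N ≤ 2 * g * J := by
      rw [hlogN]
      have h1 : (g:ℝ) * (j + 1) ≤ g * (2 * J) := by gcongr
      have h2 : (0:ℝ) ≤ g * (j + 1) := by positivity
      nlinarith only [h1, h2, hl2']
    have h1 : LL ≤ Real.log (2 * g * J) := Real.log_le_log (by rw [hlogN]; positivity) this
    rw [Real.log_mul (by positivity) (by positivity)] at h1
    linarith
  have hLL' : Real.log (Real.log N') ≤ LL := by
    apply Real.log_le_log (by rw [hlogN']; positivity)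
    exact Real.log_le_log hN'0 (by exact_mod_cast hNN)
  have hL0 : 0 < L := by linarith
  have hLL0 : 0 ≤ LL := by
    apply Real.log_nonneg
    rw [hlogN]
    have hJ1R : (1:ℝ) ≤ J := by exact_mod_cast hJ1
    have : 2 ≤ (g:ℝ) * (j + 1) := by nlinarith only [hgR, hJ1R, hj1R]
    nlinarith only [this, hl2]
  -- splitting
  have hT : T z (Finset.Icc 1 N) 0 (1 / 2) = T z (Finset.Icc 1 N') 0 (1 / 2) + T z (FF g j) 0 (1 / 2) := by
    rw [FF, ← hN, ← hN']
    exact T_cons z 0 N' N (Nat.zero_le _) hNN 0 (1 / 2)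
  have hu1 := hup N (hJN'.trans hNN)
  have hu2 := hup N' hJN'
  have hu2' : √(N' * Real.log (Real.log N')) ≤ √(N:ℝ) * √LL * ε := by
    calc √(N' * Real.log (Real.log N')) ≤ √(ε ^ 2 * N * LL) := by
          apply Real.sqrt_le_sqrt
          exact (mul_le_mul_of_nonneg_left hLL' hN'0.le).trans
            (mul_le_mul_of_nonneg_right hN'N hLL0)
      _ = _ := by
        rw [Real.sqrt_mul (by positivity), Real.sqrt_mul (by positivity), Real.sqrt_sq hε.le]; ring
  rw [Real.sqrt_mul hN0.le] at hu1 ⊢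
  have hq1 : (1 - ε) * √LL ≤ √L := by
    apply Real.le_sqrt_of_sq_le
    rw [mul_pow, Real.sq_sqrt hLL0]
    calc (1 - ε) ^ 2 * LL ≤ (1 - ε) ^ 2 * ((1 + ε) * L) := by gcongr
      _ = ((1 - ε) * (1 - ε ^ 2)) * L := by ring
      _ ≤ 1 * L := mul_le_mul_of_nonneg_right (by nlinarith only [hε, hε1, sq_nonneg ε]) hL0.le
      _ = L := one_mul L
  have hε2 : 0 ≤ (ε - ε ^ 2) * N := mul_nonneg (by nlinarith only [hε, hε1]) hN0.le
  have hc1 : (1 - ε) * √(N:ℝ) ≤ √((FF g j).card : ℝ) := by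
    apply Real.le_sqrt_of_sq_le
    rw [mul_pow, Real.sq_sqrt hN0.le, hcard]
    linarith only [hε2, hN'N]
  have hcp : 0 < √((FF g j).card : ℝ) := Real.sqrt_pos.2 (FF_card_pos g j hg)
  have hTF : |T z (FF g j) 0 (1 / 2)| ≤ 3 * (√(N:ℝ) * √LL) := by
    have h1 : T z (FF g j) 0 (1 / 2) = T z (Finset.Icc 1 N) 0 (1 / 2) - T z (Finset.Icc 1 N') 0 (1 / 2) := by
      rw [hT]; ring
    rw [h1]
    have h2 := abs_sub (T z (Finset.Icc 1 N) 0 (1 / 2)) (T z (Finset.Icc 1 N') 0 (1 / 2))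
    have h3 : √(N:ℝ) * √LL * ε ≤ √(N:ℝ) * √LL * (1 / 4) := by gcongr
    have h4 : 0 ≤ √(N:ℝ) * √LL := by positivity
    linarith
  have hddT : dd g j * √((FF g j).card : ℝ) = 2 := by unfold dd; field_simp
  have hdd0 : 0 < dd g j := by unfold dd; positivity
  have hs : |dd g j * T z (FF g j) 0 (1 / 2)| ≤ 16 * √L := by
    rw [abs_mul, abs_of_pos hdd0]
    have h1 : 3 / 4 * √(N:ℝ) ≤ √((FF g j).card : ℝ) := le_trans (by gcongr; linarith) hc1
    have h2 : 3 / 4 * √LL ≤ √L := le_trans (by gcongr; linarith) hq1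
    calc dd g j * |T z (FF g j) 0 (1 / 2)| ≤ dd g j * (3 * (√(N:ℝ) * √LL)) := by gcongr
      _ ≤ dd g j * (3 * ((4 / 3 * √((FF g j).card : ℝ)) * (4 / 3 * √L))) := by
        gcongr <;> linarith
      _ = (dd g j * √((FF g j).card : ℝ)) * (16 / 3 * √L) := by ring
      _ ≤ 16 * √L := by rw [hddT]; linarith [Real.sqrt_nonneg L]
  rw [one_div, ← Real.exp_log hJ0, ← Real.exp_neg] at hjc
  have hcl := close_u ε L _ hε hL hε1 hs hjc
  have h2 : √2 ^ 2 = 2 := Real.sq_sqrt (by norm_num)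
  have h20 : 1.41 ≤ √2 := Real.le_sqrt_of_sq_le (by norm_num)
  have h21 : √2 ≤ 1.42 := Real.sqrt_le_iff.2 ⟨by norm_num, by norm_num⟩
  have hinv : 1 / √2 = √2 / 2 := by field_simp; linarith
  refine le_trans ?_ (le_abs_self _)
  rw [hT]
  refine fin_alg ε (1 / √2) _ _ (√L) (√((FF g j).card : ℝ)) _ _ hε hε1 (by rw [hinv]; linarith) (by rw [hinv]; linarith)
    (Real.sqrt_nonneg _) (Real.sqrt_nonneg _) hq1 hc1 ?_ ?_
  · have e : T z (FF g j) 0 (1 / 2) = dd g j * T z (FF g j) 0 (1 / 2) * √((FF g j).card : ℝ) / 2 := by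
      linear_combination (-1 / 2) * T z (FF g j) 0 (1 / 2) * hddT
    rw [e, hinv]
    have := mul_le_mul_of_nonneg_right hcl hcp.le
    linarith
  · linarith

section
variable {Ω : Type*} [MeasurableSpace Ω] {P : Measure Ω} [IsProbabilityMeasure P]
  {X : ℕ → Ω → ℝ}

theorem lower_LIL (h01 : ∀ n ω, X n ω ∈ Set.Ico (0:ℝ) 1) (hG : Good P X) (ε : ℝ) (hε : 0 < ε) (hε1 : ε ≤ 1 / 4) :
    ∀ᵐ ω ∂P, ∃ᶠ N : ℕ in atTop,
      (1 / √2 - 6 * ε) * √(N * Real.log (Real.log N)) ≤ |T (fun n => X n ω) (Finset.Icc 1 N) 0 (1 / 2)| := by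
  obtain ⟨g, hg2⟩ := exists_pow_lt_of_lt_one (show 0 < ε ^ 2 by positivity) (show (1 / 2 : ℝ) < 1 by norm_num)
  have hg : 1 ≤ g := by
    rcases Nat.eq_zero_or_pos g with h | h
    · subst h; rw [pow_zero] at hg2; nlinarith
    · exact h
  have hev := tendsto_two_pow_nat.eventually (lower_prob hG g hg ε hε hε1)
  have hsumm : Summable (fun κ : ℕ => 304 * (((2 ^ κ : ℕ) : ℝ) ^ ε)⁻¹) := by
    have : (fun κ : ℕ => 304 * (((2 ^ κ : ℕ) : ℝ) ^ ε)⁻¹) = fun κ : ℕ => 304 * (((2:ℝ) ^ ε)⁻¹) ^ κ := by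
      funext κ
      rw [inv_pow]; push_cast
      rw [← Real.rpow_natCast, ← Real.rpow_mul (by norm_num), ← Real.rpow_natCast ((2:ℝ) ^ ε), ← Real.rpow_mul (by norm_num),
        mul_comm (κ:ℝ)]
    rw [this]
    exact (summable_geometric_of_lt_one (by positivity)
      (inv_lt_one_of_one_lt₀ (Real.one_lt_rpow (by norm_num) hε))).mul_left _
  filter_upwards [borel_cantelli _ _ hsumm hev, upper_LIL h01 hG (1 / 4) (by norm_num) (by norm_num)] with ω h1 h2
  rw [frequently_atTop]
  intro N0
  have tcast : Tendsto (fun κ : ℕ => ((2 ^ κ : ℕ) : ℝ)) atTop atTop := tendsto_two_pow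
  have tlog := Real.tendsto_log_atTop.comp tcast
  obtain ⟨κ, k1, k2, k3, k4, k5, k6⟩ := (h1.and (((tendsto_two_pow_nat.eventually (eventually_forall_ge_atTop.2 h2))).and
    ((tendsto_two_pow_nat.eventually (eventually_ge_atTop N0)).and
    ((tlog.eventually (eventually_ge_atTop 1)).and ((tlog.eventually (eventually_ge_atTop (Real.log (2 * g) / ε))).and
    (tcast.eventually (ev_const 8 ε hε))))))).exists
  simp only [Function.comp] at k4 k5
  obtain ⟨N, hN, hfin⟩ := det_lower (fun n => X n ω) g hg ε hε hε1 hg2.le (2 ^ κ) Nat.one_le_two_pow k4 (by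
      rw [div_le_iff₀ hε] at k5; linarith) k6 (fun N hN => by
      refine (k2 N hN 0 (1 / 2) le_rfl (by norm_num) (by norm_num)).trans ?_
      have : 1 / √2 ≤ 1 := by
        rw [div_le_one (by positivity)]
        exact Real.one_le_sqrt.2 (by norm_num)
      gcongr
      linarith) (by
      simp only [not_le] at k1
      refine k1.trans_le (le_of_eq (Finset.sum_congr rfl fun j _ => ?_))
      congr 4
      rw [← Sm_one, Sm, Sm, Finset.mul_sum]
      refine Finset.sum_congr rfl fun n _ => by ring)
  exact ⟨N, k3.trans hN, hfin⟩

end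
end LIL

namespace LIL
open ProbabilityTheory

lemma limsup_eq_of (f : ℕ → ℝ) (c : ℝ) (h1 : ∀ ε > 0, ∀ᶠ N in atTop, f N ≤ c + ε)
    (h2 : ∀ ε > 0, ∃ᶠ N in atTop, c - ε ≤ f N) : atTop.limsup f = c := by
  have hb : IsBoundedUnder (· ≤ ·) atTop f := ⟨c + 1, by simpa using h1 1 one_pos⟩
  have hc : IsCoboundedUnder (· ≤ ·) atTop f := IsCoboundedUnder.of_frequently_ge (h2 1 one_pos)
  apply le_antisymm
  · exact le_of_forall_pos_le_add fun ε hε => limsup_le_of_le hc (h1 ε hε)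
  · refine le_of_forall_pos_le_add fun ε hε => ?_
    have := le_limsup_of_frequently_le (h2 ε hε) hb
    linarith

lemma elem_eq (z : ℕ → ℝ) (N : ℕ) (hN : 0 < N) (a b : ℝ) :
    |(∑ n ∈ Finset.Icc 1 N, Set.indicator (Set.Ico a b) (fun _ => (1 : ℝ)) (z n)) / N - (b - a)| =
      |T z (Finset.Icc 1 N) a b| / N := by
  have hN0 : (0:ℝ) < N := by exact_mod_cast hN
  rw [show |T z (Finset.Icc 1 N) a b| / (N:ℝ) = |T z (Finset.Icc 1 N) a b / N| by rw [abs_div, abs_of_pos hN0]]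
  congr 1
  unfold T ind
  rw [Finset.sum_sub_distrib, Finset.sum_const, Nat.card_Icc, nsmul_eq_mul, sub_div]
  simp only [Nat.add_sub_cancel]
  rw [mul_div_cancel_left₀ _ hN0.ne']

def Up (z : ℕ → ℝ) : Prop := ∀ ε > 0, ∀ᶠ N : ℕ in atTop, ∀ a b : ℝ, 0 ≤ a → a < b → b ≤ 1 →
  |T z (Finset.Icc 1 N) a b| ≤ (1 / √2 + ε) * √(N * Real.log (Real.log N))

def Low (z : ℕ → ℝ) : Prop := ∀ ε > 0, ∃ᶠ N : ℕ in atTop,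
  (1 / √2 - ε) * √(N * Real.log (Real.log N)) ≤ |T z (Finset.Icc 1 N) 0 (1 / 2)|

lemma scale (N : ℕ) (hN : 0 < N) (hL : 0 < Real.log (Real.log N)) (c : ℝ) :
    √(N:ℝ) * (c * √(N * Real.log (Real.log N)) / N) / √(Real.log (Real.log N)) = c := by
  have hN0 : (0:ℝ) < N := by exact_mod_cast hN
  have h1 : √(N:ℝ) * √(N:ℝ) = N := Real.mul_self_sqrt hN0.le
  have h2 := Real.sqrt_pos.2 hL
  rw [Real.sqrt_mul hN0.le, div_eq_iff h2.ne', mul_div_assoc', div_eq_iff hN0.ne']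
  linear_combination c * √(Real.log (Real.log N)) * h1

lemma disc_limsup (z : ℕ → ℝ) (hU : Up z) (hL : Low z) :
    atTop.limsup (fun N : ℕ => √(N:ℝ) * discrepancy N z / √(Real.log (Real.log N))) = 1 / √2 ∧
    atTop.limsup (fun N : ℕ => √(N:ℝ) * starDiscrepancy N z / √(Real.log (Real.log N))) = 1 / √2 := by
  have hev : ∀ᶠ N : ℕ in atTop, 0 < N ∧ 0 < Real.log (Real.log N) :=
    (eventually_gt_atTop 0).and (loglog_tendsto.eventually (eventually_gt_atTop 0))
  refine ⟨limsup_eq_of _ _ (fun ε hε => ?_) fun ε hε => ?_, limsup_eq_of _ _ (fun ε hε => ?_) fun ε hε => ?_⟩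
  · filter_upwards [hU ε hε, hev] with N h ⟨hN, hl⟩
    have : discrepancy N z ≤ (1 / √2 + ε) * √(N * Real.log (Real.log N)) / N := by
      refine csSup_le ⟨_, 0, 1, le_rfl, one_pos, le_rfl, rfl⟩ ?_
      rintro d ⟨a, b, ha, hab, hb, rfl⟩
      rw [elem_eq z N hN]
      exact div_le_div_of_nonneg_right (h a b ha hab hb) (by positivity)
    rw [← scale N hN hl (1 / √2 + ε)]
    gcongr
  · refine ((hL ε hε).and_eventually ((hU 1 one_pos).and hev)).mono ?_
    rintro N ⟨h, hu, hN, hl⟩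
    have : (1 / √2 - ε) * √(N * Real.log (Real.log N)) / N ≤ discrepancy N z := by
      refine le_trans ?_ (le_csSup ?_ ⟨0, 1 / 2, le_rfl, by norm_num, by norm_num, rfl⟩)
      · rw [elem_eq z N hN]
        exact div_le_div_of_nonneg_right h (by positivity)
      · refine ⟨(1 / √2 + 1) * √(N * Real.log (Real.log N)) / N, ?_⟩
        rintro d ⟨a, b, ha, hab, hb, rfl⟩
        rw [elem_eq z N hN]
        exact div_le_div_of_nonneg_right (hu a b ha hab hb) (by positivity)
    rw [← scale N hN hl (1 / √2 - ε)]
    gcongr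
  · filter_upwards [hU ε hε, hev] with N h ⟨hN, hl⟩
    have : starDiscrepancy N z ≤ (1 / √2 + ε) * √(N * Real.log (Real.log N)) / N := by
      refine csSup_le ⟨_, 1, one_pos, le_rfl, rfl⟩ ?_
      rintro d ⟨a, ha, hb, rfl⟩
      have e := elem_eq z N hN 0 a
      rw [sub_zero] at e
      rw [e]
      exact div_le_div_of_nonneg_right (h 0 a le_rfl ha hb) (by positivity)
    rw [← scale N hN hl (1 / √2 + ε)]
    gcongr
  · refine ((hL ε hε).and_eventually ((hU 1 one_pos).and hev)).mono ?_
    rintro N ⟨h, hu, hN, hl⟩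
    have : (1 / √2 - ε) * √(N * Real.log (Real.log N)) / N ≤ starDiscrepancy N z := by
      refine le_trans ?_ (le_csSup ?_ ⟨1 / 2, by norm_num, by norm_num, rfl⟩)
      · have e := elem_eq z N hN 0 (1 / 2)
        rw [sub_zero] at e
        rw [e]
        exact div_le_div_of_nonneg_right h (by positivity)
      · refine ⟨(1 / √2 + 1) * √(N * Real.log (Real.log N)) / N, ?_⟩
        rintro d ⟨a, ha, hb, rfl⟩
        have e := elem_eq z N hN 0 a
        rw [sub_zero] at e
        rw [e]
        exact div_le_div_of_nonneg_right (hu 0 a le_rfl ha hb) (by positivity)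
    rw [← scale N hN hl (1 / √2 - ε)]
    gcongr

lemma ae_UpLow {Ω : Type*} [MeasurableSpace Ω] {P : Measure Ω} [IsProbabilityMeasure P] {X : ℕ → Ω → ℝ}
    (h01 : ∀ n ω, X n ω ∈ Set.Ico (0:ℝ) 1) (hG : Good P X) :
    ∀ᵐ ω ∂P, Up (fun n => X n ω) ∧ Low (fun n => X n ω) := by
  have hu := ae_all_iff.2 fun m : ℕ => upper_LIL h01 hG (1 / (m + 1)) (by positivity)
    (by rw [div_le_one (by positivity)]; linarith [(Nat.cast_nonneg m : (0:ℝ) ≤ m)])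
  have hl := ae_all_iff.2 fun m : ℕ => lower_LIL h01 hG (1 / (m + 4)) (by positivity)
    (by gcongr; linarith [(Nat.cast_nonneg m : (0:ℝ) ≤ m)])
  filter_upwards [hu, hl] with ω h1 h2
  constructor
  · intro ε hε
    obtain ⟨m, hm⟩ := exists_nat_one_div_lt hε
    filter_upwards [h1 m] with N h a b ha hab hb
    refine (h a b ha hab hb).trans ?_
    gcongr
  · intro ε hε
    obtain ⟨m, hm⟩ := exists_nat_one_div_lt (show 0 < ε / 6 by positivity)
    refine (h2 m).mono fun N h => le_trans ?_ h
    have : (1:ℝ) / (m + 4) ≤ 1 / (m + 1) := by gcongr; norm_num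
    gcongr
    linarith

end LIL

theorem stmt0 (s : ℕ → ℕ) (hmono : StrictMono s) (hpos : ∀ n, 1 ≤ n → 1 ≤ s n)
    (ξ : ℝ) (hξ : 0 < ξ) :
    ∀ᵐ x : ℝ ∂volume, 1 < x →
      (Filter.atTop.limsup (fun N : ℕ =>
          Real.sqrt N * discrepancy N (fun n => Int.fract (ξ * x ^ s n))
            / Real.sqrt (Real.log (Real.log N))) = 1 / Real.sqrt 2
       ∧ Filter.atTop.limsup (fun N : ℕ =>
          Real.sqrt N * starDiscrepancy N (fun n => Int.fract (ξ * x ^ s n))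
            / Real.sqrt (Real.log (Real.log N))) = 1 / Real.sqrt 2) := by
  have key : ∀ k : ℕ, ∀ᵐ x : ℝ ∂volume, x ∈ Set.Ioc (1 + 1 / ((k:ℝ) + 1)) (k + 3) →
      LIL.Up (fun n => Int.fract (ξ * x ^ s n)) ∧ LIL.Low (fun n => Int.fract (ξ * x ^ s n)) := by
    intro k
    have hk : (0:ℝ) ≤ k := Nat.cast_nonneg k
    have hA : (1:ℝ) < 1 + 1 / ((k:ℝ) + 1) := by
      have : (0:ℝ) < 1 / ((k:ℝ) + 1) := by positivity
      linarith
    have hAB : 1 + 1 / ((k:ℝ) + 1) < k + 3 := by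
      have : 1 / ((k:ℝ) + 1) ≤ 1 := by rw [div_le_one (by positivity)]; linarith
      linarith
    have := LIL.nrm_prob _ _ hAB
    have h := LIL.ae_UpLow (P := LIL.nrm (1 + 1 / ((k:ℝ) + 1)) (k + 3)) (X := fun n x => Int.fract (ξ * x ^ s n))
      (fun n x => ⟨Int.fract_nonneg _, Int.fract_lt_one _⟩) (LIL.good_nrm _ _ ξ hA hAB hξ s hmono)
    rw [← ae_restrict_iff' measurableSet_Ioc]
    refine Measure.AbsolutelyContinuous.ae_le ?_ h
    rw [LIL.nrm, ProbabilityTheory.cond]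
    exact Measure.absolutelyContinuous_smul (ENNReal.inv_ne_zero.2 (by simp))
  filter_upwards [ae_all_iff.2 key] with x hx h1
  obtain ⟨m, hm⟩ := exists_nat_one_div_lt (show 0 < x - 1 by linarith)
  obtain ⟨m', hm'⟩ := exists_nat_gt x
  have c1 : (m:ℝ) ≤ (max m m' : ℕ) := by exact_mod_cast le_max_left _ _
  have c2 : (m':ℝ) ≤ (max m m' : ℕ) := by exact_mod_cast le_max_right _ _
  have c3 : 1 / (((max m m' : ℕ) : ℝ) + 1) ≤ 1 / ((m:ℝ) + 1) := by gcongr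
  obtain ⟨hU, hL⟩ := hx (max m m') ⟨by linarith, by linarith⟩
  exact LIL.disc_limsup _ hU hL
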